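/- arXiv:1712.09861 — 2 statements merged into one kernel-verified Lean document; each statement's English description precedes it below -/
import Mathlib

section
/- Let q be a power of a prime p ≥ 5. Then there exists an element of F_{q^3} that is simultaneously 2-primitive and 1-normal over F_q. -/
/-- The `F_q`-span of the conjugates `α, α^q, …, α^{q^{n-1}}` of `α ∈ F_{q^n}`. -/
def conjSpan (K : Type*) {L : Type*} [Field K] [Field L] [Algebra K L]
    (q n : ℕ) (α : L) : Submodule K L :=
  Submodule.span K (Set.range fun i : Fin n => α ^ q ^ (i : ℕ))

open Finset

lemma prime_factor_cases {q l : ℕ} (hl : l.Prime) (h3 : l ≠ 3) (h : l ∣ q ^ 2 + q + 1) :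
    l = 7 ∨ l = 13 ∨ l = 19 ∨ 31 ≤ l := by
  by_contra! hcon
  obtain ⟨h7, h13, h19, h31⟩ := hcon
  have key : (q : ZMod l) ^ 2 + q + 1 = 0 := by
    have := (ZMod.natCast_eq_zero_iff _ _).2 h
    push_cast at this
    exact this
  revert key
  generalize (q : ZMod l) = x
  clear h
  have h2 := hl.two_le
  revert x
  interval_cases l <;> first | (exfalso; omega) | decide | (exfalso; revert hl; norm_num)

lemma pow_le_prod_of_seven_or_le {P : Finset ℕ} (h : ∀ l ∈ P, l = 7 ∨ 13 ≤ l) :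
    (7 / 13 : ℝ) * 13 ^ #P ≤ ∏ l ∈ P, (l : ℝ) := by
  calc (7 / 13 : ℝ) * 13 ^ #P ≤ (∏ l ∈ P, if l = 7 then (7 / 13 : ℝ) else 1) * ∏ l ∈ P, (13 : ℝ) := by
        rw [prod_const, Finset.prod_ite_eq']
        gcongr
        split_ifs <;> norm_num
    _ ≤ ∏ l ∈ P, (l : ℝ) := by
        rw [← prod_mul_distrib]
        refine prod_le_prod (fun l _ => by split_ifs <;> norm_num) fun l hl => ?_
        split_ifs with h7
        · subst h7; norm_num
        · have : (13 : ℝ) ≤ l := by exact_mod_cast (h l hl).resolve_left h7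
          linarith

lemma prod_pow_four_le {P : Finset ℕ} (h : ∀ l ∈ P, l = 7 ∨ l = 13 ∨ l = 19 ∨ 31 ≤ l)
    (hk : 7 ≤ #P) :
    ∏ l ∈ P, (2 * (l : ℝ) / (l - 1)) ^ 4 ≤ 0.905 * ∏ l ∈ P, (l : ℝ) := by
  set δ : ℝ := 0.5886
  set A : ℝ := 4.235 / δ
  set B : ℝ := 1.6953 / δ
  set C : ℝ := 1.0455 / δ
  have hstep : ∀ l ∈ P, (2 * (l : ℝ) / (l - 1)) ^ 4 ≤
      (δ * (if l = 7 then A else 1) * (if l = 13 then B else 1) * (if l = 19 then C else 1)) * l := by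
    intro l hl
    rcases h l hl with rfl | rfl | rfl | h31
    · norm_num [A, δ]
    · norm_num [B, δ]
    · norm_num [C, δ]
    · rw [if_neg (by omega), if_neg (by omega), if_neg (by omega)]
      have h31' : (31 : ℝ) ≤ l := by exact_mod_cast h31
      have h1 : 2 * (l : ℝ) / (l - 1) ≤ 62 / 30 := by
        rw [div_le_div_iff₀ (by linarith) (by norm_num)]; linarith
      have h0 : 0 ≤ 2 * (l : ℝ) / (l - 1) := div_nonneg (by linarith) (by linarith)
      calc (2 * (l : ℝ) / (l - 1)) ^ 4 ≤ (62 / 30) ^ 4 := by gcongr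
        _ ≤ (δ * 1 * 1 * 1) * 31 := by norm_num [δ]
        _ ≤ _ := by gcongr
  have hA : (if 7 ∈ P then A else 1) ≤ A := by split_ifs <;> norm_num [A, δ]
  have hB : (if 13 ∈ P then B else 1) ≤ B := by split_ifs <;> norm_num [B, δ]
  have hC : (if 19 ∈ P then C else 1) ≤ C := by split_ifs <;> norm_num [C, δ]
  have hB0 : 0 ≤ (if 13 ∈ P then B else 1) := by split_ifs <;> norm_num [B, δ]
  have hC0 : 0 ≤ (if 19 ∈ P then C else 1) := by split_ifs <;> norm_num [C, δ]
  have hA0 : 0 ≤ A := by norm_num [A, δ]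
  have hB1 : 0 ≤ B := by norm_num [B, δ]
  have hδ : δ ^ #P ≤ δ ^ 7 := pow_le_pow_of_le_one (by norm_num [δ]) (by norm_num [δ]) hk
  calc ∏ l ∈ P, (2 * (l : ℝ) / (l - 1)) ^ 4
      ≤ ∏ l ∈ P, ((δ * (if l = 7 then A else 1) * (if l = 13 then B else 1) *
          (if l = 19 then C else 1)) * (l : ℝ)) :=
        prod_le_prod (fun l _ => by positivity) hstep
    _ = (δ ^ #P * (if 7 ∈ P then A else 1) * (if 13 ∈ P then B else 1) *
          (if 19 ∈ P then C else 1)) * ∏ l ∈ P, (l : ℝ) := by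
        simp only [prod_mul_distrib, prod_const, Finset.prod_ite_eq']
    _ ≤ (δ ^ 7 * A * B * C) * ∏ l ∈ P, (l : ℝ) := by
        gcongr
    _ ≤ 0.905 * ∏ l ∈ P, (l : ℝ) := by
        gcongr
        norm_num [A, B, C, δ]

/-- The union bound: if every point of `S` is caught by some member of a family of sets of
bounded size, then `S` is small. -/
lemma seven_sub_card_mul_le {q v : ℕ} {T : Type*} [DecidableEq T] {S : Finset T} {m : T → ℕ}
    {P : Finset ℕ} (hq : 2 ≤ q) (hS : #S = q ^ 2 - 1)
    (hbound : ∀ d : ℕ, d ∣ v → |(d : ℝ) * #{x ∈ S | d ∣ m x} - (q ^ 2 - 1)| ≤ (d - 1) * (q - 1) * √q)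
    (hP : ∀ l ∈ P, l ∣ v ∧ 7 ≤ l) (hcover : ∀ x ∈ S, ∃ l ∈ P, l ∣ m x) :
    (7 - #P : ℝ) * (q + 1) ≤ 6 * #P * √q := by
  have hq' : (2 : ℝ) ≤ q := by exact_mod_cast hq
  have hs : √q ≤ q + 1 := by
    rw [Real.sqrt_le_left (by linarith)]; nlinarith
  have hcard : (#S : ℝ) = q ^ 2 - 1 := by
    rw [hS, Nat.cast_sub (Nat.one_le_pow _ _ (by omega))]; simp
  have hsum : (#S : ℝ) ≤ ∑ l ∈ P, (#{x ∈ S | l ∣ m x} : ℝ) := by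
    have : S ⊆ P.biUnion fun l => {x ∈ S | l ∣ m x} := fun x hx => by
      obtain ⟨l, hl, hd⟩ := hcover x hx
      exact mem_biUnion.2 ⟨l, hl, mem_filter.2 ⟨hx, hd⟩⟩
    exact_mod_cast (card_le_card this).trans card_biUnion_le
  have heach : ∀ l ∈ P, (#{x ∈ S | l ∣ m x} : ℝ) ≤ (q - 1) * ((q + 1) + 6 * √q) / 7 := by
    intro l hl
    obtain ⟨hd, h7⟩ := hP l hl
    have h7' : (7 : ℝ) ≤ l := by exact_mod_cast h7
    have hb := (abs_le.1 (hbound l hd)).2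
    have : (#{x ∈ S | l ∣ m x} : ℝ) ≤ ((q ^ 2 - 1) + (l - 1) * (q - 1) * √q) / l := by
      rw [le_div_iff₀ (by linarith)]; linarith
    refine this.trans ?_
    rw [div_le_div_iff₀ (by linarith) (by norm_num)]
    nlinarith [mul_nonneg (mul_nonneg (sub_nonneg.2 h7') (by linarith : (0 : ℝ) ≤ q - 1))
      (sub_nonneg.2 hs)]
  have htot := hsum.trans (sum_le_sum heach)
  rw [sum_const, nsmul_eq_mul, hcard] at htot
  have : (q - 1 : ℝ) * (q + 1) ≤ (q - 1) * (#P * ((q + 1) + 6 * √q) / 7) := by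
    linarith
  have := le_of_mul_le_mul_left this (by linarith)
  linarith

/-- Inclusion–exclusion: if every point of `S` is caught, then `q` is small compared with the
number of subsets of `P`. -/
lemma succ_mul_prod_le {q v : ℕ} {T : Type*} {S : Finset T} {m : T → ℕ}
    {P : Finset ℕ} (hq : 2 ≤ q) (hv : v ≠ 0)
    (hbound : ∀ d : ℕ, d ∣ v → |(d : ℝ) * #{x ∈ S | d ∣ m x} - (q ^ 2 - 1)| ≤ (d - 1) * (q - 1) * √q)
    (hP : ∀ l ∈ P, l.Prime ∧ l ∣ v) (hcover : ∀ x ∈ S, ∃ l ∈ P, l ∣ m x) :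
    (q + 1 : ℝ) * ∏ l ∈ P, (1 - (l : ℝ)⁻¹) ≤ 2 ^ #P * √q := by
  have hq' : (2 : ℝ) ≤ q := by exact_mod_cast hq
  have hdvd : ∀ A ∈ P.powerset, ∀ n, ∏ l ∈ A, l ∣ n ↔ ∀ l ∈ A, l ∣ n := fun A hA n =>
    ⟨fun h l hl => (dvd_prod_of_mem _ hl).trans h,
      prod_primes_dvd n fun l hl => (hP l (mem_powerset.1 hA hl)).1.prime⟩
  have hzero : ∑ A ∈ P.powerset, (-1 : ℝ) ^ #A * #{x ∈ S | (∏ l ∈ A, l) ∣ m x} = 0 := by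
    have hx : ∀ x ∈ S, ∑ A ∈ P.powerset, (-1 : ℝ) ^ #A * (if (∏ l ∈ A, l) ∣ m x then 1 else 0) = 0 := by
      intro x hx
      obtain ⟨l, hl, hd⟩ := hcover x hx
      have hp : ∏ l ∈ P, (1 - if l ∣ m x then (1 : ℝ) else 0) = 0 :=
        prod_eq_zero hl (by simp [hd])
      rw [prod_sub] at hp
      refine Eq.trans ?_ hp
      refine sum_congr rfl fun A hA => ?_
      rw [prod_const_one, mul_one, Finset.prod_boole]
      simp only [hdvd A hA]
    rw [← sum_eq_zero hx, sum_comm]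
    refine sum_congr rfl fun A _ => ?_
    rw [← mul_sum, sum_boole]
  have hprod : ∏ l ∈ P, (1 - (l : ℝ)⁻¹) = ∑ A ∈ P.powerset, (-1 : ℝ) ^ #A * ((∏ l ∈ A, l : ℕ) : ℝ)⁻¹ := by
    rw [prod_sub]
    refine sum_congr rfl fun A _ => ?_
    simp
  have hterm : ∀ A ∈ P.powerset, (-1 : ℝ) ^ #A * ((q ^ 2 - 1) * ((∏ l ∈ A, l : ℕ) : ℝ)⁻¹ -
      #{x ∈ S | (∏ l ∈ A, l) ∣ m x}) ≤ (q - 1) * √q := by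
    intro A hA
    have hd : (∏ l ∈ A, l) ∣ v := (hdvd A hA v).2 fun l hl => (hP l (mem_powerset.1 hA hl)).2
    have hb := hbound _ hd
    have hpos : 0 < ∏ l ∈ A, l := Nat.pos_of_dvd_of_pos hd (Nat.pos_of_ne_zero hv)
    set d := ∏ l ∈ A, l
    have hpos' : (0 : ℝ) < d := by exact_mod_cast hpos
    refine (le_abs_self _).trans ?_
    rw [abs_mul, abs_pow, abs_neg, abs_one, one_pow, one_mul]
    refine le_of_mul_le_mul_left ?_ hpos'
    rw [← abs_of_pos hpos', ← abs_mul, abs_of_pos hpos', mul_sub, mul_left_comm,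
      mul_inv_cancel₀ hpos'.ne', mul_one, abs_sub_comm]
    refine hb.trans ?_
    nlinarith [mul_nonneg (by linarith : (0 : ℝ) ≤ q - 1) (Real.sqrt_nonneg q)]
  have htot := sum_le_sum hterm
  rw [sum_const, card_powerset, nsmul_eq_mul] at htot
  have heq : ∑ A ∈ P.powerset, (-1 : ℝ) ^ #A * ((q ^ 2 - 1) * ((∏ l ∈ A, l : ℕ) : ℝ)⁻¹ -
      #{x ∈ S | (∏ l ∈ A, l) ∣ m x}) = (q ^ 2 - 1) * ∏ l ∈ P, (1 - (l : ℝ)⁻¹) := by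
    rw [hprod, mul_sum, ← sub_zero (∑ A ∈ P.powerset, _ * (_ * _)), ← hzero, ← sum_sub_distrib]
    exact sum_congr rfl fun A _ => by ring
  rw [heq] at htot
  push_cast at htot
  refine le_of_mul_le_mul_left ?_ (by linarith : (0 : ℝ) < q - 1)
  linarith

/-- A set equidistributed modulo every divisor of `q ^ 2 + q + 1` contains a point whose label is
divisible by no prime factor of `q ^ 2 + q + 1` other than `3`. -/
lemma exists_forall_not_dvd {q : ℕ} {T : Type*} [DecidableEq T] {S : Finset T} {m : T → ℕ}
    (hq : 5 ≤ q) (hS : #S = q ^ 2 - 1)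
    (hbound : ∀ d : ℕ, d ∣ q ^ 2 + q + 1 →
      |(d : ℝ) * #{x ∈ S | d ∣ m x} - (q ^ 2 - 1)| ≤ (d - 1) * (q - 1) * √q) :
    ∃ x ∈ S, ∀ l : ℕ, l.Prime → l ∣ q ^ 2 + q + 1 → l ≠ 3 → ¬ l ∣ m x := by
  by_contra! hcon
  set v := q ^ 2 + q + 1
  have hv : v ≠ 0 := by positivity
  set P := v.primeFactors.erase 3
  have hmem : ∀ l ∈ P, l.Prime ∧ l ∣ v ∧ l ≠ 3 := fun l hl => by
    simp only [P, mem_erase, Nat.mem_primeFactors] at hl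
    tauto
  have hcover : ∀ x ∈ S, ∃ l ∈ P, l ∣ m x := fun x hx => by
    obtain ⟨l, h1, h2, h3, h4⟩ := hcon x hx
    exact ⟨l, by simp [P, h1, h2, h3, hv], h4⟩
  have hcases : ∀ l ∈ P, l = 7 ∨ l = 13 ∨ l = 19 ∨ 31 ≤ l := fun l hl =>
    prime_factor_cases (hmem l hl).1 (hmem l hl).2.2 (hmem l hl).2.1
  have hprod : ∏ l ∈ P, (l : ℝ) ≤ q ^ 2 + q + 1 := by
    have : ∏ l ∈ P, l ≤ v := Nat.le_of_dvd (Nat.pos_of_ne_zero hv)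
      (prod_primes_dvd v (fun l hl => (hmem l hl).1.prime) fun l hl => (hmem l hl).2.1)
    rw [← Nat.cast_prod]
    exact (Nat.cast_le.2 this).trans_eq (by push_cast [v]; ring)
  have hq5 : (5 : ℝ) ≤ q := by exact_mod_cast hq
  set s := √(q : ℝ)
  have hs0 : 0 ≤ s := Real.sqrt_nonneg _
  have hs2 : s ^ 2 = q := Real.sq_sqrt (by positivity)
  have hlow := (pow_le_prod_of_seven_or_le fun l hl => by have := hcases l hl; omega).trans hprod
  rcases Nat.lt_or_ge #P 7 with hk | hk
  · have hsieve := seven_sub_card_mul_le (by omega) hS hbound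
      (fun l hl => ⟨(hmem l hl).2.1, by have := hcases l hl; omega⟩) hcover
    change (7 - #P : ℝ) * (q + 1) ≤ 6 * #P * s at hsieve
    generalize #P = k at *
    rw [← hs2] at hq5 hlow hsieve
    clear hs2
    have hs : 2 ≤ s := by nlinarith
    interval_cases k
    · norm_num at hsieve; nlinarith
    · norm_num at hsieve; nlinarith
    · norm_num at hsieve; nlinarith
    · norm_num at hsieve hlow
      have : 5 < s := by by_contra! h; nlinarith [pow_le_pow_left₀ hs0 h 2, pow_le_pow_left₀ hs0 h 4]
      nlinarith
    · norm_num at hsieve hlow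
      have : 8 < s := by by_contra! h; nlinarith [pow_le_pow_left₀ hs0 h 2, pow_le_pow_left₀ hs0 h 4]
      nlinarith
    · norm_num at hsieve hlow
      have : 15 < s := by by_contra! h; nlinarith [pow_le_pow_left₀ hs0 h 2, pow_le_pow_left₀ hs0 h 4]
      nlinarith
    · norm_num at hsieve hlow
      have : 36 < s := by by_contra! h; nlinarith [pow_le_pow_left₀ hs0 h 2, pow_le_pow_left₀ hs0 h 4]
      nlinarith
  · have hsieve := succ_mul_prod_le (by omega) hv hbound
      (fun l hl => ⟨(hmem l hl).1, (hmem l hl).2.1⟩) hcover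
    change (q + 1 : ℝ) * ∏ l ∈ P, (1 - (l : ℝ)⁻¹) ≤ 2 ^ #P * s at hsieve
    have hq11 : (11 : ℝ) ≤ q := by
      have : (13 : ℝ) ^ 7 ≤ 13 ^ #P := pow_le_pow_right₀ (by norm_num) hk
      by_contra! h
      nlinarith
    have hl1 : ∀ l ∈ P, (1 : ℝ) < l := fun l hl => by exact_mod_cast (hmem l hl).1.one_lt
    have hθ : (∏ l ∈ P, (2 * (l : ℝ) / (l - 1))) * ∏ l ∈ P, (1 - (l : ℝ)⁻¹) = 2 ^ #P := by
      rw [← prod_mul_distrib, ← prod_const]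
      refine prod_congr rfl fun l hl => ?_
      have := hl1 l hl
      have : (l : ℝ) - 1 ≠ 0 := by linarith
      have : (l : ℝ) ≠ 0 := by linarith
      field_simp
    have hθ0 : 0 < ∏ l ∈ P, (1 - (l : ℝ)⁻¹) :=
      prod_pos fun l hl => sub_pos.2 (inv_lt_one_of_one_lt₀ (hl1 l hl))
    have hfour := prod_pow_four_le hcases hk
    rw [prod_pow] at hfour
    set R := ∏ l ∈ P, (2 * (l : ℝ) / (l - 1))
    have hR : R ≤ s := by
      refine le_of_pow_le_pow_left₀ (n := 4) (by norm_num) hs0 ?_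
      have : s ^ 4 = q ^ 2 := by rw [← hs2]; ring
      rw [this]
      nlinarith
    rw [← hθ] at hsieve
    have : (q + 1 : ℝ) ≤ R * s := le_of_mul_le_mul_right (by linarith) hθ0
    nlinarith

lemma sq_card_sub_card_fiber_le {ι κ : Type*} [DecidableEq ι] [DecidableEq κ] {S : Finset ι}
    {C : Finset κ} {f : ι → κ} {c : κ} (hf : Set.MapsTo f S C) (hc : c ∈ C) :
    ((#S : ℝ) - #{x ∈ S | f x = c}) ^ 2 ≤
      (#C - 1) * (#{p ∈ S ×ˢ S | f p.1 = f p.2} - (#{x ∈ S | f x = c} : ℝ) ^ 2) := by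
  have hS : (#S : ℝ) = ∑ b ∈ C, (#{x ∈ S | f x = b} : ℝ) := by
    exact_mod_cast card_eq_sum_card_fiberwise hf
  have hpairs : (#{p ∈ S ×ˢ S | f p.1 = f p.2} : ℝ) = ∑ b ∈ C, (#{x ∈ S | f x = b} : ℝ) ^ 2 := by
    have h : Set.MapsTo (fun p : ι × ι => f p.1) ({p ∈ S ×ˢ S | f p.1 = f p.2} : Finset (ι × ι)) C := by
      intro p hp
      simp only [coe_filter, mem_product, Set.mem_ofPred_eq] at hp
      exact hf hp.1.1
    rw [card_eq_sum_card_fiberwise h]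
    push_cast
    refine sum_congr rfl fun b _ => ?_
    rw [sq, ← Nat.cast_mul, ← card_product]
    congr 2
    ext ⟨x, y⟩
    simp only [mem_filter, mem_product]
    constructor
    · rintro ⟨⟨⟨hx, hy⟩, h⟩, hb⟩
      exact ⟨⟨hx, hb⟩, hy, h ▸ hb⟩
    · rintro ⟨⟨hx, hb⟩, hy, hb'⟩
      exact ⟨⟨⟨hx, hy⟩, hb.trans hb'.symm⟩, hb⟩
  rw [hS, hpairs, ← add_sum_erase C _ hc, ← add_sum_erase C _ hc, add_sub_cancel_left,
    add_sub_cancel_left]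
  have := sq_sum_le_card_mul_sum_sq (s := C.erase c) (f := fun b => (#{x ∈ S | f x = b} : ℝ))
  rwa [card_erase_of_mem hc, Nat.cast_sub (card_pos.2 ⟨c, hc⟩), Nat.cast_one] at this

lemma card_nthRootsFinset_le {R : Type*} [CommRing R] [IsDomain R] (n : ℕ) (a : R) :
    #(Polynomial.nthRootsFinset n a) ≤ n := by
  classical
  rw [Polynomial.nthRootsFinset_def]
  exact (Multiset.toFinset_card_le _).trans (Polynomial.card_nthRoots n a)

section

variable {K L : Type*} [Field K] [Field L] [Algebra K L]

lemma mem_range_algebraMap_of_pow_card_sub_one_eq_one [Fintype K] {x : L}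
    (h1 : x ^ (Fintype.card K - 1) = 1) : ∃ k : K, algebraMap K L k = x := by
  classical
  have h : x ^ Fintype.card K = x := by
    rw [← Nat.sub_add_cancel (Fintype.card_pos (α := K)), pow_succ, h1, one_mul]
  have hne : (Polynomial.X ^ Fintype.card K - Polynomial.X : Polynomial L) ≠ 0 :=
    FiniteField.X_pow_card_sub_X_ne_zero L Fintype.one_lt_card
  have hsub : univ.image (algebraMap K L) ⊆
      (Polynomial.X ^ Fintype.card K - Polynomial.X : Polynomial L).roots.toFinset := by
    intro y hy
    obtain ⟨k, -, rfl⟩ := mem_image.1 hy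
    rw [Multiset.mem_toFinset, Polynomial.mem_roots hne]
    simp [← map_pow, FiniteField.pow_card]
  have hcard := (Multiset.toFinset_card_le
    (Polynomial.X ^ Fintype.card K - Polynomial.X : Polynomial L).roots).trans
      (Polynomial.card_roots' _)
  rw [FiniteField.X_pow_card_sub_X_natDegree_eq L Fintype.one_lt_card] at hcard
  have heq := eq_of_subset_of_card_le hsub (by
    rwa [card_image_of_injective _ (algebraMap K L).injective, card_univ])
  have hx : x ∈ univ.image (algebraMap K L) := by
    rw [heq, Multiset.mem_toFinset, Polynomial.mem_roots hne]
    simp [h]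
  obtain ⟨k, -, hk⟩ := mem_image.1 hx
  exact ⟨k, hk⟩

lemma finrank_ker_trace [Finite L] (h3 : Module.finrank K L = 3) :
    Module.finrank K (LinearMap.ker (Algebra.trace K L)) = 2 := by
  have h := LinearMap.finrank_range_add_finrank_ker (Algebra.trace K L)
  rw [LinearMap.range_eq_top.2 (Algebra.trace_surjective K L), finrank_top, Module.finrank_self] at h
  omega

variable [Fintype L] [DecidableEq L] [DecidableEq K]

variable (K L) in
/-- The nonzero elements of trace zero. -/
noncomputable def traceZero : Finset L := {x | x ≠ 0 ∧ Algebra.trace K L x = 0}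

lemma mem_traceZero {x : L} : x ∈ traceZero K L ↔ x ≠ 0 ∧ Algebra.trace K L x = 0 := by
  simp [traceZero]

variable [Fintype K]

lemma card_traceZero (h3 : Module.finrank K L = 3) :
    #(traceZero K L) = Fintype.card K ^ 2 - 1 := by
  classical
  have h : traceZero K L = ({x | x ∈ LinearMap.ker (Algebra.trace K L)} : Finset L).erase 0 := by
    ext x; simp [mem_traceZero]
  rw [h, card_erase_of_mem (by simp), ← finrank_ker_trace h3, ← Module.card_eq_pow_finrank,
    Fintype.card_subtype]

/-- The trace-zero planes of `b` and of `β * b` meet in at most a line unless `β` is a scalar. -/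
lemma card_traceZero_mul_le (h3 : Module.finrank K L = 3) {β : L}
    (hβ : β ∉ Set.range (algebraMap K L)) :
    #{b ∈ traceZero K L | β * b ∈ traceZero K L} ≤ Fintype.card K - 1 := by
  classical
  set φ := Algebra.trace K L
  set ψ : L →ₗ[K] K := φ ∘ₗ LinearMap.mulLeft K β
  have hnot : ¬ LinearMap.ker φ ≤ LinearMap.ker ψ := by
    intro hle
    have hspan : ψ ∈ Submodule.span K (Set.range fun _ : Unit => φ) :=
      mem_span_of_iInf_ker_le_ker (by simpa using hle)
    rw [Set.range_const, Submodule.mem_span_singleton] at hspan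
    obtain ⟨c, hc⟩ := hspan
    refine hβ ⟨c, ?_⟩
    have h0 : algebraMap K L c - β = 0 := by
      refine (traceForm_nondegenerate K L).1 _ fun y => ?_
      have := LinearMap.congr_fun hc y
      simp only [LinearMap.smul_apply, ψ, LinearMap.comp_apply, LinearMap.mulLeft_apply] at this
      rw [Algebra.traceForm_apply, sub_mul, map_sub, ← Algebra.smul_def, map_smul, sub_eq_zero]
      exact this
    exact sub_eq_zero.1 h0
  have hlt : Module.finrank K ↥(LinearMap.ker φ ⊓ LinearMap.ker ψ) ≤ 1 := by
    have hlt' : LinearMap.ker φ ⊓ LinearMap.ker ψ < LinearMap.ker φ :=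
      lt_of_le_of_ne inf_le_left fun h => hnot (inf_eq_left.1 h)
    have := Submodule.finrank_lt_finrank_of_lt hlt'
    rw [finrank_ker_trace h3] at this
    omega
  have hsub : ({b ∈ traceZero K L | β * b ∈ traceZero K L} : Finset L) ⊆
      ({x | x ∈ LinearMap.ker φ ⊓ LinearMap.ker ψ} : Finset L).erase 0 := by
    intro b hb
    simp only [mem_filter, mem_traceZero] at hb
    simp [hb.1.1, φ, ψ, hb.1.2, hb.2.2]
  refine (card_le_card hsub).trans ?_
  rw [card_erase_of_mem (by simp), ← Fintype.card_subtype]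
  refine Nat.sub_le_sub_right ?_ 1
  calc Fintype.card {x // x ∈ LinearMap.ker φ ⊓ LinearMap.ker ψ}
      = Fintype.card K ^ Module.finrank K ↥(LinearMap.ker φ ⊓ LinearMap.ker ψ) :=
        Module.card_eq_pow_finrank
    _ ≤ Fintype.card K ^ 1 := Nat.pow_le_pow_right Fintype.card_pos hlt
    _ = Fintype.card K := pow_one _

lemma card_traceZero_pairs_le (h3 : Module.finrank K L = 3) {e : ℕ} (he : 0 < e) :
    (#{p ∈ traceZero K L ×ˢ traceZero K L | p.1 ^ e = p.2 ^ e} : ℝ) ≤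
      ((Fintype.card K : ℝ) - 1) * (e + Fintype.card K ^ 2 - Fintype.card K) := by
  set q := Fintype.card K
  have hq : 1 ≤ q := Fintype.card_pos
  have hq' : (1 : ℝ) ≤ q := by exact_mod_cast hq
  set S := traceZero K L
  set B : Finset L := Polynomial.nthRootsFinset e (1 : L)
  have hBcard : #B ≤ e := card_nthRootsFinset_le e 1
  have hle : #{p ∈ S ×ˢ S | p.1 ^ e = p.2 ^ e} ≤ ∑ β ∈ B, #{b ∈ S | β * b ∈ S} := by
    rw [← card_sigma]
    refine card_le_card_of_injOn (fun p => ⟨p.1 / p.2, p.2⟩) ?_ ?_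
    · rintro ⟨a, b⟩ hp
      simp only [coe_filter, mem_product, Set.mem_ofPred_eq] at hp
      obtain ⟨⟨ha, hb⟩, hab⟩ := hp
      have hb0 : b ≠ 0 := (mem_traceZero.1 hb).1
      simp only [coe_sigma, Set.mem_sigma_iff, mem_coe, mem_filter, B]
      refine ⟨(Polynomial.mem_nthRootsFinset he 1).2 ?_, hb, ?_⟩
      · rw [div_pow, hab, div_self (pow_ne_zero _ hb0)]
      · rwa [div_mul_cancel₀ _ hb0]
    · rintro ⟨a, b⟩ hp ⟨a', b'⟩ hp' h
      simp only [coe_filter, mem_product, Set.mem_ofPred_eq] at hp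
      have hb0 : b ≠ 0 := (mem_traceZero.1 hp.1.2).1
      simp only [Sigma.mk.injEq, heq_eq_eq] at h
      obtain ⟨h1, rfl⟩ := h
      rw [div_left_inj' hb0] at h1
      rw [h1]
  have hterm : ∀ β ∈ B, (#{b ∈ S | β * b ∈ S} : ℝ) ≤
      (q - 1) + if β ∈ (univ.erase (0 : K)).image (algebraMap K L) then (q ^ 2 - q : ℝ) else 0 := by
    intro β hβ
    have hβ0 : β ≠ 0 := by
      rintro rfl
      have := (Polynomial.mem_nthRootsFinset he 1).1 hβ
      rw [zero_pow he.ne'] at this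
      exact zero_ne_one this
    split_ifs with h
    · have : #{b ∈ S | β * b ∈ S} ≤ q ^ 2 - 1 :=
        (card_filter_le _ _).trans (card_traceZero h3).le
      have : (#{b ∈ S | β * b ∈ S} : ℝ) ≤ ((q ^ 2 - 1 : ℕ) : ℝ) := by exact_mod_cast this
      rw [Nat.cast_sub (Nat.one_le_pow _ _ hq)] at this
      push_cast at this
      linarith
    · have : #{b ∈ S | β * b ∈ S} ≤ q - 1 := by
        refine card_traceZero_mul_le h3 ?_
        rintro ⟨k, rfl⟩
        exact h (mem_image_of_mem _ (mem_erase.2 ⟨fun hk => hβ0 (by simp [hk]), mem_univ _⟩))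
      have : (#{b ∈ S | β * b ∈ S} : ℝ) ≤ ((q - 1 : ℕ) : ℝ) := by exact_mod_cast this
      rw [Nat.cast_sub hq] at this
      push_cast at this
      linarith
  have hscal : (#{β ∈ B | β ∈ (univ.erase (0 : K)).image (algebraMap K L)} : ℝ) ≤ q - 1 := by
    have h1 : #{β ∈ B | β ∈ (univ.erase (0 : K)).image (algebraMap K L)} ≤ q - 1 := by
      refine ((card_le_card fun x hx => (mem_filter.1 hx).2).trans card_image_le).trans_eq ?_
      rw [card_erase_of_mem (mem_univ (0 : K)), card_univ]
    have : (#{β ∈ B | β ∈ (univ.erase (0 : K)).image (algebraMap K L)} : ℝ) ≤ ((q - 1 : ℕ) : ℝ) := by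
      exact_mod_cast h1
    rwa [Nat.cast_sub hq, Nat.cast_one] at this
  have hqq : (0 : ℝ) ≤ q ^ 2 - q := by nlinarith
  calc (#{p ∈ S ×ˢ S | p.1 ^ e = p.2 ^ e} : ℝ) ≤ ∑ β ∈ B, (#{b ∈ S | β * b ∈ S} : ℝ) := by
        exact_mod_cast hle
    _ ≤ _ := sum_le_sum hterm
    _ = #B * (q - 1) +
        #{β ∈ B | β ∈ (univ.erase (0 : K)).image (algebraMap K L)} * (q ^ 2 - q) := by
        rw [sum_add_distrib, sum_const, nsmul_eq_mul, ← sum_filter, sum_const, nsmul_eq_mul]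
    _ ≤ e * (q - 1) + (q - 1) * (q ^ 2 - q) := by
        gcongr
    _ = _ := by ring

lemma abs_card_traceZero_filter_pow_le (h3 : Module.finrank K L = 3) {d e : ℕ}
    (hde : d * e = Fintype.card K ^ 3 - 1) :
    |(d : ℝ) * #{x ∈ traceZero K L | x ^ e = 1} - (Fintype.card K ^ 2 - 1)| ≤
      (d - 1) * (Fintype.card K - 1) * √(Fintype.card K) := by
  have hpairs := card_traceZero_pairs_le (K := K) (L := L) h3 (e := e)
  have hScard := card_traceZero (K := K) (L := L) h3
  have hL : Fintype.card L = Fintype.card K ^ 3 := by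
    rw [← h3]; exact Module.card_eq_pow_finrank
  set q := Fintype.card K
  have hq : 1 < q := Fintype.one_lt_card
  have hq' : (1 : ℝ) < q := by exact_mod_cast hq
  have hpos : 0 < d * e := by
    rw [hde]; exact Nat.sub_pos_of_lt (Nat.one_lt_pow (by norm_num) hq)
  have hd : 0 < d := Nat.pos_of_mul_pos_right hpos
  have he : 0 < e := Nat.pos_of_mul_pos_left hpos
  have hdeR : (d : ℝ) * e = q ^ 3 - 1 := by
    rw [← Nat.cast_mul, hde, Nat.cast_sub (Nat.one_le_pow _ _ hq.le)]; simp
  have hd1 : (1 : ℝ) ≤ d := by exact_mod_cast hd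
  set S := traceZero K L
  set C : Finset L := Polynomial.nthRootsFinset d (1 : L)
  have hC : (#C : ℝ) ≤ d := by
    exact_mod_cast card_nthRootsFinset_le d (1 : L)
  have hmaps : Set.MapsTo (fun x : L => x ^ e) S C := by
    intro x hx
    refine (Polynomial.mem_nthRootsFinset hd 1).2 ?_
    rw [← pow_mul, mul_comm, hde, ← hL]
    exact FiniteField.pow_card_sub_one_eq_one x (mem_traceZero.1 hx).1
  have hcs := sq_card_sub_card_fiber_le hmaps
    ((Polynomial.mem_nthRootsFinset hd 1).2 (one_pow d) : (1 : L) ∈ C)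
  have hS : (#S : ℝ) = q ^ 2 - 1 := by
    rw [hScard, Nat.cast_sub (Nat.one_le_pow _ _ hq.le)]; simp
  have hpairs := hpairs he
  rw [hS] at hcs
  set N : ℝ := ((#{x ∈ S | x ^ e = 1} : ℕ) : ℝ)
  set R : ℝ := ((#{p ∈ S ×ˢ S | p.1 ^ e = p.2 ^ e} : ℕ) : ℝ)
  have hRN : N ^ 2 ≤ R := by
    rw [sq]
    simp only [N, R]
    rw [← Nat.cast_mul, ← card_product, Nat.cast_le]
    refine card_le_card fun p hp => ?_
    simp only [mem_product, mem_filter] at hp ⊢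
    exact ⟨⟨hp.1.1, hp.2.1⟩, hp.1.2.trans hp.2.2.symm⟩
  have hcs' : (q ^ 2 - 1 - N) ^ 2 ≤ (d - 1) * ((q - 1) * (e + q ^ 2 - q) - N ^ 2) := by
    refine hcs.trans ((mul_le_mul_of_nonneg_right (sub_le_sub_right hC 1) (by linarith)).trans ?_)
    refine mul_le_mul_of_nonneg_left ?_ (by linarith)
    linarith
  refine abs_le_of_sq_le_sq ?_ (mul_nonneg
    (mul_nonneg (sub_nonneg.2 hd1) (sub_nonneg.2 hq'.le)) (Real.sqrt_nonneg _))
  rw [mul_pow, Real.sq_sqrt (by positivity)]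
  have h1 := mul_le_mul_of_nonneg_left hcs' (by linarith : (0 : ℝ) ≤ d)
  have h2 : (d : ℝ) * ((d - 1) * ((q - 1) * (e + q ^ 2 - q) - N ^ 2)) =
      (d - 1) * ((q - 1) * ((q ^ 3 - 1) + d * (q ^ 2 - q)) - d * N ^ 2) := by
    rw [← hdeR]; ring
  rw [h2] at h1
  linarith [h1]

end

lemma finrank_conjSpan_eq_two {K L : Type*} [Field K] [Field L] [Algebra K L] [Fintype K]
    [Fintype L] {q : ℕ} (hq : 2 ≤ q) (hK : Fintype.card K = q) (h3 : Module.finrank K L = 3)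
    {x b : L} {w : K} (hb : b ≠ 0) (hbw : b ^ q = algebraMap K L w * b)
    (hx : orderOf x = (q ^ 3 - 1) / 2) (htr : Algebra.trace K L (b⁻¹ * x) = 0)
    (hodd : Odd q) :
    Module.finrank K (conjSpan K q 3 x) = 2 := by
  set W := algebraMap K L w
  have hW : W ≠ 0 := fun h => by simp [h, hb, show q ≠ 0 by omega] at hbw
  have hWq : W ^ q = W := by rw [← map_pow, ← hK, FiniteField.pow_card]
  have hbw2 : b ^ q ^ 2 = W ^ 2 * b := by
    rw [sq q, pow_mul, hbw, mul_pow, hWq, hbw]; ring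
  have hrel : x ^ q ^ 2 = (-w ^ 2) • x + (-w) • x ^ q := by
    have h := FiniteField.algebraMap_trace_eq_sum_pow K L (b⁻¹ * x)
    rw [htr, map_zero, h3, Nat.card_eq_fintype_card, hK] at h
    simp only [sum_range_succ, sum_range_zero, mul_pow, inv_pow, pow_zero, pow_one, hbw, hbw2,
      zero_add] at h
    field_simp at h
    rw [Algebra.smul_def, Algebra.smul_def, map_neg, map_neg, map_pow]
    linear_combination -h
  have hv : 1 ≤ q ^ 3 := Nat.one_le_pow _ _ (by omega)
  have heven : 2 * ((q ^ 3 - 1) / 2) = q ^ 3 - 1 := Nat.two_mul_div_two_of_even (by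
    obtain ⟨j, hj⟩ := hodd.pow (n := 3)
    exact ⟨j, by omega⟩)
  have hx0 : x ≠ 0 := by
    rintro rfl
    rw [orderOf_zero] at hx
    have : 2 ^ 3 ≤ q ^ 3 := Nat.pow_le_pow_left hq 3
    omega
  have hind : LinearIndependent K ![x, x ^ q] := by
    rw [LinearIndependent.pair_iff' hx0]
    intro a ha
    have ha0 : a ≠ 0 := by
      rintro rfl
      rw [zero_smul] at ha
      exact pow_ne_zero _ hx0 ha.symm
    have h1 : x ^ (q - 1) = algebraMap K L a := by
      refine mul_right_cancel₀ hx0 ?_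
      rw [← pow_succ, Nat.sub_add_cancel (by omega), ← ha, Algebra.smul_def]
    have h2 : x ^ ((q - 1) * (q - 1)) = 1 := by
      rw [pow_mul, h1, ← map_pow, ← hK, FiniteField.pow_card_sub_one_eq_one a ha0, map_one]
    have hdvd := mul_dvd_mul_left 2 (orderOf_dvd_of_pow_eq_one h2)
    rw [hx, heven] at hdvd
    obtain ⟨r, rfl⟩ : ∃ r, q = r + 1 := ⟨q - 1, by omega⟩
    have hr : 0 < r := by omega
    have hle := Nat.le_of_dvd (by positivity) hdvd
    rw [Nat.add_sub_cancel] at hle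
    have : (r + 1) ^ 3 = r * r * r + 3 * (r * r) + 3 * r + 1 := by ring
    have : 0 ≤ r * r * r := by positivity
    have : 0 < r * r := by positivity
    omega
  have hspan : conjSpan K q 3 x = Submodule.span K (Set.range ![x, x ^ q]) := by
    rw [conjSpan]
    apply le_antisymm
    · rw [Submodule.span_le]
      have hx1 : x ∈ Submodule.span K (Set.range ![x, x ^ q]) :=
        Submodule.subset_span ⟨0, rfl⟩
      have hx2 : x ^ q ∈ Submodule.span K (Set.range ![x, x ^ q]) :=
        Submodule.subset_span ⟨1, rfl⟩
      rintro _ ⟨i, rfl⟩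
      fin_cases i
      · simpa using hx1
      · simpa using hx2
      · simp only [SetLike.mem_coe]
        rw [hrel]
        exact add_mem (Submodule.smul_mem _ _ hx1) (Submodule.smul_mem _ _ hx2)
    · refine Submodule.span_mono ?_
      rintro _ ⟨i, rfl⟩
      fin_cases i
      · exact ⟨0, by simp⟩
      · exact ⟨1, by simp⟩
  rw [hspan, finrank_span_eq_card hind, Fintype.card_fin]

/-- An integer coprime to the odd modulus `v` is congruent modulo `v` to twice a unit modulo any
multiple of `v`. -/
lemma exists_two_mul_modEq {v n m : ℕ} (hn : n ≠ 0) (hvn : v ∣ n) (hv : Odd v)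
    (hm : m.Coprime v) : ∃ u : ℕ, u.Coprime n ∧ 2 * u ≡ m [MOD v] := by
  have : NeZero n := ⟨hn⟩
  have h2 : Nat.Coprime 2 v := Nat.coprime_two_left.2 hv
  obtain ⟨U, hU⟩ := ZMod.unitsMap_surjective hvn
    ((ZMod.unitOfCoprime 2 h2)⁻¹ * ZMod.unitOfCoprime m hm)
  refine ⟨(U : ZMod n).val, ZMod.val_coe_unit_coprime U, ?_⟩
  rw [← ZMod.natCast_eq_natCast_iff]
  have h := congrArg (fun y => ((ZMod.unitOfCoprime 2 h2 * y : (ZMod v)ˣ) : ZMod v)) hU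
  simp only [mul_inv_cancel_left, Units.val_mul, ZMod.coe_unitOfCoprime, ZMod.unitsMap_val] at h
  rw [← h]
  push_cast
  rw [ZMod.natCast_val]

/-- Let `q` be a power of a prime `p ≥ 5`. Then there exists an element of `F_{q^3}` that is
simultaneously `2`-primitive and `1`-normal over `F_q`. -/
theorem stmt_5 (p t q : ℕ) (hp : p.Prime) (hp5 : 5 ≤ p) (ht : 1 ≤ t) (hq : q = p ^ t)
    (K L : Type*) [Field K] [Field L] [Algebra K L] [Fintype K] [Fintype L]
    (hK : Fintype.card K = q) (hL : Fintype.card L = q ^ 3) :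
    ∃ α : L, orderOf α = (q ^ 3 - 1) / 2 ∧
      Module.finrank K (conjSpan K q 3 α) = 3 - 1 := by
  classical
  have hq5 : 5 ≤ q := by
    rw [hq]; exact hp5.trans (Nat.le_self_pow (by omega) p)
  have hodd : Odd q := by
    rw [hq]; exact (hp.odd_of_ne_two (by omega)).pow
  have h3 : Module.finrank K L = 3 := by
    have h := Module.card_eq_pow_finrank (K := K) (V := L)
    rw [hK, hL] at h
    exact (Nat.pow_right_injective (by omega) h).symm
  set v := q ^ 2 + q + 1 with hv
  have hN : q ^ 3 - 1 = (q - 1) * v := by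
    obtain ⟨r, rfl⟩ : ∃ r, q = r + 1 := ⟨q - 1, by omega⟩
    rw [hv, Nat.add_sub_cancel, Nat.sub_eq_iff_eq_add (Nat.one_le_pow _ _ (by omega))]
    ring
  have hvodd : Odd v := by
    obtain ⟨j, hj⟩ := hodd
    exact ⟨2 * j ^ 2 + 3 * j + 1, by rw [hv, hj]; ring⟩
  obtain ⟨g, hg⟩ := IsCyclic.exists_ofOrder_eq_natCard (α := Lˣ)
  have hgN : orderOf (g : L) = q ^ 3 - 1 := by
    rw [orderOf_units, hg, Nat.card_units, Nat.card_eq_fintype_card, hL]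
  have hlog : ∀ x : L, ∃ m : ℕ, x ≠ 0 → (g : L) ^ m = x := fun x => by
    by_cases hx : x = 0
    · exact ⟨0, fun h => absurd hx h⟩
    have hmem : Units.mk0 x hx ∈ Submonoid.powers g := by
      rw [mem_powers_iff_mem_zpowers]
      rw [Subgroup.eq_top_of_card_eq (Subgroup.zpowers g) (by rw [Nat.card_zpowers, hg])]
      exact Subgroup.mem_top _
    obtain ⟨m, hm⟩ := hmem
    exact ⟨m, fun _ => by simpa using congrArg Units.val hm⟩
  choose m hm using hlog
  have hNpos : 0 < q ^ 3 - 1 := Nat.sub_pos_of_lt (Nat.one_lt_pow (by norm_num) (by omega))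
  obtain ⟨a, haS, ha⟩ := exists_forall_not_dvd (S := traceZero K L) (m := m) hq5
    (by rw [card_traceZero h3, hK]) (by
      intro d hd
      obtain ⟨e, he⟩ : d ∣ q ^ 3 - 1 := hN ▸ hd.mul_left _
      have h := abs_card_traceZero_filter_pow_le (K := K) (L := L) h3 (d := d) (e := e)
        (by rw [hK, he])
      rw [hK] at h
      convert h using 6
      refine filter_congr fun x hx => ?_
      have hepos : 0 < e := Nat.pos_of_mul_pos_left (he ▸ hNpos)
      rw [← hm x (mem_traceZero.1 hx).1, ← pow_mul, ← orderOf_dvd_iff_pow_eq_one, hgN, he,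
        Nat.mul_dvd_mul_iff_right hepos, hm x (mem_traceZero.1 hx).1])
  obtain ⟨ha0, hatr⟩ := mem_traceZero.1 haS
  obtain ⟨j, w, hw, hj⟩ : ∃ (j : ℕ) (w : K), ((g : L) ^ j) ^ q = algebraMap K L w * (g : L) ^ j ∧
      (m a + j).Coprime v := by
    have hcop : ∀ n : ℕ, (∀ l : ℕ, l.Prime → l ∣ v → ¬ l ∣ n) → n.Coprime v := fun n hn =>
      Nat.coprime_of_dvd fun l hl h1 h2 => hn l hl h2 h1
    by_cases h3v : 3 ∣ v ∧ 3 ∣ m a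
    · obtain ⟨⟨c, hc⟩, h3a⟩ := h3v
      obtain ⟨i, hi⟩ : ∃ i, q = 3 * i + 1 := by
        have h := Nat.div_add_mod q 3
        have hlt : q % 3 < 3 := Nat.mod_lt _ (by norm_num)
        refine ⟨q / 3, ?_⟩
        generalize q / 3 = i at h
        interval_cases hs : q % 3
        · rw [hv, ← h] at hc
          ring_nf at hc
          omega
        · exact h.symm
        · rw [hv, ← h] at hc
          ring_nf at hc
          omega
      have h3c : ¬ 3 ∣ c := by
        have : c = 3 * (i ^ 2 + i) + 1 := by
          rw [hv, hi] at hc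
          ring_nf at hc ⊢
          omega
        omega
      obtain ⟨w, hw⟩ := mem_range_algebraMap_of_pow_card_sub_one_eq_one (K := K) 
        (x := (g : L) ^ (c * (q - 1))) (by
          rw [hK, ← pow_mul, ← orderOf_dvd_iff_pow_eq_one, hgN, hN, hc, hi, Nat.add_sub_cancel]
          exact ⟨i, by ring⟩)
      refine ⟨c, w, ?_, hcop _ fun l hl hlv hdvd => ?_⟩
      · rw [hw, ← pow_mul, ← pow_add]
        congr 1
        rw [← Nat.mul_succ, Nat.succ_eq_add_one, Nat.sub_add_cancel (by omega)]
      · by_cases hl3 : l = 3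
        · subst hl3
          exact h3c ((Nat.dvd_add_right h3a).1 hdvd)
        · have hlc : l ∣ c := by
            rw [hc] at hlv
            exact (hl.dvd_mul.1 hlv).resolve_left fun h =>
              hl3 ((Nat.prime_dvd_prime_iff_eq hl Nat.prime_three).1 h)
          exact ha l hl hlv hl3 ((Nat.dvd_add_left hlc).1 hdvd)
    · refine ⟨0, 1, by simp, hcop _ fun l hl hlv hdvd => ?_⟩
      by_cases hl3 : l = 3
      · subst hl3
        exact h3v ⟨hlv, hdvd⟩
      · exact ha l hl hlv hl3 hdvd
  obtain ⟨r, hr⟩ : ∃ r, q - 1 = 2 * r := by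
    obtain ⟨i, hi⟩ := hodd
    exact ⟨i, by omega⟩
  have hhalf : (q ^ 3 - 1) / 2 = r * v := by
    rw [hN, hr, mul_assoc, Nat.mul_div_cancel_left _ (by norm_num)]
  obtain ⟨u, hu, hum⟩ := exists_two_mul_modEq (n := r * v)
    (Nat.mul_ne_zero (by omega) (by omega)) (Dvd.intro_left r rfl) hvodd hj
  have horder : orderOf ((g : L) ^ (2 * u)) = (q ^ 3 - 1) / 2 := by
    have hgcd : (q ^ 3 - 1).gcd (2 * u) = 2 := by
      rw [hN, hr, mul_assoc, Nat.gcd_mul_left, Nat.gcd_comm, hu, mul_one]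
    have hu0 : 2 * u ≠ 0 := by
      intro h
      rw [h, Nat.gcd_zero_right, hN] at hgcd
      nlinarith [Nat.sub_add_cancel (show 1 ≤ q by omega)]
    rw [orderOf_pow' _ hu0, hgN, hgcd]
  refine ⟨(g : L) ^ (2 * u), horder, ?_⟩
  have hg0 : (g : L) ≠ 0 := g.ne_zero
  refine finrank_conjSpan_eq_two (by omega) hK h3 (pow_ne_zero j hg0) hw horder ?_ hodd
  -- The quotient of `g ^ (2 * u)` by `g ^ (m a + j)` is a scalar.
  obtain ⟨k, hk⟩ := mem_range_algebraMap_of_pow_card_sub_one_eq_one (K := K)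
    (x := (g : L) ^ (2 * u) / (g : L) ^ (m a + j)) (by
      rw [hK, div_pow, div_eq_one_iff_eq (pow_ne_zero _ (pow_ne_zero _ hg0)), ← pow_mul, ← pow_mul,
        ← Units.val_pow_eq_pow_val, ← Units.val_pow_eq_pow_val, Units.val_inj,
        pow_eq_pow_iff_modEq, ← orderOf_units, hgN, hN, mul_comm (2 * u), mul_comm (m a + j)]
      exact hum.mul_left' _)
  have : ((g : L) ^ j)⁻¹ * (g : L) ^ (2 * u) = k • a := by
    rw [Algebra.smul_def, hk, pow_add, hm a ha0]
    field_simp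
  rw [this, map_smul, hatr, smul_zero]
end

section
/- Let q be a power of a prime p ≥ 5 and let n ≥ 3 be a positive integer with gcd(n, p) = 1. Then there exists an element of F_{q^n} that is simultaneously 2-primitive and 1-normal over F_q. -/
section Sieve

open Finset
open scoped Classical

variable {A X : Type*} [AddCommGroup A] [Fintype X]

/-- The weighted character sums `∑ x, w x * Ψ (φ x)`, over the characters `Ψ` of `A` trivial
on `Γ`, are within `E` of `M` for the trivial character and of `0` for all others. -/
def CharSumBound (φ : X → A) (w : X → ℝ) (Γ : AddSubgroup A) (M E : ℝ) : Prop :=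
  ∀ Ψ : AddChar A ℂ, (∀ a ∈ Γ, Ψ a = 1) →
    ‖∑ x, (w x : ℂ) * Ψ (φ x) - if Ψ = 0 then (M : ℂ) else 0‖ ≤ E

variable {φ : X → A} {w : X → ℝ} {Γ D : AddSubgroup A} {M E : ℝ}

/-- The pullback of a character of the quotient `A ⧸ D` to `A`. -/
def quotChar (D : AddSubgroup A) (τ : AddChar (A ⧸ D) ℂ) : AddChar A ℂ :=
  τ.compAddMonoidHom (QuotientAddGroup.mk' D)

lemma quotChar_apply (τ : AddChar (A ⧸ D) ℂ) (a : A) :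
    quotChar D τ a = τ (a : A ⧸ D) := rfl

lemma quotChar_apply_of_mem (τ : AddChar (A ⧸ D) ℂ) {a : A} (ha : a ∈ D) :
    quotChar D τ a = 1 := by
  rw [quotChar_apply, (QuotientAddGroup.eq_zero_iff a).2 ha, AddChar.map_zero_eq_one]

lemma add_quotChar_eq_zero_iff (hΓ : Γ ⊔ D = ⊤) {Ψ : AddChar A ℂ} (hΨ : ∀ a ∈ Γ, Ψ a = 1)
    (τ : AddChar (A ⧸ D) ℂ) : Ψ + quotChar D τ = 0 ↔ Ψ = 0 ∧ τ = 0 := by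
  constructor
  · intro h
    have h' (a : A) : Ψ a * quotChar D τ a = 1 := by
      rw [← AddChar.add_apply, h, AddChar.zero_apply]
    have h0 : Ψ = 0 := by
      ext a
      have ha : a ∈ Γ ⊔ D := hΓ ▸ AddSubgroup.mem_top a
      obtain ⟨b, hb, c, hc, rfl⟩ := AddSubgroup.mem_sup.1 ha
      have hc' := h' c
      rw [quotChar_apply_of_mem τ hc, mul_one] at hc'
      rw [AddChar.map_add_eq_mul, hΨ b hb, hc', one_mul, AddChar.zero_apply]
    refine ⟨h0, ?_⟩
    ext a
    induction a using QuotientAddGroup.induction_on with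
    | H a =>
      have := h' a
      rwa [h0, AddChar.zero_apply, one_mul, quotChar_apply] at this
  · rintro ⟨rfl, rfl⟩
    ext a
    simp [quotChar_apply]

lemma CharSumBound.abs_sum_sub_le (h : CharSumBound φ w Γ M E) : |∑ x, w x - M| ≤ E := by
  have := h 0 (by simp)
  rw [if_pos rfl] at this
  simp only [AddChar.zero_apply, mul_one] at this
  rw [← Real.norm_eq_abs, ← Complex.norm_real]
  simpa using this

variable [Finite A]

/-- Multiplying the weight by a function that is constant on cosets of `D`. -/
lemma CharSumBound.mul (h : CharSumBound φ w (Γ ⊓ D) M E) (hΓ : Γ ⊔ D = ⊤)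
    (c : AddChar (A ⧸ D) ℂ → ℝ) (g : A → ℝ)
    (hg : ∀ a, (g a : ℂ) = ∑ τ, (c τ : ℂ) * quotChar D τ a) :
    CharSumBound φ (fun x => w x * g (φ x)) Γ (c 0 * M) ((∑ τ, |c τ|) * E) := by
  intro Ψ hΨ
  have h1 : ∑ x, ((w x * g (φ x) : ℝ) : ℂ) * Ψ (φ x) - (if Ψ = 0 then ((c 0 * M : ℝ) : ℂ) else 0)
      = ∑ τ, (c τ : ℂ) * (∑ x, (w x : ℂ) * (Ψ + quotChar D τ) (φ x) -
          if Ψ + quotChar D τ = 0 then (M : ℂ) else 0) := by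
    simp_rw [mul_sub, sum_sub_distrib, add_quotChar_eq_zero_iff hΓ hΨ]
    congr 1
    · simp_rw [mul_sum]
      rw [sum_comm]
      refine sum_congr rfl fun x _ => ?_
      push_cast
      rw [hg, mul_sum, sum_mul]
      refine sum_congr rfl fun τ _ => ?_
      simp only [Pi.mul_apply]
      ring
    · by_cases h0 : Ψ = 0
      · simp [h0]
      · simp [h0]
  rw [h1, sum_mul]
  refine (norm_sum_le _ _).trans (sum_le_sum fun τ _ => ?_)
  rw [norm_mul, Complex.norm_real, Real.norm_eq_abs]
  refine mul_le_mul_of_nonneg_left (h _ ?_) (abs_nonneg _)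
  intro a ha
  rw [AddChar.add_apply, hΨ a ha.1, quotChar_apply_of_mem τ ha.2, one_mul]

lemma card_quotChar (D : AddSubgroup A) : Fintype.card (AddChar (A ⧸ D) ℂ) = D.index := by
  have : Fintype (A ⧸ D) := Fintype.ofFinite _
  rw [AddSubgroup.index, Nat.card_eq_fintype_card, ← AddChar.card_eq (α := A ⧸ D)]

lemma index_pos (D : AddSubgroup A) : (0 : ℝ) < D.index :=
  Nat.cast_pos.2 (Nat.pos_of_ne_zero AddSubgroup.FiniteIndex.index_ne_zero)

/-- The indicator function of a subgroup. -/
noncomputable def ind (D : AddSubgroup A) (a : A) : ℝ := if a ∈ D then 1 else 0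

lemma sum_quotChar (D : AddSubgroup A) (a : A) :
    ∑ τ, quotChar D τ a = (D.index : ℂ) * (ind D a : ℝ) := by
  have : Fintype (A ⧸ D) := Fintype.ofFinite _
  simp_rw [quotChar_apply, ind]
  rw [AddChar.sum_apply_eq_ite]
  simp only [QuotientAddGroup.eq_zero_iff, AddSubgroup.index, Nat.card_eq_fintype_card]
  split_ifs <;> simp

lemma ind_eq_sum (D : AddSubgroup A) (a : A) :
    (ind D a : ℂ) = ∑ τ, (((D.index : ℝ)⁻¹ : ℝ) : ℂ) * quotChar D τ a := by
  rw [← mul_sum, sum_quotChar, ← mul_assoc]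
  have : (D.index : ℂ) ≠ 0 := by exact_mod_cast (index_pos D).ne'
  push_cast
  rw [inv_mul_cancel₀ this, one_mul]

lemma CharSumBound.mul_ind (h : CharSumBound φ w (Γ ⊓ D) M E) (hΓ : Γ ⊔ D = ⊤) :
    CharSumBound φ (fun x => w x * ind D (φ x)) Γ ((D.index : ℝ)⁻¹ * M) E := by
  have := h.mul hΓ (fun _ => (D.index : ℝ)⁻¹) (ind D) (ind_eq_sum D)
  have hi := index_pos D
  rwa [sum_const, card_univ, card_quotChar, abs_of_pos (inv_pos.2 hi), nsmul_eq_mul,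
    mul_inv_cancel₀ hi.ne', one_mul] at this

lemma CharSumBound.mul_one_sub_ind (h : CharSumBound φ w (Γ ⊓ D) M E) (hΓ : Γ ⊔ D = ⊤) :
    CharSumBound φ (fun x => w x * (1 - ind D (φ x))) Γ ((1 - (D.index : ℝ)⁻¹) * M)
      (2 * (1 - (D.index : ℝ)⁻¹) * E) := by
  have hi := index_pos D
  have hi1 : (D.index : ℝ)⁻¹ ≤ 1 := by
    refine inv_le_one_of_one_le₀ ?_
    exact_mod_cast (show 0 < D.index by exact_mod_cast hi)
  have := h.mul hΓ (fun τ => (if τ = 0 then 1 else 0) - (D.index : ℝ)⁻¹) (fun a => 1 - ind D a) ?_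
  · convert this using 1
    · simp
    · have hs (τ : AddChar (A ⧸ D) ℂ) : |(if τ = 0 then 1 else 0) - (D.index : ℝ)⁻¹| =
          (if τ = 0 then 1 - 2 * (D.index : ℝ)⁻¹ else 0) + (D.index : ℝ)⁻¹ := by
        split_ifs
        · rw [abs_of_nonneg (by linarith)]; ring
        · rw [zero_sub, abs_neg, abs_of_pos (inv_pos.2 hi), zero_add]
      simp_rw [hs]
      rw [sum_add_distrib, sum_const, card_univ, card_quotChar, nsmul_eq_mul,
        mul_inv_cancel₀ hi.ne']
      simp
      left
      ring
  · intro a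
    simp_rw [Complex.ofReal_sub, sub_mul]
    rw [sum_sub_distrib, ind_eq_sum]
    congr 1
    simp_rw [apply_ite Complex.ofReal]
    simp [quotChar_apply]

/-- The weight of `D₂ \ D`, for a subgroup `D` of index `4` inside a subgroup `D₂` of
index `2`. -/
lemma CharSumBound.mul_ind_sub_ind (h : CharSumBound φ w (Γ ⊓ D) M E) (hΓ : Γ ⊔ D = ⊤)
    {D₂ : AddSubgroup A} (hD : D ≤ D₂) (h4 : D.index = 4) (h2 : D₂.index = 2) :
    CharSumBound φ (fun x => w x * (ind D₂ (φ x) - ind D (φ x))) Γ (4⁻¹ * M) E := by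
  let r : AddChar (A ⧸ D₂) ℂ → AddChar (A ⧸ D) ℂ := fun σ =>
    σ.compAddMonoidHom (QuotientAddGroup.map D D₂ (AddMonoidHom.id A) hD)
  have hr (σ : AddChar (A ⧸ D₂) ℂ) (a : A) : quotChar D (r σ) a = quotChar D₂ σ a := rfl
  have hinj : Function.Injective r := by
    intro σ σ' hσ
    ext a
    induction a using QuotientAddGroup.induction_on with
    | H a => rw [← quotChar_apply, ← quotChar_apply, ← hr, ← hr, hσ]
  let c : AddChar (A ⧸ D) ℂ → ℝ := fun τ => (∑ σ, if r σ = τ then 2⁻¹ else 0) - 4⁻¹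
  have hc (σ : AddChar (A ⧸ D₂) ℂ) : c (r σ) = 4⁻¹ := by
    simp only [c, hinj.eq_iff, sum_ite_eq', mem_univ, if_true]
    norm_num
  have hc' (τ : AddChar (A ⧸ D) ℂ) : |c τ| = 4⁻¹ := by
    by_cases hτ : ∃ σ, r σ = τ
    · obtain ⟨σ, rfl⟩ := hτ
      rw [hc, abs_of_pos (by norm_num)]
    · push Not at hτ
      simp only [c, hτ, if_false, sum_const_zero, zero_sub, abs_neg]
      norm_num
  have h0 : r 0 = 0 := by
    ext a
    rfl
  have := h.mul hΓ c (fun a => ind D₂ a - ind D a) ?_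
  · rw [← h0, hc] at this
    simp_rw [hc'] at this
    rw [sum_const, card_univ, card_quotChar, h4] at this
    norm_num at this
    rwa [one_div] at this
  · intro a
    simp_rw [c, Complex.ofReal_sub, sub_mul]
    rw [sum_sub_distrib, ind_eq_sum, ind_eq_sum, h4, h2]
    congr 1
    · simp_rw [Complex.ofReal_sum, sum_mul]
      rw [sum_comm]
      refine sum_congr rfl fun σ _ => ?_
      simp_rw [apply_ite Complex.ofReal]
      simp [hr]

variable {ι : Type*} [DecidableEq ι] {D : ι → AddSubgroup A} {J : Finset ι}

lemma CharSumBound.mul_prod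
    (hJ : ∀ i t, i ∉ t → insert i t ⊆ J → t.inf D ⊔ D i = ⊤)
    (hw : ∀ t ⊆ J, CharSumBound φ w (t.inf D) M E) (core : Finset ι) :
    core ⊆ J → ∀ t ⊆ J, Disjoint core t →
      CharSumBound φ (fun x => w x * ∏ i ∈ core, (1 - ind (D i) (φ x))) (t.inf D)
        ((∏ i ∈ core, (1 - ((D i).index : ℝ)⁻¹)) * M)
        (2 ^ #core * (∏ i ∈ core, (1 - ((D i).index : ℝ)⁻¹)) * E) := by
  induction core using Finset.induction_on with
  | empty =>
    intro _ t ht _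
    simpa using hw t ht
  | insert i c hi ih =>
    intro hc t ht hdisj
    rw [disjoint_insert_left] at hdisj
    have hit : insert i t ⊆ J := insert_subset (hc (mem_insert_self i c)) ht
    have := ih ((subset_insert i c).trans hc) (insert i t) hit
      (disjoint_insert_right.2 ⟨hi, hdisj.2⟩)
    rw [inf_insert, inf_comm] at this
    have := this.mul_one_sub_ind (hJ i t hdisj.1 hit)
    convert this using 1
    · ext x
      rw [prod_insert hi]
      ring
    · rw [prod_insert hi]
      ring
    · rw [prod_insert hi, card_insert_of_notMem hi]
      ring

/-- A sieve: the conditions in `core` are imposed exactly, those in `rest` by a union bound. -/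
theorem exists_forall_notMem_of_charSumBound
    (hJ : ∀ i t, i ∉ t → insert i t ⊆ J → t.inf D ⊔ D i = ⊤)
    (hw : ∀ t ⊆ J, CharSumBound φ w (t.inf D) M E) (hw0 : ∀ x, 0 ≤ w x)
    {core rest : Finset ι} (hdisj : Disjoint core rest) (hcore : core ⊆ J) (hrest : rest ⊆ J)
    (hindex : ∀ i ∈ core, 2 ≤ (D i).index)
    (hlt : 2 ^ #core * E * (#rest + 1) < (1 - ∑ i ∈ rest, ((D i).index : ℝ)⁻¹) * M) :
    ∃ x, w x ≠ 0 ∧ ∀ i ∈ core ∪ rest, φ x ∉ D i := by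
  by_contra! hno
  set P : ℝ := ∏ i ∈ core, (1 - ((D i).index : ℝ)⁻¹) with hP
  have hPpos : 0 < P := by
    refine prod_pos fun i hi => sub_pos.2 (inv_lt_one_of_one_lt₀ ?_)
    exact_mod_cast hindex i hi
  set v : X → ℝ := fun x => w x * ∏ i ∈ core, (1 - ind (D i) (φ x)) with hv
  have hb := CharSumBound.mul_prod hJ hw core hcore
  have hind (i : ι) (x : X) : 0 ≤ ind (D i) (φ x) ∧ ind (D i) (φ x) ≤ 1 := by
    unfold ind
    split_ifs <;> norm_num
  have hv0 (x : X) : 0 ≤ v x :=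
    mul_nonneg (hw0 x) (prod_nonneg fun i _ => sub_nonneg.2 (hind i x).2)
  have hpoint (x : X) : v x ≤ ∑ i ∈ rest, v x * ind (D i) (φ x) := by
    rcases eq_or_ne (v x) 0 with h0 | h0
    · simp [h0]
    · obtain ⟨i, hi, hxi⟩ := hno x (left_ne_zero_of_mul h0)
      have hone : ind (D i) (φ x) = 1 := if_pos hxi
      rcases mem_union.1 hi with hi | hi
      · exact absurd (prod_eq_zero hi (by rw [hone, sub_self])) (right_ne_zero_of_mul h0)
      · calc v x = v x * ind (D i) (φ x) := by rw [hone, mul_one]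
          _ ≤ _ := single_le_sum (f := fun i => v x * ind (D i) (φ x))
            (fun j _ => mul_nonneg (hv0 x) (hind j x).1) hi
  have hlow := (abs_le.1 (hb ∅ (empty_subset _) (disjoint_empty_right _)).abs_sum_sub_le).1
  have hup (i : ι) (hi : i ∈ rest) : ∑ x, v x * ind (D i) (φ x) ≤
      ((D i).index : ℝ)⁻¹ * (P * M) + 2 ^ #core * P * E := by
    have h1 := hb {i} (singleton_subset_iff.2 (hrest hi))
      (disjoint_singleton_right.2 (disjoint_right.1 hdisj hi))
    rw [inf_singleton, ← top_inf_eq (D i)] at h1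
    have h2 := (abs_le.1 (h1.mul_ind (top_sup_eq _)).abs_sum_sub_le).2
    linarith
  have hsum : ∑ x, v x ≤ ∑ i ∈ rest, (((D i).index : ℝ)⁻¹ * (P * M) + 2 ^ #core * P * E) :=
    calc ∑ x, v x ≤ ∑ x, ∑ i ∈ rest, v x * ind (D i) (φ x) := sum_le_sum fun x _ => hpoint x
      _ = ∑ i ∈ rest, ∑ x, v x * ind (D i) (φ x) := sum_comm
      _ ≤ _ := sum_le_sum hup
  rw [sum_add_distrib, ← sum_mul, sum_const, nsmul_eq_mul] at hsum
  have hmul := mul_lt_mul_of_pos_left hlt hPpos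
  linarith

end Sieve

section GaussSum

open Finset
open scoped Classical

variable {L : Type*} [Field L] [Fintype L]

lemma norm_gaussSum_le {χ : MulChar L ℂ} {ψ : AddChar L ℂ} (h : χ ≠ 1 ∨ ψ ≠ 1) :
    ‖gaussSum χ ψ‖ ≤ √(Fintype.card L) := by
  have hone : (1 : ℝ) ≤ √(Fintype.card L) := by
    rw [Real.one_le_sqrt]
    exact_mod_cast Fintype.card_pos
  rcases eq_or_ne χ 1 with rfl | hχ
  · rw [gaussSum_one_left (by simpa using h), norm_neg, norm_one]
    exact hone
  rcases eq_or_ne ψ 1 with rfl | hψ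
  · rw [gaussSum_one_right hχ, norm_zero]
    exact zero_le_one.trans hone
  have h1 := gaussSum_mul_gaussSum_eq_card hχ (AddChar.IsPrimitive.of_ne_one hψ)
  rw [← star_gaussSum_eq, Complex.star_def, Complex.mul_conj, Complex.normSq_eq_norm_sq] at h1
  rw [Real.le_sqrt (norm_nonneg _) (Nat.cast_nonneg _)]
  exact le_of_eq (by exact_mod_cast h1)

/-- The diagonal embedding of `Lˣ` in the product of its multiplicative group and the additive
group of `L`. -/
def diagUnit (x : Lˣ) : Additive Lˣ × L := (Additive.ofMul x, x)

lemma charSumBound_diagUnit (Γ : AddSubgroup (Additive Lˣ × L)) :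
    CharSumBound (diagUnit (L := L)) (fun _ => 1) Γ (Fintype.card L - 1) √(Fintype.card L) := by
  intro Ψ _
  simp only [Complex.ofReal_one, one_mul]
  split_ifs with h0
  · subst h0
    simp [Fintype.card_units, Nat.cast_sub Fintype.card_pos]
  rw [sub_zero]
  let ψ : AddChar L ℂ := Ψ.compAddMonoidHom (AddMonoidHom.inr _ _)
  let u : Lˣ →* ℂ :=
    { toFun := fun x => Ψ (Additive.ofMul x, 0)
      map_one' := Ψ.map_zero_eq_one
      map_mul' := fun x y => by
        rw [← AddChar.map_add_eq_mul, Prod.mk_add_mk, add_zero, ofMul_mul] }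
  let χ : MulChar L ℂ := MulChar.ofUnitHom u.toHomUnits
  have hχ (x : Lˣ) : χ x = Ψ (Additive.ofMul x, 0) := MulChar.ofUnitHom_coe _ x
  have hsplit (x : Lˣ) (y : L) : Ψ (Additive.ofMul x, y) = χ x * ψ y := by
    rw [hχ, AddChar.compAddMonoidHom_apply, ← AddChar.map_add_eq_mul]
    simp
  have hne : χ ≠ 1 ∨ ψ ≠ 1 := by
    by_contra! hcon
    refine h0 ?_
    ext ⟨x, y⟩
    have := hsplit (Additive.toMul x) y
    rw [ofMul_toMul] at this
    rw [this, hcon.1, hcon.2]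
    simp
  have hsum : ∑ x : Lˣ, Ψ (diagUnit x) = gaussSum χ ψ := by
    rw [gaussSum, ← Finset.sum_subset (subset_univ (univ.filter fun x : L => x ≠ 0))]
    · refine Finset.sum_bij' (fun x _ => (x : L)) (fun x hx => Units.mk0 x (mem_filter.1 hx).2)
        ?_ ?_ ?_ ?_ ?_ <;> simp [diagUnit, hsplit]
    · intro x _ hx
      have : x = 0 := by simpa using hx
      rw [this, MulChar.map_zero, zero_mul]
  rw [hsum]
  exact norm_gaussSum_le hne

end GaussSum

section Frobenius

open Polynomial Module

variable {K L : Type*} [Field K]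

/-- The polynomial `(X ^ n - 1) / P`, for `n` the degree of the extension `L / K`. -/
noncomputable def coPoly (n : ℕ) (P : K[X]) : K[X] := (X ^ n - 1) / P

lemma mul_coPoly {n : ℕ} {P : K[X]} (hP : P ∣ X ^ n - 1) : P * coPoly n P = X ^ n - 1 := by
  rcases eq_or_ne P 0 with rfl | h0
  · rw [zero_mul, zero_dvd_iff.1 hP]
  · exact EuclideanDomain.mul_div_cancel' h0 hP

lemma X_pow_sub_one_ne_zero' {n : ℕ} (hn : n ≠ 0) : (X ^ n - 1 : K[X]) ≠ 0 :=
  (monic_X_pow_sub_C (1 : K) hn).ne_zero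

lemma sum_X_pow_mul {n : ℕ} : (X - 1) * ∑ i ∈ Finset.range n, (X : K[X]) ^ i = X ^ n - 1 := by
  rw [mul_geom_sum]

lemma natDegree_geom_sum {n : ℕ} (hn : n ≠ 0) :
    (∑ i ∈ Finset.range n, (X : K[X]) ^ i).natDegree = n - 1 ∧
      (∑ i ∈ Finset.range n, (X : K[X]) ^ i).Monic := by
  have hm : (∑ i ∈ Finset.range n, (X : K[X]) ^ i).Monic := monic_geom_sum_X hn
  refine ⟨?_, hm⟩
  have h1 := congrArg natDegree (sum_X_pow_mul (K := K) (n := n))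
  rw [← C_1, (monic_X_sub_C (1 : K)).natDegree_mul hm, natDegree_X_sub_C,
    natDegree_X_pow_sub_C] at h1
  omega

variable [Field L] [Algebra K L] [Fintype K]

variable (K L) in
/-- The action of `K[X]` on `L` in which `X` acts as the Frobenius map `x ↦ x ^ #K`. -/
noncomputable def frobAct : K[X] →ₐ[K] End K L :=
  aeval (FiniteField.frobeniusAlgHom K L).toLinearMap

lemma frobAct_X_pow_apply (i : ℕ) (x : L) : frobAct K L (X ^ i) x = x ^ Fintype.card K ^ i := by
  rw [frobAct, map_pow, aeval_X, Module.End.coe_pow]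
  exact congrFun (pow_iterate (Fintype.card K) i) x

lemma frobAct_mul_apply (f g : K[X]) (x : L) :
    frobAct K L (f * g) x = frobAct K L f (frobAct K L g x) := by
  rw [map_mul, Module.End.mul_apply]

lemma frobAct_mul_apply' (f g : K[X]) (x : L) :
    frobAct K L (f * g) x = frobAct K L g (frobAct K L f x) := by
  rw [mul_comm, frobAct_mul_apply]

/-- If the annihilator of `α` contains `h` but no `h / P`, then it is generated by `h`. -/
lemma natDegree_le_of_frobAct_eq_zero {h : K[X]} (h0 : h ≠ 0) {α : L}
    (hα : frobAct K L h α = 0)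
    (hmin : ∀ P g : K[X], Irreducible P → h = P * g → frobAct K L g α ≠ 0)
    {g : K[X]} (hg0 : g ≠ 0) (hg : frobAct K L g α = 0) : h.natDegree ≤ g.natDegree := by
  classical
  set d := EuclideanDomain.gcd h g with hd
  have hdα : frobAct K L d α = 0 := by
    rw [hd, EuclideanDomain.gcd_eq_gcd_ab, map_add, LinearMap.add_apply, frobAct_mul_apply',
      frobAct_mul_apply', hα, hg, map_zero, map_zero, add_zero]
  obtain ⟨e, he⟩ := EuclideanDomain.gcd_dvd_left h g
  rw [← hd] at he
  have he0 : e ≠ 0 := right_ne_zero_of_mul (he ▸ h0)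
  have hunit : IsUnit e := by
    by_contra hu
    obtain ⟨P, hP, c, rfl⟩ := WfDvdMonoid.exists_irreducible_factor hu he0
    refine hmin P (d * c) hP (by rw [he]; ring) ?_
    rw [frobAct_mul_apply', hdα, map_zero]
  rw [he, natDegree_mul (left_ne_zero_of_mul (he ▸ h0)) he0, natDegree_eq_zero_of_isUnit hunit,
    add_zero]
  exact natDegree_le_of_dvd (EuclideanDomain.gcd_dvd_right h g) hg0

/-- The polynomial conditions under which an element of trace zero is `1`-normal. -/
lemma finrank_span_of_frobAct {n : ℕ} (hn : 2 ≤ n) {α : L}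
    (htr : frobAct K L (∑ i ∈ Finset.range n, X ^ i) α = 0)
    (hP : ∀ P : K[X], Irreducible P → P.Monic → P ∣ X ^ n - 1 → P ≠ X - 1 →
      frobAct K L (coPoly n P) α ≠ 0)
    (hcop : ¬ (X - 1 : K[X]) ∣ ∑ i ∈ Finset.range n, (X : K[X]) ^ i) :
    finrank K (conjSpan K (Fintype.card K) n α) = n - 1 := by
  set h : K[X] := ∑ i ∈ Finset.range n, X ^ i with hh
  obtain ⟨hdeg, hmonic⟩ := natDegree_geom_sum (K := K) (n := n) (by omega)
  rw [← hh] at hdeg hmonic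
  have hmin : ∀ P g : K[X], Irreducible P → h = P * g → frobAct K L g α ≠ 0 := by
    intro P g hPi hPg hg
    have hlc : P.leadingCoeff⁻¹ ≠ 0 := inv_ne_zero (leadingCoeff_ne_zero.2 hPi.ne_zero)
    have hassoc : Associated (P * C P.leadingCoeff⁻¹) P :=
      associated_mul_unit_left P _ (isUnit_C.2 hlc.isUnit)
    have hdvd : P * C P.leadingCoeff⁻¹ ∣ X ^ n - 1 := by
      rw [hassoc.dvd_iff_dvd_left, ← sum_X_pow_mul, ← hh, hPg]
      exact ⟨(X - 1) * g, by ring⟩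
    refine hP _ (hassoc.symm.irreducible hPi) (monic_mul_leadingCoeff_inv hPi.ne_zero) hdvd ?_ ?_
    · intro h1
      exact hcop (by rw [← h1, hassoc.dvd_iff_dvd_left, hPg]; exact dvd_mul_right _ _)
    · have h2 := mul_coPoly hdvd
      have h3 : coPoly n (P * C P.leadingCoeff⁻¹) = C P.leadingCoeff * (X - 1) * g := by
        have hne : P * C P.leadingCoeff⁻¹ ≠ 0 := hassoc.symm.ne_zero_iff.1 hPi.ne_zero
        refine mul_left_cancel₀ hne ?_
        rw [h2, ← sum_X_pow_mul, ← hh, hPg]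
        have : C P.leadingCoeff⁻¹ * C P.leadingCoeff = (1 : K[X]) := by
          rw [← C_mul, inv_mul_cancel₀ (leadingCoeff_ne_zero.2 hPi.ne_zero), C_1]
        linear_combination (-(X - 1) * P * g) * this
      rw [h3, frobAct_mul_apply, hg, map_zero]
  have hle := fun g => natDegree_le_of_frobAct_eq_zero hmonic.ne_zero htr hmin (g := g)
  let v : Fin (n - 1) → L := fun i => α ^ Fintype.card K ^ (i : ℕ)
  have hli : LinearIndependent K v := by
    rw [Fintype.linearIndependent_iff]
    intro c hc
    by_contra! hne
    obtain ⟨j, hj⟩ := hne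
    set g : K[X] := ∑ i : Fin (n - 1), C (c i) * X ^ (i : ℕ) with hg
    have hcoeff (j : Fin (n - 1)) : g.coeff j = c j := by
      rw [hg, finsetSum_coeff]
      simp [coeff_X_pow, Fin.val_inj]
    have hg0 : g ≠ 0 := fun h0 => hj (by rw [← hcoeff, h0, coeff_zero])
    have hgα : frobAct K L g α = 0 := by
      rw [← hc, hg, map_sum, LinearMap.sum_apply]
      refine Finset.sum_congr rfl fun i _ => ?_
      rw [← smul_eq_C_mul, map_smul, LinearMap.smul_apply, frobAct_X_pow_apply]
    have h1 := hle g hg0 hgα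
    have h2 : g.natDegree ≤ n - 2 := by
      refine natDegree_sum_le_of_forall_le _ _ fun i _ => ?_
      refine (natDegree_C_mul_X_pow_le _ _).trans ?_
      have := i.2
      omega
    omega
  have hspan : conjSpan K (Fintype.card K) n α = Submodule.span K (Set.range v) := by
    refine le_antisymm (Submodule.span_le.2 ?_) (Submodule.span_mono ?_)
    · rintro _ ⟨i, rfl⟩
      by_cases hi : (i : ℕ) < n - 1
      · exact Submodule.subset_span ⟨⟨i, hi⟩, rfl⟩
      · have hi' : (i : ℕ) = n - 1 := by have := i.2; omega
        rw [hh, map_sum, LinearMap.sum_apply, show n = n - 1 + 1 by omega,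
          Finset.sum_range_succ] at htr
        simp only [frobAct_X_pow_apply] at htr
        simp only [hi', SetLike.mem_coe]
        rw [add_comm, add_eq_zero_iff_eq_neg] at htr
        rw [htr]
        refine Submodule.neg_mem _ (Submodule.sum_mem _ fun j hj => ?_)
        exact Submodule.subset_span ⟨⟨j, Finset.mem_range.1 hj⟩, rfl⟩
    · rintro _ ⟨i, rfl⟩
      exact ⟨⟨i, by omega⟩, rfl⟩
  rw [hspan, finrank_span_eq_card hli, Fintype.card_fin]

variable [Finite L]

lemma frobAct_X_pow_sub_one : frobAct K L (X ^ finrank K L - 1) = 0 := by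
  rw [← FiniteField.minpoly_frobeniusAlgHom, frobAct, minpoly.aeval]

lemma frobAct_ne_zero {g : K[X]} (hg : g ≠ 0) (hdeg : g.natDegree < finrank K L) :
    frobAct K L g ≠ 0 := by
  intro h
  have h1 := natDegree_le_of_dvd
    (minpoly.dvd K (FiniteField.frobeniusAlgHom K L).toLinearMap h) hg
  rw [FiniteField.minpoly_frobeniusAlgHom, ← C_1, natDegree_X_pow_sub_C] at h1
  omega

end Frobenius

section SieveGroup

open Polynomial Module
open scoped Classical

variable {K L : Type*} [Field K] [Field L] [Algebra K L] [Fintype K]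

variable (K L) in
/-- The subgroups to be avoided: the `d`-th powers in `Lˣ`, and the kernels of
`(X ^ n - 1) / P`, for `n = [L : K]`, on `L`. -/
noncomputable def sieveGroup : ℕ ⊕ K[X] → AddSubgroup (Additive Lˣ × L)
  | .inl d => (Subgroup.toAddSubgroup (powMonoidHom d : Lˣ →* Lˣ).range).comap
      (AddMonoidHom.fst _ _)
  | .inr P => (LinearMap.ker (frobAct K L (coPoly (finrank K L) P))).toAddSubgroup.comap
      (AddMonoidHom.snd _ _)

lemma mem_sieveGroup_inr {P : K[X]} {x : Additive Lˣ} {y : L} :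
    (x, y) ∈ sieveGroup K L (.inr P) ↔ frobAct K L (coPoly (finrank K L) P) y = 0 := Iff.rfl

lemma sieveGroup_inl_le {d e : ℕ} (h : d ∣ e) :
    sieveGroup K L (.inl e) ≤ sieveGroup K L (.inl d) := by
  rintro ⟨x, y⟩ ⟨z, hz⟩
  obtain ⟨c, rfl⟩ := h
  refine ⟨z ^ c, ?_⟩
  rw [← hz]
  simp [← pow_mul, mul_comm]

lemma index_sieveGroup_inr (P : K[X]) :
    (sieveGroup K L (.inr P)).index =
      Nat.card (LinearMap.range (frobAct K L (coPoly (finrank K L) P))) := by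
  rw [sieveGroup, AddSubgroup.index_comap_of_surjective _ Prod.snd_surjective]
  exact AddSubgroup.index_ker (frobAct K L (coPoly (finrank K L) P)).toAddMonoidHom

variable [Fintype L]

lemma index_sieveGroup_inl {d : ℕ} (hd : d ∣ Fintype.card L - 1) :
    (sieveGroup K L (.inl d)).index = d := by
  rw [sieveGroup, AddSubgroup.index_comap_of_surjective _ Prod.fst_surjective,
    Subgroup.index_toAddSubgroup, IsCyclic.index_powMonoidHom_range, Nat.card_eq_fintype_card,
    Fintype.card_units, Nat.gcd_eq_right hd]

lemma frobAct_comp_coPoly {P : K[X]} (hP : P ∣ X ^ finrank K L - 1) (x : L) :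
    frobAct K L P (frobAct K L (coPoly (finrank K L) P) x) = 0 := by
  rw [← frobAct_mul_apply, mul_coPoly hP, frobAct_X_pow_sub_one, LinearMap.zero_apply]

lemma le_index_sieveGroup_inr {P : K[X]} (hPi : Irreducible P)
    (hP : P ∣ X ^ finrank K L - 1) :
    Fintype.card K ^ P.natDegree ≤ (sieveGroup K L (.inr P)).index := by
  have hn : finrank K L ≠ 0 := finrank_pos.ne'
  have hne := X_pow_sub_one_ne_zero' (K := K) hn
  have hmul := mul_coPoly hP
  have hco0 : coPoly (finrank K L) P ≠ 0 := right_ne_zero_of_mul (hmul ▸ hne)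
  have hdeg : (coPoly (finrank K L) P).natDegree < finrank K L := by
    have h1 := congrArg natDegree hmul
    rw [natDegree_mul hPi.ne_zero hco0, ← C_1, natDegree_X_pow_sub_C] at h1
    have := hPi.natDegree_pos
    omega
  obtain ⟨v, hv⟩ : ∃ v, frobAct K L (coPoly (finrank K L) P) v ≠ 0 := by
    by_contra! h
    exact frobAct_ne_zero hco0 hdeg (LinearMap.ext h)
  set u := frobAct K L (coPoly (finrank K L) P) v with hu
  have hPu : frobAct K L P u = 0 := frobAct_comp_coPoly hP v
  let e : degreeLT K P.natDegree → LinearMap.range (frobAct K L (coPoly (finrank K L) P)) :=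
    fun g => ⟨frobAct K L g.1 u, frobAct K L g.1 v, by
      rw [hu, ← frobAct_mul_apply, ← frobAct_mul_apply']⟩
  have hinj : Function.Injective e := by
    intro g g' hgg
    by_contra hne'
    have hsub : (g.1 - g'.1) ≠ 0 := sub_ne_zero.2 fun h => hne' (Subtype.ext h)
    have h0 : frobAct K L (g.1 - g'.1) u = 0 := by
      rw [map_sub, LinearMap.sub_apply, sub_eq_zero]
      exact congrArg Subtype.val hgg
    have hlt : (g.1 - g'.1).degree < P.natDegree :=
      mem_degreeLT.1 ((degreeLT K P.natDegree).sub_mem g.2 g'.2)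
    have hcop : IsCoprime P (g.1 - g'.1) := by
      rw [hPi.coprime_iff_not_dvd]
      intro hdvd
      have h1 := natDegree_le_of_dvd hdvd hsub
      rw [degree_eq_natDegree hsub] at hlt
      exact absurd h1 (not_le.2 (by exact_mod_cast hlt))
    obtain ⟨a, b, hab⟩ := hcop
    refine hv ?_
    have h2 : frobAct K L (a * P + b * (g.1 - g'.1)) u = u := by
      rw [hab, map_one, Module.End.one_apply]
    rw [map_add, LinearMap.add_apply, frobAct_mul_apply, frobAct_mul_apply, hPu, h0, map_zero,
      map_zero, add_zero] at h2
    exact h2.symm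
  have hcard := Nat.card_le_card_of_injective e hinj
  rw [index_sieveGroup_inr]
  refine le_trans (le_of_eq ?_) hcard
  rw [Nat.card_congr (degreeLTEquiv K P.natDegree).toEquiv]
  simp

/-- The kernel of the trace map has index at most `#K`. -/
lemma index_sieveGroup_X_sub_one_le :
    (sieveGroup K L (.inr (X - 1))).index ≤ Fintype.card K := by
  have hq : 1 < Fintype.card K := Fintype.one_lt_card
  rw [index_sieveGroup_inr]
  have hdvd : (X - 1 : K[X]) ∣ X ^ finrank K L - 1 := by
    simpa using sub_dvd_pow_sub_pow (X : K[X]) 1 (finrank K L)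
  let f : L[X] := X ^ Fintype.card K - X
  have hf : f ≠ 0 := FiniteField.X_pow_card_sub_X_ne_zero L hq
  have hroot : (LinearMap.range (frobAct K L (coPoly (finrank K L) (X - 1))) : Set L) ⊆
      f.roots.toFinset := by
    rintro _ ⟨x, rfl⟩
    have := frobAct_comp_coPoly hdvd x
    rw [map_sub, map_one, LinearMap.sub_apply, Module.End.one_apply, ← pow_one X,
      frobAct_X_pow_apply, pow_one] at this
    simpa [f, hf] using this
  calc _ ≤ (f.roots.toFinset : Set L).ncard := Set.ncard_le_ncard hroot (Finset.finite_toSet _)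
    _ = f.roots.toFinset.card := Set.ncard_coe_finset _
    _ ≤ f.roots.card := Multiset.toFinset_card_le _
    _ ≤ f.natDegree := card_roots' f
    _ = _ := FiniteField.X_pow_card_sub_X_natDegree_eq L hq

/-- Distinct irreducible factors and pairwise coprime exponents give independent conditions. -/
lemma inf_sieveGroup_sup_eq_top {J : Finset (ℕ ⊕ K[X])} (hn : (finrank K L : K) ≠ 0)
    (hcop : ∀ d e, .inl d ∈ J → .inl e ∈ J → d ≠ e → d.Coprime e)
    (hpoly : ∀ P, .inr P ∈ J → Irreducible P ∧ P.Monic ∧ P ∣ X ^ finrank K L - 1)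
    (i : ℕ ⊕ K[X]) (t : Finset (ℕ ⊕ K[X])) (hit : i ∉ t) (ht : insert i t ⊆ J) :
    t.inf (sieveGroup K L) ⊔ sieveGroup K L i = ⊤ := by
  rw [eq_top_iff]
  rintro ⟨x, y⟩ -
  rw [AddSubgroup.mem_sup]
  have hmem {a : Additive Lˣ × L} (h : ∀ j ∈ t, a ∈ sieveGroup K L j) :
      a ∈ t.inf (sieveGroup K L) := by
    rw [← SetLike.mem_coe, Finset.inf_eq_iInf]
    simpa using h
  have htJ {j} (hj : j ∈ t) : j ∈ J := ht (Finset.mem_insert_of_mem hj)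
  have hiJ : i ∈ J := ht (Finset.mem_insert_self i t)
  cases i with
  | inl d =>
    set N := ∏ j ∈ t, Sum.elim id (fun _ => 1) j with hN
    have hdN : IsCoprime (N : ℤ) (d : ℤ) := by
      rw [Nat.isCoprime_iff_coprime, hN]
      refine Nat.Coprime.prod_left fun j hj => ?_
      cases j with
      | inl e => exact hcop e d (htJ hj) hiJ (by rintro rfl; exact hit hj)
      | inr P => exact Nat.coprime_one_left d
    obtain ⟨a, b, hab⟩ := hdN
    refine ⟨(Additive.ofMul ((x.toMul ^ a) ^ N), 0), hmem fun j hj => ?_,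
      (Additive.ofMul ((x.toMul ^ b) ^ d), y), ⟨x.toMul ^ b, rfl⟩, ?_⟩
    · cases j with
      | inl e =>
        obtain ⟨c, hc⟩ : e ∣ N := Finset.dvd_prod_of_mem (Sum.elim id (fun _ => 1)) hj
        exact ⟨(x.toMul ^ a) ^ c, by rw [hc, mul_comm, pow_mul]; rfl⟩
      | inr P => exact mem_sieveGroup_inr.2 (map_zero _)
    · rw [Prod.mk_add_mk, zero_add, ← ofMul_mul, ← zpow_natCast, ← zpow_natCast, ← zpow_mul,
        ← zpow_mul, ← zpow_add, hab, zpow_one, ofMul_toMul]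
  | inr P =>
    obtain ⟨hPi, hPm, hP⟩ := hpoly P hiJ
    have hsep : (X ^ finrank K L - 1 : K[X]).Separable := X_pow_sub_one_separable_iff.2 hn
    rw [← mul_coPoly hP] at hsep
    obtain ⟨a, b, hab⟩ := hsep.isCoprime
    refine ⟨(0, frobAct K L (b * coPoly (finrank K L) P) y), hmem fun j hj => ?_,
      (x, frobAct K L (a * P) y), ?_, ?_⟩
    · cases j with
      | inl e => exact ⟨1, one_pow e⟩
      | inr R =>
        obtain ⟨hRi, hRm, hR⟩ := hpoly R (htJ hj)
        have hRP : ¬ P ∣ R := fun hdvd => hit <| by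
          rwa [eq_of_monic_of_associated hPm hRm
            ((hPi.dvd_irreducible_iff_associated hRi).1 hdvd)]
        have hdvd : P ∣ coPoly (finrank K L) R := by
          have h1 := hP
          rw [← mul_coPoly hR] at h1
          exact (hPi.prime.dvd_or_dvd h1).resolve_left hRP
        obtain ⟨c, hc⟩ := hdvd
        rw [mem_sieveGroup_inr, hc, ← frobAct_mul_apply,
          show P * c * (b * coPoly (finrank K L) P) = c * b * (P * coPoly (finrank K L) P) by ring,
          mul_coPoly hP, frobAct_mul_apply, frobAct_X_pow_sub_one]
        simp
    · rw [mem_sieveGroup_inr, ← frobAct_mul_apply,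
        show coPoly (finrank K L) P * (a * P) = a * (P * coPoly (finrank K L) P) by ring,
        mul_coPoly hP, frobAct_mul_apply, frobAct_X_pow_sub_one]
      simp
    · rw [Prod.mk_add_mk, zero_add, ← LinearMap.add_apply, ← map_add, add_comm, hab, map_one,
        Module.End.one_apply]

end SieveGroup

section Factors

open Polynomial Finset UniqueFactorizationMonoid
open scoped Classical

variable (K : Type*) [Field K] (n : ℕ)

/-- The monic irreducible factors of `X ^ n - 1` other than `X - 1`. -/
noncomputable def unitFactors : Finset K[X] :=
  (normalizedFactors (X ^ n - 1 : K[X])).toFinset.erase (X - 1)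

variable {K n}

lemma mem_factors (hn : n ≠ 0) {P : K[X]} :
    P ∈ normalizedFactors (X ^ n - 1 : K[X]) ↔ Irreducible P ∧ P.Monic ∧ P ∣ X ^ n - 1 :=
  Polynomial.mem_normalizedFactors_iff (X_pow_sub_one_ne_zero' hn)

lemma mem_unitFactors (hn : n ≠ 0) {P : K[X]} :
    P ∈ unitFactors K n ↔ P ≠ X - 1 ∧ Irreducible P ∧ P.Monic ∧ P ∣ X ^ n - 1 := by
  rw [unitFactors, mem_erase, Multiset.mem_toFinset, mem_factors hn]

lemma sum_natDegree_factors_le (hn : n ≠ 0) :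
    ∑ P ∈ (normalizedFactors (X ^ n - 1 : K[X])).toFinset, P.natDegree ≤ n := by
  have h0 := X_pow_sub_one_ne_zero' (K := K) hn
  have hdvd : ∏ P ∈ (normalizedFactors (X ^ n - 1 : K[X])).toFinset, P ∣ X ^ n - 1 := by
    refine dvd_trans ?_ (prod_normalizedFactors h0).dvd
    rw [Finset.prod_eq_multiset_prod, Multiset.map_id', Multiset.toFinset_val]
    exact Multiset.prod_dvd_prod_of_le (Multiset.dedup_le _)
  have h1 := natDegree_le_of_dvd hdvd h0
  rwa [natDegree_prod_of_monic _ _ fun P hP =>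
    ((mem_factors hn).1 (Multiset.mem_toFinset.1 hP)).2.1, ← C_1, natDegree_X_pow_sub_C] at h1

lemma X_sub_one_mem_factors (hn : n ≠ 0) :
    (X - 1 : K[X]) ∈ normalizedFactors (X ^ n - 1 : K[X]) := by
  refine (mem_factors hn).2 ⟨?_, ?_, ?_⟩
  · rw [← C_1]; exact irreducible_X_sub_C 1
  · rw [← C_1]; exact monic_X_sub_C 1
  · simpa using sub_dvd_pow_sub_pow (X : K[X]) 1 n

variable [Fintype K]

lemma card_linear_factors_le (hn : n ≠ 0) :
    #{P ∈ (normalizedFactors (X ^ n - 1 : K[X])).toFinset | P.natDegree = 1} ≤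
      n.gcd (Fintype.card K - 1) := by
  have hr : 0 < n.gcd (Fintype.card K - 1) := Nat.gcd_pos_of_pos_left _ (Nat.pos_of_ne_zero hn)
  refine le_trans (card_le_card_of_injOn (t := nthRootsFinset (n.gcd (Fintype.card K - 1)) (1 : K))
    (fun P => -P.coeff 0) ?_ ?_) ?_
  · intro P hP
    simp only [coe_filter, Set.mem_ofPred_eq, Multiset.mem_toFinset] at hP
    obtain ⟨_, hm, hdvd⟩ := (mem_factors hn).1 hP.1
    have hP' : P = X - C (-P.coeff 0) := by
      rw [map_neg, sub_neg_eq_add]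
      exact hm.eq_X_add_C hP.2
    rw [hP', dvd_iff_isRoot, IsRoot, eval_sub, eval_pow, eval_X, eval_one, sub_eq_zero] at hdvd
    have h0 : -P.coeff 0 ≠ 0 := by
      rintro h
      rw [h, zero_pow hn] at hdvd
      exact zero_ne_one hdvd
    rw [mem_coe, mem_nthRootsFinset hr]
    exact pow_gcd_eq_one.2 ⟨hdvd, FiniteField.pow_card_sub_one_eq_one _ h0⟩
  · intro P hP R hR hPR
    simp only [coe_filter, Set.mem_ofPred_eq, Multiset.mem_toFinset] at hP hR
    rw [((mem_factors hn).1 hP.1).2.1.eq_X_add_C hP.2,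
      ((mem_factors hn).1 hR.1).2.1.eq_X_add_C hR.2, neg_inj.1 hPR]
  · exact (Multiset.toFinset_card_le _).trans (card_nthRoots _ _)

/-- The number of linear and of nonlinear factors. -/
lemma exists_card_factors (hn : n ≠ 0) : ∃ a b : ℕ, a + 1 ≤ n.gcd (Fintype.card K - 1) ∧
    a + 1 + 2 * b ≤ n ∧ #(unitFactors K n) = a + b ∧
    ∑ P ∈ unitFactors K n, ((Fintype.card K : ℝ) ^ P.natDegree)⁻¹ ≤
      a / (Fintype.card K : ℝ) + b / (Fintype.card K : ℝ) ^ 2 := by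
  set T := (normalizedFactors (X ^ n - 1 : K[X])).toFinset with hT
  set U := unitFactors K n with hU
  have hX : (X - 1 : K[X]) ∈ T := Multiset.mem_toFinset.2 (X_sub_one_mem_factors hn)
  have hX1 : (X - 1 : K[X]).natDegree = 1 := by rw [← C_1, natDegree_X_sub_C]
  have hTU : insert (X - 1) U = T := insert_erase hX
  have hXU : (X - 1 : K[X]) ∉ U := notMem_erase _ _
  have hpos (P) (hP : P ∈ U) : 1 ≤ P.natDegree :=
    ((mem_unitFactors hn).1 hP).2.1.natDegree_pos
  have hq : (1 : ℝ) ≤ Fintype.card K := by exact_mod_cast Fintype.card_pos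
  have hcard := card_filter_add_card_filter_not (s := U) (fun P => P.natDegree = 1)
  refine ⟨#{P ∈ U | P.natDegree = 1}, #{P ∈ U | ¬ P.natDegree = 1}, ?_, ?_, hcard.symm, ?_⟩
  · have := card_linear_factors_le (K := K) hn
    rwa [← hT, ← hTU, filter_insert, if_pos hX1, card_insert_of_notMem] at this
    simp [hXU]
  · have := sum_natDegree_factors_le (K := K) hn
    rw [← hT, ← hTU, sum_insert hXU, hX1,
      ← sum_filter_add_sum_filter_not U (fun P => P.natDegree = 1)] at this
    have h1 : ∑ P ∈ U with P.natDegree = 1, P.natDegree = #{P ∈ U | P.natDegree = 1} := by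
      rw [card_eq_sum_ones]
      exact sum_congr rfl fun P hP => (mem_filter.1 hP).2
    have h2 : #{P ∈ U | ¬ P.natDegree = 1} * 2 ≤ ∑ P ∈ U with ¬ P.natDegree = 1, P.natDegree := by
      rw [← smul_eq_mul]
      refine card_nsmul_le_sum _ _ _ fun P hP => ?_
      have := hpos P (mem_filter.1 hP).1
      have := (mem_filter.1 hP).2
      omega
    omega
  · rw [← sum_filter_add_sum_filter_not U (fun P => P.natDegree = 1)]
    refine add_le_add ?_ ?_
    · rw [div_eq_mul_inv, ← nsmul_eq_mul]
      refine sum_le_card_nsmul _ _ _ fun P hP => ?_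
      rw [(mem_filter.1 hP).2, pow_one]
    · rw [div_eq_mul_inv, ← nsmul_eq_mul]
      refine sum_le_card_nsmul _ _ _ fun P hP => ?_
      have h1 := hpos P (mem_filter.1 hP).1
      have h2 := (mem_filter.1 hP).2
      refine inv_anti₀ (by positivity) (pow_le_pow_right₀ hq (by omega))

lemma two_mul_card_unitFactors_le (hn : n ≠ 0) :
    2 * (#(unitFactors K n) + 1) ≤ n + n.gcd (Fintype.card K - 1) := by
  obtain ⟨a, b, h1, h2, h3, -⟩ := exists_card_factors (K := K) hn
  omega

lemma sum_inv_unitFactors_le (hn : n ≠ 0) :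
    ∑ P ∈ unitFactors K n, ((Fintype.card K : ℝ) ^ P.natDegree)⁻¹ ≤
      ((n.gcd (Fintype.card K - 1) : ℝ) - 1) / Fintype.card K +
        ((n : ℝ) - n.gcd (Fintype.card K - 1)) / (2 * (Fintype.card K : ℝ) ^ 2) := by
  obtain ⟨a, b, h1, h2, -, h4⟩ := exists_card_factors (K := K) hn
  refine h4.trans ?_
  have hq : (1 : ℝ) ≤ Fintype.card K := by exact_mod_cast Fintype.card_pos
  set q : ℝ := (Fintype.card K : ℝ)
  set r : ℝ := (n.gcd (Fintype.card K - 1) : ℝ)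
  have h1' : (a : ℝ) + 1 ≤ r := by simp only [r]; exact_mod_cast h1
  have h2' : (a : ℝ) + 1 + 2 * b ≤ n := by exact_mod_cast h2
  rw [div_add_div _ _ (by positivity) (by positivity),
    div_add_div _ _ (by positivity) (by positivity), div_le_div_iff₀ (by positivity) (by positivity)]
  have : a * q ^ 2 * 2 + 2 * q * b ≤ (r - 1) * (2 * q ^ 2) + q * (n - r) := by
    nlinarith [mul_nonneg (sub_nonneg.2 h1') (sub_nonneg.2 hq),
      mul_le_mul_of_nonneg_left h2' (by positivity : 0 ≤ q),
      mul_nonneg (mul_nonneg (sub_nonneg.2 h1') (sub_nonneg.2 hq)) (by positivity : 0 ≤ q)]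
  nlinarith [mul_le_mul_of_nonneg_left this (by positivity : 0 ≤ q^3)]

end Factors

section Criterion

open Polynomial Module Finset
open scoped Classical

/-- The odd primes dividing `1 + q + ⋯ + q ^ (n - 1)`. -/
def oddPrimes (q n : ℕ) : Finset ℕ := (∑ i ∈ range n, q ^ i).primeFactors.erase 2

/-- The reciprocal of the proportion cut out by the condition modulo `4`. -/
def parityFactor (n : ℕ) : ℕ := if Even n then 4 else 1

lemma mem_oddPrimes {q n ℓ : ℕ} :
    ℓ ∈ oddPrimes q n ↔ ℓ ≠ 2 ∧ ℓ.Prime ∧ ℓ ∣ ∑ i ∈ range n, q ^ i ∧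
      ∑ i ∈ range n, q ^ i ≠ 0 := by
  rw [oddPrimes, mem_erase, Nat.mem_primeFactors]

lemma geom_sum_mul_sub_one (q n : ℕ) (hq : 1 ≤ q) :
    (∑ i ∈ range n, q ^ i) * (q - 1) = q ^ n - 1 := by
  zify [hq, Nat.one_le_pow n q hq]
  exact geom_sum_mul _ _

/-- The combinatorial inequality under which the sieve succeeds. -/
def SieveCriterion (q n : ℕ) : Prop :=
  ∃ C ⊆ oddPrimes q n,
    (2 : ℝ) ^ #C * √((q : ℝ) ^ n) * (parityFactor n * q) *
        (#(oddPrimes q n \ C) + ((n + n.gcd (q - 1)) / 2 : ℕ)) <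
      (1 - ∑ ℓ ∈ oddPrimes q n \ C, (ℓ : ℝ)⁻¹ - (((n.gcd (q - 1) : ℝ) - 1) / q +
        ((n : ℝ) - n.gcd (q - 1)) / (2 * (q : ℝ) ^ 2))) * ((q : ℝ) ^ n - 1) ∨
    (2 : ℝ) ^ (#C + ((n + n.gcd (q - 1)) / 2 - 1)) * √((q : ℝ) ^ n) * (parityFactor n * q) *
        (#(oddPrimes q n \ C) + 1) <
      (1 - ∑ ℓ ∈ oddPrimes q n \ C, (ℓ : ℝ)⁻¹) * ((q : ℝ) ^ n - 1)

variable {K L : Type*} [Field K] [Field L] [Algebra K L] [Fintype K] [Fintype L]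

/-- The conditions imposed by the sieve on a unit of `L`. -/
structure SieveConditions (K : Type*) {L : Type*} [Field K] [Field L] [Algebra K L] [Fintype K]
    (x : Lˣ) : Prop where
  trace : frobAct K L (coPoly (finrank K L) (X - 1)) x = 0
  isSquare : Even (finrank K L) → ∃ z, z ^ 2 = x
  not_fourth : Even (finrank K L) → ¬ ∃ z, z ^ 4 = x
  not_pow : ∀ ℓ ∈ oddPrimes (Fintype.card K) (finrank K L), ¬ ∃ z, z ^ ℓ = x
  not_ker : ∀ P ∈ unitFactors K (finrank K L), frobAct K L (coPoly (finrank K L) P) x ≠ 0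

lemma dvd_card_sub_one_of_mem_oddPrimes {ℓ : ℕ}
    (hℓ : ℓ ∈ oddPrimes (Fintype.card K) (finrank K L)) : ℓ ∣ Fintype.card L - 1 := by
  rw [Module.card_eq_pow_finrank (K := K) (V := L),
    ← geom_sum_mul_sub_one _ _ Fintype.card_pos]
  exact (mem_oddPrimes.1 hℓ).2.2.1.mul_right _

lemma four_dvd_card_sub_one (hodd : Odd (Fintype.card K)) (hev : Even (finrank K L)) :
    4 ∣ Fintype.card L - 1 := by
  obtain ⟨k, hk⟩ := hev
  obtain ⟨j, hj⟩ := hodd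
  rw [Module.card_eq_pow_finrank (K := K) (V := L), hk, ← two_mul, pow_mul]
  refine dvd_trans ?_ (Nat.sub_one_dvd_pow_sub_one (Fintype.card K ^ 2) k)
  rw [hj]
  exact ⟨j * j + j, by
    rw [show (2 * j + 1) ^ 2 = 4 * (j * j + j) + 1 by ring, Nat.add_sub_cancel]⟩

lemma exists_sieveConditions_of_lt (hodd : Odd (Fintype.card K)) (hn : (finrank K L : K) ≠ 0)
    {C R : Finset ℕ} {U V : Finset K[X]} (hCR : Disjoint C R) (hUV : Disjoint U V)
    (hC : C ∪ R = oddPrimes (Fintype.card K) (finrank K L))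
    (hU : U ∪ V = unitFactors K (finrank K L))
    (hlt : (2 : ℝ) ^ (#C + #U) * √(Fintype.card L) *
        (parityFactor (finrank K L) * Fintype.card K) * (#R + #V + 1) <
      (1 - ∑ ℓ ∈ R, (ℓ : ℝ)⁻¹ - ∑ P ∈ V, ((Fintype.card K : ℝ) ^ P.natDegree)⁻¹) *
        (Fintype.card L - 1)) :
    ∃ x : Lˣ, SieveConditions K x := by
  set n := finrank K L with hnr
  have hn0 : n ≠ 0 := finrank_pos.ne'
  set S := oddPrimes (Fintype.card K) n with hS
  set T := unitFactors K n with hT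
  let D := sieveGroup K L
  let J : Finset (ℕ ⊕ K[X]) :=
    (if Even n then insert 4 S else S).disjSum (insert (X - 1) T)
  have hXT : (X - 1 : K[X]) ∉ T := fun h => ((mem_unitFactors hn0).1 h).1 rfl
  have h4S : 4 ∉ S := fun h => by
    have := (mem_oddPrimes.1 h).2.1
    norm_num at this
  have hcop : ∀ d e, .inl d ∈ J → .inl e ∈ J → d ≠ e → d.Coprime e := by
    have hodd4 (e : ℕ) (he : e ∈ S) : Nat.Coprime 4 e := by
      obtain ⟨h2, hpe, -⟩ := mem_oddPrimes.1 he
      exact Nat.Coprime.pow_left 2 ((Nat.coprime_primes Nat.prime_two hpe).2 (Ne.symm h2))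
    have hSS (d e : ℕ) (hd : d ∈ S) (he : e ∈ S) (hne : d ≠ e) : d.Coprime e :=
      (Nat.coprime_primes (mem_oddPrimes.1 hd).2.1 (mem_oddPrimes.1 he).2.1).2 hne
    intro d e hd he hne
    simp only [J, inl_mem_disjSum] at hd he
    split_ifs at hd he with hev
    · rcases mem_insert.1 hd with rfl | hd <;> rcases mem_insert.1 he with rfl | he
      · exact absurd rfl hne
      · exact hodd4 e he
      · exact (hodd4 d hd).symm
      · exact hSS d e hd he hne
    · exact hSS d e hd he hne
  have hpoly : ∀ P, .inr P ∈ J → Irreducible P ∧ P.Monic ∧ P ∣ X ^ n - 1 := by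
    intro P hP
    rcases mem_insert.1 (inr_mem_disjSum.1 hP) with rfl | hP
    · exact (mem_factors hn0).1 (X_sub_one_mem_factors hn0)
    · exact ((mem_unitFactors hn0).1 hP).2
  have hJ := inf_sieveGroup_sup_eq_top (J := J) hn hcop hpoly
  have hXJ : .inr (X - 1) ∈ J := inr_mem_disjSum.2 (mem_insert_self _ _)
  set H := D (.inr (X - 1)) with hH
  have hw1 (t : Finset (ℕ ⊕ K[X])) (ht : t ⊆ J) (htX : .inr (X - 1) ∉ t) :
      CharSumBound (diagUnit (L := L)) (fun x => ind H (diagUnit x)) (t.inf D)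
        ((H.index : ℝ)⁻¹ * (Fintype.card L - 1)) √(Fintype.card L) := by
    simpa using (charSumBound_diagUnit (L := L) (t.inf D ⊓ H)).mul_ind
      (hJ _ t htX (insert_subset hXJ ht))
  have hsub : S.disjSum T ⊆ J := by
    refine disjSum_mono ?_ (subset_insert _ _)
    split_ifs
    exacts [subset_insert _ _, subset_rfl]
  have hXsub {t : Finset (ℕ ⊕ K[X])} (ht : t ⊆ S.disjSum T) : .inr (X - 1) ∉ t :=
    fun h => hXT (inr_mem_disjSum.1 (ht h))
  have hind {B : AddSubgroup (Additive Lˣ × L)} (a) : 0 ≤ ind B a := by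
    unfold ind
    split_ifs <;> norm_num
  have hindne {B : AddSubgroup (Additive Lˣ × L)} {a} (h : ind B a ≠ 0) : a ∈ B := by
    by_contra hcon
    exact h (if_neg hcon)
  obtain ⟨w, hw0, hwne, hw⟩ : ∃ w : Lˣ → ℝ, (∀ x, 0 ≤ w x) ∧
      (∀ x, w x ≠ 0 → diagUnit x ∈ H ∧ (Even n → diagUnit x ∈ D (.inl 2) ∧
        diagUnit x ∉ D (.inl 4))) ∧
      ∀ t ⊆ S.disjSum T, CharSumBound (diagUnit (L := L)) w (t.inf D)
        ((parityFactor n : ℝ)⁻¹ * ((H.index : ℝ)⁻¹ * (Fintype.card L - 1)))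
          √(Fintype.card L) := by
    by_cases hev : Even n
    · have h4dvd := four_dvd_card_sub_one (L := L) hodd hev
      have hle : D (.inl 4) ≤ D (.inl 2) := sieveGroup_inl_le (by norm_num)
      refine ⟨fun x => ind H (diagUnit x) * (ind (D (.inl 2)) (diagUnit x) -
        ind (D (.inl 4)) (diagUnit x)), ?_, ?_, ?_⟩
      · intro x
        refine mul_nonneg (hind _) (sub_nonneg.2 ?_)
        unfold ind
        split_ifs with h1 h2
        · exact le_rfl
        · exact absurd (hle h1) h2
        · exact zero_le_one
        · exact le_rfl
      · intro x hx
        refine ⟨hindne (left_ne_zero_of_mul hx), fun _ => ?_⟩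
        have h1 := right_ne_zero_of_mul hx
        by_cases h4 : diagUnit x ∈ D (.inl 4)
        · exact absurd (by simp [ind, h4, hle h4]) h1
        · refine ⟨hindne (B := D (.inl 2)) fun h0 => h1 ?_, h4⟩
          rw [h0]
          simp [ind, h4]
      · intro t ht
        have h4t : .inl 4 ∉ t := fun h => h4S (inl_mem_disjSum.1 (ht h))
        have h4J : insert (.inl 4) t ⊆ J := by
          refine insert_subset ?_ (ht.trans hsub)
          simp [J, hev]
        have := hw1 _ h4J (by simp [hXsub ht])
        rw [inf_insert, inf_comm] at this
        have := this.mul_ind_sub_ind (hJ _ t h4t h4J) hle (index_sieveGroup_inl h4dvd)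
          (index_sieveGroup_inl (dvd_trans (by norm_num) h4dvd))
        simpa [parityFactor, hev] using this
    · refine ⟨fun x => ind H (diagUnit x), fun x => hind _,
        fun x hx => ⟨hindne hx, fun h => absurd h hev⟩, fun t ht => ?_⟩
      simpa [parityFactor, hev] using hw1 t (ht.trans hsub) (hXsub ht)
  have hcore : C.disjSum U ⊆ S.disjSum T :=
    disjSum_mono (hC ▸ subset_union_left) (hU ▸ subset_union_left)
  have hrest : R.disjSum V ⊆ S.disjSum T :=
    disjSum_mono (hC ▸ subset_union_right) (hU ▸ subset_union_right)
  have hindex_inl {ℓ : ℕ} (h : ℓ ∈ S) : (D (.inl ℓ)).index = ℓ :=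
    index_sieveGroup_inl (dvd_card_sub_one_of_mem_oddPrimes h)
  have hindex_inr {P : K[X]} (h : P ∈ T) :
      Fintype.card K ^ P.natDegree ≤ (D (.inr P)).index :=
    le_index_sieveGroup_inr ((mem_unitFactors hn0).1 h).2.1 ((mem_unitFactors hn0).1 h).2.2.2
  have hq1 : 1 < Fintype.card K := Fintype.one_lt_card
  obtain ⟨x, hx, hxD⟩ : ∃ x, w x ≠ 0 ∧ ∀ i ∈ C.disjSum U ∪ R.disjSum V, diagUnit x ∉ D i := by
    refine exists_forall_notMem_of_charSumBound (D := D) (J := S.disjSum T)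
      (fun i t hi ht => hJ i t hi (ht.trans hsub)) hw hw0 ?_ hcore hrest ?_ ?_
    · rw [disjoint_left]
      rintro (ℓ | P) h1 h2
      · exact disjoint_left.1 hCR (inl_mem_disjSum.1 h1) (inl_mem_disjSum.1 h2)
      · exact disjoint_left.1 hUV (inr_mem_disjSum.1 h1) (inr_mem_disjSum.1 h2)
    · rintro (ℓ | P) h
      · have hℓ : ℓ ∈ S := inl_mem_disjSum.1 (hcore h)
        rw [hindex_inl hℓ]
        exact (mem_oddPrimes.1 hℓ).2.1.two_le
      · have hP : P ∈ T := inr_mem_disjSum.1 (hcore h)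
        refine le_trans ?_ (hindex_inr hP)
        exact hq1.trans_le (Nat.le_self_pow
          (((mem_unitFactors hn0).1 hP).2.1.natDegree_pos.ne') _)
    · rw [card_disjSum, card_disjSum, sum_disjSum]
      have hκ : (0 : ℝ) < parityFactor n := by unfold parityFactor; split_ifs <;> norm_num
      have hq0 : (0 : ℝ) < Fintype.card K := by exact_mod_cast Fintype.card_pos
      have hL1 : (0 : ℝ) < Fintype.card L - 1 := by
        rw [sub_pos]; exact_mod_cast Fintype.one_lt_card
      have hHpos : (0 : ℝ) < H.index := index_pos H
      have hHle : (H.index : ℝ) ≤ Fintype.card K := by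
        exact_mod_cast index_sieveGroup_X_sub_one_le
      have hs1 : ∑ ℓ ∈ R, ((D (.inl ℓ)).index : ℝ)⁻¹ = ∑ ℓ ∈ R, (ℓ : ℝ)⁻¹ :=
        sum_congr rfl fun ℓ hℓ => by rw [hindex_inl (hC ▸ mem_union_right _ hℓ)]
      have hs2 : ∑ P ∈ V, ((D (.inr P)).index : ℝ)⁻¹ ≤
          ∑ P ∈ V, ((Fintype.card K : ℝ) ^ P.natDegree)⁻¹ :=
        sum_le_sum fun P hP => inv_anti₀ (by positivity)
          (by exact_mod_cast hindex_inr (hU ▸ mem_union_right _ hP))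
      rw [hs1]
      set s := ∑ ℓ ∈ R, (ℓ : ℝ)⁻¹
      set u := ∑ P ∈ V, ((Fintype.card K : ℝ) ^ P.natDegree)⁻¹
      set u' := ∑ P ∈ V, ((D (.inr P)).index : ℝ)⁻¹
      push_cast
      have hδ : 0 < 1 - s - u := by
        by_contra! hcon
        have h1 := mul_nonpos_of_nonpos_of_nonneg hcon hL1.le
        have h2 : 0 ≤ (2 : ℝ) ^ (#C + #U) * √(Fintype.card L) *
          (parityFactor n * Fintype.card K) * (#R + #V + 1) := by positivity
        linarith
      calc (2 : ℝ) ^ (#C + #U) * √(Fintype.card L) * (#R + #V + 1)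
          < (1 - s - u) * (Fintype.card L - 1) / (parityFactor n * Fintype.card K) := by
            rw [lt_div_iff₀ (by positivity)]
            linarith
        _ = (1 - s - u) * ((parityFactor n : ℝ)⁻¹ *
              ((Fintype.card K : ℝ)⁻¹ * (Fintype.card L - 1))) := by
            field_simp
        _ ≤ _ := by rw [← sub_sub]; gcongr; linarith
  have hxD' (i) (hi : i ∈ S.disjSum T) : diagUnit x ∉ D i := by
    refine hxD i ?_
    cases i with
    | inl ℓ =>
      rw [inl_mem_disjSum, ← hC, mem_union] at hi
      simpa using hi
    | inr P =>
      rw [inr_mem_disjSum, ← hU, mem_union] at hi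
      simpa using hi
  exact ⟨x, (hwne x hx).1, fun hev => ((hwne x hx).2 hev).1, fun hev => ((hwne x hx).2 hev).2,
    fun ℓ hℓ => hxD' (.inl ℓ) (inl_mem_disjSum.2 hℓ),
    fun P hP => hxD' (.inr P) (inr_mem_disjSum.2 hP)⟩

lemma exists_sieveConditions (hodd : Odd (Fintype.card K)) (hn : (finrank K L : K) ≠ 0)
    (h : SieveCriterion (Fintype.card K) (finrank K L)) : ∃ x : Lˣ, SieveConditions K x := by
  have hn0 : finrank K L ≠ 0 := finrank_pos.ne'
  have hcardL : (Fintype.card L : ℝ) = (Fintype.card K : ℝ) ^ finrank K L := by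
    exact_mod_cast Module.card_eq_pow_finrank (K := K) (V := L)
  have hL1 : (0 : ℝ) < Fintype.card L - 1 := by
    rw [sub_pos]; exact_mod_cast Fintype.one_lt_card
  have h2 := two_mul_card_unitFactors_le (K := K) hn0
  have h2' : #(unitFactors K (finrank K L)) + 1 ≤
    (finrank K L + (finrank K L).gcd (Fintype.card K - 1)) / 2 := by omega
  obtain ⟨C, hC, h | h⟩ := h
  · refine exists_sieveConditions_of_lt hodd hn (U := ∅) (V := unitFactors K (finrank K L))
      (disjoint_sdiff (s := C)) (disjoint_empty_left _) (union_sdiff_of_subset hC)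
      (empty_union _) ?_
    rw [← hcardL] at h
    refine lt_of_le_of_lt ?_ (h.trans_le ?_)
    · rw [card_empty, add_zero, add_assoc]
      gcongr
      exact_mod_cast h2'
    · gcongr
      exact sum_inv_unitFactors_le hn0
  · refine exists_sieveConditions_of_lt hodd hn (U := unitFactors K (finrank K L)) (V := ∅)
      (disjoint_sdiff (s := C)) (disjoint_empty_right _) (union_sdiff_of_subset hC)
      (union_empty _) ?_
    rw [← hcardL] at h
    refine lt_of_le_of_lt ?_ (h.trans_le ?_)
    · rw [card_empty, Nat.cast_zero, add_zero]
      gcongr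
      · norm_num
      · omega
    · simp

end Criterion

section Order

open Polynomial Module Finset

/-- An exponent `b ≡ a` modulo `m` with `gcd (b, m * s) = 2`. -/
lemma exists_gcd_eq_two {m s a : ℕ} (hm : m ≠ 0) (hs : Even s) (hs0 : s ≠ 0)
    (hodd : ∀ ℓ, ℓ.Prime → ℓ ≠ 2 → ℓ ∣ m → ¬ ℓ ∣ a)
    (hfour : ∃ j, (a + m * j) % 4 = 2) : ∃ j, (m * s).gcd (a + m * j) = 2 := by
  obtain ⟨j₀, hj₀⟩ := hfour
  set u := ∏ ℓ ∈ s.primeFactors with ¬ ℓ ∣ 4 * m, ℓ with hu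
  have hcop : (4 * m).Coprime u := by
    refine Nat.Coprime.prod_right fun ℓ hℓ => ?_
    rw [mem_filter] at hℓ
    exact ((Nat.prime_of_mem_primeFactors hℓ.1).coprime_iff_not_dvd.2 hℓ.2).symm
  obtain ⟨b, hb1, hb2⟩ := Nat.chineseRemainder hcop (a + m * j₀) 1
  have hu0 : 0 < u := prod_pos fun ℓ hℓ => (Nat.prime_of_mem_primeFactors (mem_filter.1 hℓ).1).pos
  set B := b + 4 * m * u * a with hB
  have hB1 : B ≡ a + m * j₀ [MOD 4 * m] := by
    have : B ≡ b + 0 [MOD 4 * m] :=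
      Nat.ModEq.add_left b ((Nat.modEq_zero_iff_dvd).2 ⟨u * a, by ring⟩)
    exact this.trans hb1
  have hB2 : B ≡ 1 [MOD u] := by
    have : B ≡ b + 0 [MOD u] :=
      Nat.ModEq.add_left b ((Nat.modEq_zero_iff_dvd).2 ⟨4 * m * a, by ring⟩)
    exact this.trans hb2
  have hBa : a ≤ B := by
    have : 1 * a ≤ 4 * m * u * a := Nat.mul_le_mul_right a (Nat.succ_le_of_lt (by positivity))
    omega
  have hBm : a ≡ B [MOD m] := by
    have h1 : B ≡ a + m * j₀ [MOD m] := hB1.of_dvd (Dvd.intro_left 4 rfl)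
    have h2 : a + m * j₀ ≡ a + 0 [MOD m] :=
      Nat.ModEq.add_left a ((Nat.modEq_zero_iff_dvd).2 (dvd_mul_right _ _))
    exact (h1.trans h2).symm
  obtain ⟨j, hj⟩ := (Nat.modEq_iff_dvd' hBa).1 hBm
  have hBj : B = a + m * j := by omega
  refine ⟨j, ?_⟩
  rw [← hBj]
  have hB4 : B % 4 = 2 := by
    have : B ≡ a + m * j₀ [MOD 4] := hB1.of_dvd (dvd_mul_right _ _)
    rw [Nat.ModEq, hj₀] at this
    exact this
  obtain ⟨e, he⟩ : 2 ∣ (m * s).gcd B :=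
    Nat.dvd_gcd (hs.two_dvd.mul_left m) (by omega)
  have he1 : e = 1 := by
    by_contra hne
    obtain ⟨ℓ, hℓ, hℓe⟩ := Nat.exists_prime_and_dvd hne
    have hℓB : 2 * ℓ ∣ B := (Nat.mul_dvd_mul_left 2 hℓe).trans (he ▸ Nat.gcd_dvd_right _ _)
    have hℓN : ℓ ∣ m * s := (hℓe.mul_left 2).trans (he ▸ Nat.gcd_dvd_left _ _)
    have hℓB' : ℓ ∣ B := (Dvd.intro_left 2 rfl).trans hℓB
    rcases eq_or_ne ℓ 2 with rfl | h2
    · omega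
    by_cases hℓm : ℓ ∣ m
    · refine hodd ℓ hℓ h2 hℓm ?_
      rw [hBj] at hℓB'
      exact (Nat.dvd_add_left (hℓm.mul_right j)).1 hℓB'
    · have hℓs : ℓ ∣ s := (hℓ.dvd_mul.1 hℓN).resolve_left hℓm
      have hℓ4 : ¬ ℓ ∣ 4 * m := by
        intro h
        rcases hℓ.dvd_mul.1 h with h | h
        · exact h2 ((Nat.prime_dvd_prime_iff_eq hℓ Nat.prime_two).1
            (hℓ.dvd_of_dvd_pow (show ℓ ∣ 2 ^ 2 from h)))
        · exact hℓm h
      have hℓu : ℓ ∣ u := dvd_prod_of_mem _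
        (mem_filter.2 ⟨Nat.mem_primeFactors.2 ⟨hℓ, hℓs, hs0⟩, hℓ4⟩)
      have h1 : B ≡ 1 [MOD ℓ] := hB2.of_dvd hℓu
      have h0 : B ≡ 0 [MOD ℓ] := Nat.modEq_zero_iff_dvd.2 hℓB'
      have := Nat.modEq_zero_iff_dvd.1 (h1.symm.trans h0)
      exact hℓ.one_lt.ne' (Nat.dvd_one.1 this)
  rw [he, he1, mul_one]

variable {K L : Type*} [Field K] [Field L] [Algebra K L] [Fintype K]

lemma exists_algebraMap_eq_of_pow_card_eq {y : L} (hy : y ^ Fintype.card K = y) :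
    ∃ c : K, algebraMap K L c = y := by
  have hq : 1 < Fintype.card K := Fintype.one_lt_card
  have hprod : ∏ c : K, (X - C c) = X ^ Fintype.card K - X := by
    have hm : (X ^ Fintype.card K - X : K[X]).Monic :=
      monic_X_pow_sub (by rw [degree_X]; exact_mod_cast hq)
    have := prod_multiset_X_sub_C_of_monic_of_roots_card_eq hm (by
      rw [FiniteField.roots_X_pow_card_sub_X, FiniteField.X_pow_card_sub_X_natDegree_eq K hq]
      rfl)
    rwa [FiniteField.roots_X_pow_card_sub_X] at this
  have h := congrArg (fun f => aeval y f) hprod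
  simp only [map_prod, map_sub, aeval_X, aeval_C, map_pow, hy, sub_self] at h
  obtain ⟨c, -, hc⟩ := prod_eq_zero_iff.1 h
  exact ⟨c, (sub_eq_zero.1 hc).symm⟩

lemma frobAct_smul (g : K[X]) (c : K) (x : L) : frobAct K L g (algebraMap K L c * x) =
    algebraMap K L c * frobAct K L g x := by
  rw [← Algebra.smul_def, ← Algebra.smul_def, map_smul]

lemma geom_sum_odd {q n : ℕ} (hq : Odd q) (hn : ¬ Even n) : Odd (∑ i ∈ range n, q ^ i) := by
  rw [odd_sum_iff_odd_card_odd]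
  simpa [hq.pow] using Nat.not_even_iff_odd.1 hn

variable [Fintype L]

lemma exists_orderOf_of_sieveConditions (hodd : Odd (Fintype.card K)) {x : Lˣ}
    (hx : SieveConditions K x) :
    ∃ c : K, c ≠ 0 ∧ orderOf (algebraMap K L c * x) = (Fintype.card L - 1) / 2 := by
  classical
  set q := Fintype.card K with hq
  set n := finrank K L with hn
  have hn0 : n ≠ 0 := finrank_pos.ne'
  have hq1 : 1 < q := Fintype.one_lt_card
  set m := ∑ i ∈ range n, q ^ i with hm
  have hm0 : m ≠ 0 := (sum_pos (fun i _ => by positivity) (nonempty_range_iff.2 hn0)).ne'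
  have hN : m * (q - 1) = Fintype.card L - 1 := by
    rw [geom_sum_mul_sub_one q n hq1.le, Module.card_eq_pow_finrank (K := K) (V := L)]
  obtain ⟨g, hg⟩ := IsCyclic.exists_generator (α := Lˣ)
  have hog : orderOf g = m * (q - 1) := by
    rw [orderOf_eq_card_of_forall_mem_zpowers hg, Nat.card_eq_fintype_card, Fintype.card_units, hN]
  obtain ⟨a, ha⟩ : ∃ a : ℕ, g ^ a = x := by
    have := hg x
    rw [← mem_powers_iff_mem_zpowers] at this
    exact this
  have heven : Even (q - 1) := by
    obtain ⟨k, hk⟩ := hodd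
    exact ⟨k, by omega⟩
  have hfour : ∃ j, (a + m * j) % 4 = 2 := by
    by_cases hev : Even n
    · refine ⟨0, ?_⟩
      have h4 := four_dvd_card_sub_one (K := K) (L := L) hodd hev
      rw [← hN, ← hog] at h4
      obtain ⟨z, hz⟩ := hx.isSquare hev
      obtain ⟨k, hk⟩ : ∃ k : ℕ, g ^ k = z := by
        have := hg z
        rw [← mem_powers_iff_mem_zpowers] at this
        exact this
      rw [← hk, ← ha, ← pow_mul, pow_eq_pow_iff_modEq] at hz
      have h2 : k * 2 ≡ a [MOD 2] := hz.of_dvd (dvd_trans (by norm_num) h4)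
      have hne : ¬ 4 ∣ a := by
        rintro ⟨e, he⟩
        exact hx.not_fourth hev ⟨g ^ e, by rw [← ha, he, ← pow_mul, mul_comm]⟩
      rw [Nat.ModEq] at h2
      omega
    · obtain ⟨k, hk⟩ := geom_sum_odd (q := q) (n := n) hodd hev
      rw [← hm] at hk
      rcases (by omega : m % 4 = 1 ∨ m % 4 = 3) with h | h
      · refine ⟨(a * 3 + 2) % 4, ?_⟩
        rw [Nat.add_mod, Nat.mul_mod, h]
        omega
      · refine ⟨(a + 2) % 4, ?_⟩
        rw [Nat.add_mod, Nat.mul_mod, h]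
        omega
  obtain ⟨j, hj⟩ := exists_gcd_eq_two hm0 heven (by omega) (fun ℓ hℓ h2 hℓm ⟨e, he⟩ =>
    hx.not_pow ℓ (mem_oddPrimes.2 ⟨h2, hℓ, hℓm, hm0⟩)
      ⟨g ^ e, by rw [← ha, he, ← pow_mul, mul_comm]⟩) hfour
  obtain ⟨c, hc⟩ := exists_algebraMap_eq_of_pow_card_eq (K := K) (y := ((g ^ (m * j) : Lˣ) : L)) <| by
    have h1 : (g ^ (m * j)) ^ (q - 1) = 1 := by
      rw [← pow_mul, show m * j * (q - 1) = m * (q - 1) * j by ring, ← hog, pow_mul,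
        pow_orderOf_eq_one, one_pow]
    rw [← Units.val_pow_eq_pow_val, ← hq, show q = q - 1 + 1 by omega, pow_succ, h1, one_mul]
  refine ⟨c, fun h0 => ?_, ?_⟩
  · rw [h0, map_zero] at hc
    exact (Units.ne_zero _) hc.symm
  · rw [hc, ← Units.val_mul, orderOf_units, ← ha, ← pow_add, add_comm, orderOf_pow, hog, hj, hN]

/-- The sieve criterion implies the existence of a `2`-primitive `1`-normal element. -/
theorem exists_of_sieveCriterion (hodd : Odd (Fintype.card K)) (hn2 : 2 ≤ finrank K L)
    (hn : (finrank K L : K) ≠ 0) (h : SieveCriterion (Fintype.card K) (finrank K L)) :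
    ∃ α : L, orderOf α = (Fintype.card L - 1) / 2 ∧
      finrank K (conjSpan K (Fintype.card K) (finrank K L) α) = finrank K L - 1 := by
  obtain ⟨x, hx⟩ := exists_sieveConditions (L := L) hodd hn h
  obtain ⟨c, hc0, hc⟩ := exists_orderOf_of_sieveConditions hodd hx
  have hn0 : finrank K L ≠ 0 := by omega
  refine ⟨_, hc, finrank_span_of_frobAct hn2 ?_ ?_ ?_⟩
  · have hco : coPoly (finrank K L) (X - 1 : K[X]) = ∑ i ∈ range (finrank K L), X ^ i := by
      have hX : (X - 1 : K[X]) ≠ 0 := by rw [← C_1]; exact X_sub_C_ne_zero 1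
      refine mul_left_cancel₀ hX ?_
      rw [mul_coPoly, sum_X_pow_mul]
      simpa using sub_dvd_pow_sub_pow (X : K[X]) 1 (finrank K L)
    rw [frobAct_smul, ← hco, hx.trace, mul_zero]
  · intro P hPi hPm hPd hP1
    rw [frobAct_smul]
    refine mul_ne_zero ?_ (hx.not_ker P ((mem_unitFactors hn0).2 ⟨hP1, hPi, hPm, hPd⟩))
    simpa using hc0
  · rw [← C_1, dvd_iff_isRoot, IsRoot, eval_finsetSum]
    simpa using hn

end Order

section CriterionBounds

open Finset

variable {q n : ℕ} {C : Finset ℕ} {s : ℕ} {σ τ : ℝ}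

lemma mul_sqrt_lt_of_sq_lt {x y z : ℝ} (hz : 0 ≤ z) (hy : 0 ≤ y) (h : x ^ 2 * z < y ^ 2) :
    x * √z < y := by
  refine lt_of_pow_lt_pow_left₀ 2 hy ?_
  rwa [mul_pow, Real.sq_sqrt hz]

lemma sieveCriterion_of_additive_sieved (hC : C ⊆ oddPrimes q n) (hq : 1 ≤ q)
    (hs : #(oddPrimes q n \ C) ≤ s) (hσ : ∑ ℓ ∈ oddPrimes q n \ C, (ℓ : ℝ)⁻¹ ≤ σ)
    (hτ : ((n.gcd (q - 1) : ℝ) - 1) / q + ((n : ℝ) - n.gcd (q - 1)) / (2 * (q : ℝ) ^ 2) ≤ τ)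
    (hστ : σ + τ ≤ 1)
    (h : ((2 : ℝ) ^ #C * (parityFactor n * q) * (s + ((n + n.gcd (q - 1)) / 2 : ℕ))) ^ 2 *
      (q : ℝ) ^ n < ((1 - σ - τ) * ((q : ℝ) ^ n - 1)) ^ 2) : SieveCriterion q n := by
  have hQ : (0 : ℝ) ≤ (q : ℝ) ^ n - 1 := sub_nonneg.2 (one_le_pow₀ (by exact_mod_cast hq))
  have hlt := mul_sqrt_lt_of_sq_lt (by positivity) (mul_nonneg (by linarith) hQ) h
  refine ⟨C, hC, .inl (lt_of_le_of_lt ?_ (hlt.trans_le ?_))⟩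
  · have : (#(oddPrimes q n \ C) : ℝ) ≤ s := by exact_mod_cast hs
    calc _ = (2 : ℝ) ^ #C * (parityFactor n * q) *
          (#(oddPrimes q n \ C) + ((n + n.gcd (q - 1)) / 2 : ℕ)) * √((q : ℝ) ^ n) := by ring
      _ ≤ _ := by gcongr
  · gcongr

lemma sieveCriterion_of_additive_core (hC : C ⊆ oddPrimes q n) (hq : 1 ≤ q)
    (hs : #(oddPrimes q n \ C) ≤ s) (hσ : ∑ ℓ ∈ oddPrimes q n \ C, (ℓ : ℝ)⁻¹ ≤ σ) (hσ1 : σ ≤ 1)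
    (h : ((2 : ℝ) ^ (#C + ((n + n.gcd (q - 1)) / 2 - 1)) * (parityFactor n * q) * (s + 1)) ^ 2 *
      (q : ℝ) ^ n < ((1 - σ) * ((q : ℝ) ^ n - 1)) ^ 2) : SieveCriterion q n := by
  have hQ : (0 : ℝ) ≤ (q : ℝ) ^ n - 1 := sub_nonneg.2 (one_le_pow₀ (by exact_mod_cast hq))
  have hlt := mul_sqrt_lt_of_sq_lt (by positivity) (mul_nonneg (by linarith) hQ) h
  refine ⟨C, hC, .inr (lt_of_le_of_lt ?_ (hlt.trans_le ?_))⟩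
  · have : (#(oddPrimes q n \ C) : ℝ) ≤ s := by exact_mod_cast hs
    calc _ = (2 : ℝ) ^ (#C + ((n + n.gcd (q - 1)) / 2 - 1)) * (parityFactor n * q) *
          (#(oddPrimes q n \ C) + 1) * √((q : ℝ) ^ n) := by ring
      _ ≤ _ := by gcongr
  · gcongr

/-- The criterion with no sieving at all. -/
lemma sieveCriterion_of_all_core (hq : 1 ≤ q)
    (h : (2 ^ (#(oddPrimes q n) + ((n + n.gcd (q - 1)) / 2 - 1)) * (parityFactor n * q)) ^ 2 *
      q ^ n < (q ^ n - 1) ^ 2) : SieveCriterion q n := by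
  refine sieveCriterion_of_additive_core (s := 0) (σ := 0) subset_rfl hq (by simp) (by simp)
    zero_le_one ?_
  have h1 : ((q ^ n - 1 : ℕ) : ℝ) = (q : ℝ) ^ n - 1 := by
    rw [Nat.cast_sub (Nat.one_le_pow _ _ hq)]
    push_cast
    rfl
  rw [← h1]
  norm_num
  exact_mod_cast h

/-- A lower bound for the product of a set of numbers in terms of its size, where `F` contains
those less than `c`. -/
lemma pow_card_mul_prod_le {c : ℕ} {S F : Finset ℕ} (hF : ∀ ℓ ∈ F, ℓ ≤ c)
    (hS : ∀ ℓ ∈ S, ℓ < c → ℓ ∈ F) : c ^ #S * ∏ ℓ ∈ F, ℓ ≤ (∏ ℓ ∈ S, ℓ) * c ^ #F := by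
  have h1 : c ^ #(S \ F) ≤ ∏ ℓ ∈ S \ F, ℓ := by
    refine pow_card_le_prod _ _ _ fun ℓ hℓ => ?_
    by_contra! hlt
    exact (mem_sdiff.1 hℓ).2 (hS ℓ (mem_sdiff.1 hℓ).1 hlt)
  have h2 : ∏ ℓ ∈ F \ S, ℓ ≤ c ^ #(F \ S) :=
    prod_le_pow_card _ _ _ fun ℓ hℓ => hF ℓ (mem_sdiff.1 hℓ).1
  rw [← card_inter_add_card_sdiff S F, ← card_inter_add_card_sdiff F S,
    ← prod_inter_mul_prod_sdiff S F, ← prod_inter_mul_prod_sdiff F S, inter_comm F S]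
  calc _ = c ^ #(S ∩ F) * (∏ ℓ ∈ S ∩ F, ℓ) * (c ^ #(S \ F) * ∏ ℓ ∈ F \ S, ℓ) := by ring
    _ ≤ c ^ #(S ∩ F) * (∏ ℓ ∈ S ∩ F, ℓ) * ((∏ ℓ ∈ S \ F, ℓ) * c ^ #(F \ S)) := by gcongr
    _ = _ := by ring

/-- An upper bound for a sum of reciprocals, where `F` contains the numbers less than `c`. -/
lemma sum_inv_le {c : ℕ} (hc : 0 < c) {S F : Finset ℕ} (hF : ∀ ℓ ∈ F, 0 < ℓ ∧ ℓ ≤ c)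
    (hS : ∀ ℓ ∈ S, ℓ < c → ℓ ∈ F) (hcard : #S ≤ #F) :
    ∑ ℓ ∈ S, (ℓ : ℝ)⁻¹ ≤ ∑ ℓ ∈ F, (ℓ : ℝ)⁻¹ := by
  have hc' : (0 : ℝ) < c := by exact_mod_cast hc
  have h1 : ∑ ℓ ∈ S \ F, (ℓ : ℝ)⁻¹ ≤ #(S \ F) * (c : ℝ)⁻¹ := by
    rw [← nsmul_eq_mul]
    refine sum_le_card_nsmul _ _ _ fun ℓ hℓ => inv_anti₀ hc' ?_
    by_contra! hlt
    exact (mem_sdiff.1 hℓ).2 (hS ℓ (mem_sdiff.1 hℓ).1 (by exact_mod_cast hlt))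
  have h2 : #(F \ S) * (c : ℝ)⁻¹ ≤ ∑ ℓ ∈ F \ S, (ℓ : ℝ)⁻¹ := by
    rw [← nsmul_eq_mul]
    refine card_nsmul_le_sum _ _ _ fun ℓ hℓ => ?_
    obtain ⟨h0, hle⟩ := hF ℓ (mem_sdiff.1 hℓ).1
    exact inv_anti₀ (by exact_mod_cast h0) (by exact_mod_cast hle)
  have h3 : #(S \ F) ≤ #(F \ S) := by
    have e1 := card_inter_add_card_sdiff S F
    have e2 := card_inter_add_card_sdiff F S
    rw [inter_comm F S] at e2
    omega
  rw [← sum_inter_add_sum_sdiff S F, ← sum_inter_add_sum_sdiff F S, inter_comm F S]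
  exact add_le_add le_rfl ((h1.trans (by gcongr)).trans h2)

lemma prod_oddPrimes_dvd (q n : ℕ) : ∏ ℓ ∈ oddPrimes q n, ℓ ∣ ∑ i ∈ range n, q ^ i :=
  (prod_dvd_prod_of_subset _ _ _ (erase_subset _ _)).trans (Nat.prod_primeFactors_dvd _)

end CriterionBounds

section CriterionCheck

open Finset

/-- The odd primes less than `101`. -/
def smallPrimes : List ℕ :=
  [3, 5, 7, 11, 13, 17, 19, 23, 29, 31, 37, 41, 43, 47, 53, 59, 61, 67, 71, 73, 79, 83, 89, 97]

/-- Divide `m` by its greatest common divisor with `2 * smallPrimes.prod`, six times. -/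
def roughPart (m : ℕ) : ℕ := (fun m => m / m.gcd (2 * smallPrimes.prod))^[6] m

/-- The logarithm to base `101`, computed in at most `fuel` steps. -/
def logFuel : ℕ → ℕ → ℕ
  | 0, _ => 0
  | fuel + 1, m => bif Nat.blt m 101 then 0 else logFuel fuel (m / 101) + 1

/-- The sieve inequality for a core of size `c` and the sieving primes in `A` together with at most
`w` primes exceeding `100`; reciprocals are rounded up to multiples of `10 ^ (-6)`. -/
def sieveTest (q n w c : ℕ) (A : List ℕ) : Bool :=
  let r := n.gcd (q - 1)
  let κ := bif n % 2 == 0 then 4 else 1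
  let s := A.length + w
  let e := A.foldr (fun ℓ e => 10 ^ 6 / ℓ + 1 + e) (w * 10 ^ 6 / 101 + 1)
  let f := e + (((r - 1) * (2 * q) + (n - r)) * 10 ^ 6 / (2 * q ^ 2) + 1)
  (Nat.ble f (10 ^ 6) && Nat.blt ((2 ^ c * (κ * q) * (s + (n + r) / 2) * 10 ^ 6) ^ 2 * q ^ n)
    (((10 ^ 6 - f) * (q ^ n - 1)) ^ 2)) ||
  (Nat.ble e (10 ^ 6) &&
    Nat.blt ((2 ^ (c + ((n + r) / 2 - 1)) * (κ * q) * (s + 1) * 10 ^ 6) ^ 2 * q ^ n)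
      (((10 ^ 6 - e) * (q ^ n - 1)) ^ 2))

/-- Run `sieveTest`, moving the elements of `A` to the core one at a time. -/
def sieveSearch (q n w : ℕ) : ℕ → List ℕ → Bool
  | c, [] => sieveTest q n w c []
  | c, a :: A => sieveTest q n w c (a :: A) || sieveSearch q n w (c + 1) A

/-- A sufficient condition for `SieveCriterion q n` suitable for evaluation. -/
def sieveCheck (q n : ℕ) : Bool :=
  let m := (q ^ n - 1) / (q - 1)
  let w := logFuel 100 (roughPart m)
  Nat.blt (roughPart m) (101 ^ (w + 1)) &&
    sieveSearch q n w 0 (smallPrimes.filter fun ℓ => m % ℓ == 0)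

lemma mem_smallPrimes {ℓ : ℕ} (h : ℓ.Prime) (h2 : ℓ ≠ 2) (hlt : ℓ < 101) : ℓ ∈ smallPrimes := by
  have key : ∀ ℓ < 101, ℓ.Prime → ℓ ≠ 2 → ℓ ∈ smallPrimes := by decide +kernel
  exact key ℓ hlt h h2

lemma dvd_roughPart {ℓ m : ℕ} (h : ℓ.Prime) (hlt : 101 ≤ ℓ) (hd : ℓ ∣ m) : ℓ ∣ roughPart m := by
  have hP : ¬ ℓ ∣ 2 * smallPrimes.prod := by
    rw [h.dvd_mul, h.prime.dvd_prod_iff]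
    rintro (h' | ⟨a, ha, h'⟩)
    · exact absurd (Nat.le_of_dvd two_pos h') (by omega)
    · have key : ∀ a ∈ smallPrimes, 0 < a ∧ a < 101 := by decide
      exact absurd (Nat.le_of_dvd (key a ha).1 h') (by have := (key a ha).2; omega)
  have step : ∀ m, ℓ ∣ m → ℓ ∣ m / m.gcd (2 * smallPrimes.prod) := by
    intro m hm
    rw [← Nat.div_mul_cancel (Nat.gcd_dvd_left m (2 * smallPrimes.prod)), h.dvd_mul] at hm
    exact hm.resolve_right fun h' => hP (h'.trans (Nat.gcd_dvd_right _ _))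
  unfold roughPart
  generalize 6 = k
  induction k generalizing m with
  | zero => exact hd
  | succ k ih => exact ih (step m hd)

lemma roughPart_pos {m : ℕ} (hm : 0 < m) : 0 < roughPart m := by
  unfold roughPart
  generalize 6 = k
  induction k generalizing m with
  | zero => exact hm
  | succ k ih =>
    exact ih (Nat.div_pos (Nat.gcd_le_left _ hm) (Nat.gcd_pos_of_pos_left _ hm))

lemma card_filter_le_of_roughPart_lt {m w : ℕ} {S : Finset ℕ} (hm : 0 < m)
    (hS : ∀ ℓ ∈ S, ℓ.Prime ∧ ℓ ∣ m) (h : roughPart m < 101 ^ (w + 1)) :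
    #{ℓ ∈ S | 101 ≤ ℓ} ≤ w := by
  have h1 : ∏ ℓ ∈ S with 101 ≤ ℓ, ℓ ∣ roughPart m := by
    refine Finset.prod_primes_dvd _ (fun ℓ hℓ => (hS ℓ (mem_filter.1 hℓ).1).1.prime)
      fun ℓ hℓ => ?_
    obtain ⟨hℓ, hle⟩ := mem_filter.1 hℓ
    exact dvd_roughPart (hS ℓ hℓ).1 hle (hS ℓ hℓ).2
  have h2 : 101 ^ #{ℓ ∈ S | 101 ≤ ℓ} ≤ ∏ ℓ ∈ S with 101 ≤ ℓ, ℓ :=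
    pow_card_le_prod _ _ _ fun ℓ hℓ => (mem_filter.1 hℓ).2
  have h3 := (h2.trans (Nat.le_of_dvd (roughPart_pos hm) h1)).trans_lt h
  exact Nat.lt_succ_iff.1 ((Nat.pow_lt_pow_iff_right (by norm_num)).1 h3)

lemma cast_div_le_div_add_one (a b : ℕ) (hb : 0 < b) : (a : ℝ) / b ≤ (a / b : ℕ) + 1 := by
  rw [div_le_iff₀ (by exact_mod_cast hb)]
  have := Nat.lt_div_mul_add (a := a) hb
  have h2 : a ≤ (a / b + 1) * b := by linarith
  exact_mod_cast h2

lemma sum_inv_toFinset_le (A : List ℕ) (hA : ∀ ℓ ∈ A, 0 < ℓ) (b : ℕ) :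
    (10 ^ 6 * ∑ ℓ ∈ A.toFinset, (ℓ : ℝ)⁻¹) + b ≤
      (A.foldr (fun ℓ e => 10 ^ 6 / ℓ + 1 + e) b : ℕ) := by
  induction A with
  | nil => simp
  | cons a A ih =>
    have h1 := ih fun ℓ hℓ => hA ℓ (List.mem_cons_of_mem _ hℓ)
    have h2 := cast_div_le_div_add_one (10 ^ 6) a (hA a List.mem_cons_self)
    have h3 : ∑ ℓ ∈ (a :: A).toFinset, (ℓ : ℝ)⁻¹ ≤ (a : ℝ)⁻¹ + ∑ ℓ ∈ A.toFinset, (ℓ : ℝ)⁻¹ := by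
      rw [List.toFinset_cons]
      by_cases h : a ∈ A.toFinset
      · rw [insert_eq_of_mem h]
        exact le_add_of_nonneg_left (by positivity)
      · rw [sum_insert h]
    rw [List.foldr_cons]
    push_cast at h2 ⊢
    rw [div_eq_mul_inv] at h2
    linarith

lemma sieveCriterion_of_sieveTest {q n w : ℕ} {C B : Finset ℕ} {A : List ℕ} {c : ℕ} (hq : 1 ≤ q)
    (hn : 1 ≤ n)
    (hC : C ⊆ oddPrimes q n) (hc : #C ≤ c) (hA : ∀ ℓ ∈ A, 0 < ℓ) (hB : ∀ ℓ ∈ B, 101 ≤ ℓ)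
    (hw : #B ≤ w) (hsub : oddPrimes q n \ C ⊆ A.toFinset ∪ B) (h : sieveTest q n w c A = true) :
    SieveCriterion q n := by
  have hκ : (bif n % 2 == 0 then 4 else 1) = parityFactor n := by
    rcases Nat.even_or_odd n with h | h
    · simp [parityFactor, h, Nat.even_iff.1 h]
    · simp [parityFactor, Nat.not_even_iff_odd.2 h, Nat.odd_iff.1 h]
  have hr1 : 1 ≤ n.gcd (q - 1) := Nat.gcd_pos_of_pos_left _ hn
  have hrn : n.gcd (q - 1) ≤ n := Nat.gcd_le_left _ hn
  simp only [sieveTest, hκ, Bool.or_eq_true, Bool.and_eq_true, Nat.ble_eq, Nat.blt_eq] at h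
  set r := n.gcd (q - 1) with hr
  set e := A.foldr (fun ℓ e => 10 ^ 6 / ℓ + 1 + e) (w * 10 ^ 6 / 101 + 1) with he
  set g := ((r - 1) * (2 * q) + (n - r)) * 10 ^ 6 / (2 * q ^ 2) + 1 with hg
  have hs : #(oddPrimes q n \ C) ≤ A.length + w :=
    (card_le_card hsub).trans ((card_union_le _ _).trans
      (add_le_add (List.toFinset_card_le A) hw))
  have hσ : ∑ ℓ ∈ oddPrimes q n \ C, (ℓ : ℝ)⁻¹ ≤ (e : ℝ) / 10 ^ 6 := by
    have h1 : ∑ ℓ ∈ B, (ℓ : ℝ)⁻¹ ≤ w * (101 : ℝ)⁻¹ := by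
      refine (sum_le_card_nsmul _ _ (101 : ℝ)⁻¹ fun ℓ hℓ => ?_).trans ?_
      · exact inv_anti₀ (by norm_num) (by exact_mod_cast hB ℓ hℓ)
      · rw [nsmul_eq_mul]
        gcongr
    have h2 := sum_inv_toFinset_le A hA (w * 10 ^ 6 / 101 + 1)
    have h3 := cast_div_le_div_add_one (w * 10 ^ 6) 101 (by norm_num)
    have h4 : ∑ ℓ ∈ oddPrimes q n \ C, (ℓ : ℝ)⁻¹ ≤
        ∑ ℓ ∈ A.toFinset, (ℓ : ℝ)⁻¹ + ∑ ℓ ∈ B, (ℓ : ℝ)⁻¹ := by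
      refine (sum_le_sum_of_subset_of_nonneg hsub fun _ _ _ => by positivity).trans ?_
      rw [← sum_union_inter]
      exact le_add_of_nonneg_right (sum_nonneg fun _ _ => by positivity)
    rw [← he] at h2
    rw [le_div_iff₀ (by norm_num)]
    push_cast at h2 h3
    linarith
  have hc' : (2 : ℝ) ^ #C ≤ 2 ^ c := pow_le_pow_right₀ one_le_two hc
  have hQ : ((q ^ n - 1 : ℕ) : ℝ) = (q : ℝ) ^ n - 1 := by
    rw [Nat.cast_sub (Nat.one_le_pow _ _ hq)]
    push_cast
    rfl
  have hU : ((10 : ℝ) ^ 6) ^ 2 > 0 := by norm_num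
  rcases h with ⟨hf, h⟩ | ⟨hf, h⟩
  · have hτ : ((r : ℝ) - 1) / q + ((n : ℝ) - r) / (2 * (q : ℝ) ^ 2) ≤ (g : ℝ) / 10 ^ 6 := by
      have h1 := cast_div_le_div_add_one (((r - 1) * (2 * q) + (n - r)) * 10 ^ 6) (2 * q ^ 2)
        (by positivity)
      rw [le_div_iff₀ (by norm_num), hg]
      refine le_of_eq_of_le ?_ (h1.trans (by push_cast; rfl))
      push_cast [hr1, hrn]
      field_simp
      norm_num
    have hf' : (e : ℝ) + g ≤ 10 ^ 6 := by exact_mod_cast hf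
    refine sieveCriterion_of_additive_sieved hC hq hs hσ hτ ?_ ?_
    · rw [← add_div, div_le_one (by norm_num)]
      exact hf'
    · refine lt_of_mul_lt_mul_right ?_ hU.le
      have h' : (((2 : ℝ) ^ c * (parityFactor n * q) * ((A.length + w : ℕ) + ((n + r) / 2 : ℕ)) *
          10 ^ 6) ^ 2 * q ^ n) < ((10 ^ 6 - (e + g)) * (q ^ n - 1)) ^ 2 := by
        rw [← hQ]
        have : ((10 ^ 6 - (e + g) : ℕ) : ℝ) = 10 ^ 6 - (e + g) := by
          rw [Nat.cast_sub hf]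
          norm_num
        rw [← this]
        exact_mod_cast h
      calc _ = ((2 : ℝ) ^ #C * (parityFactor n * q) * ((A.length + w : ℕ) + ((n + r) / 2 : ℕ)) *
            10 ^ 6) ^ 2 * q ^ n := by ring
        _ ≤ _ := by gcongr
        _ < _ := h'
        _ = _ := by field_simp; ring
  · have hf' : (e : ℝ) ≤ 10 ^ 6 := by exact_mod_cast hf
    refine sieveCriterion_of_additive_core hC hq hs hσ ?_ ?_
    · rw [div_le_one (by norm_num)]
      exact hf'
    · refine lt_of_mul_lt_mul_right ?_ hU.le
      have h' : (((2 : ℝ) ^ (c + ((n + r) / 2 - 1)) * (parityFactor n * q) *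
          ((A.length + w : ℕ) + 1) * 10 ^ 6) ^ 2 * q ^ n) < ((10 ^ 6 - e) * (q ^ n - 1)) ^ 2 := by
        rw [← hQ]
        have : ((10 ^ 6 - e : ℕ) : ℝ) = 10 ^ 6 - e := by
          rw [Nat.cast_sub hf]
          norm_num
        rw [← this]
        exact_mod_cast h
      calc _ = ((2 : ℝ) ^ (#C + ((n + r) / 2 - 1)) * (parityFactor n * q) *
            ((A.length + w : ℕ) + 1) * 10 ^ 6) ^ 2 * q ^ n := by ring
        _ ≤ _ := by gcongr; norm_num
        _ < _ := h'
        _ = _ := by field_simp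

lemma sieveCriterion_of_sieveSearch {q n w : ℕ} {B : Finset ℕ} (hq : 1 ≤ q) (hn : 1 ≤ n)
    (hB : ∀ ℓ ∈ B, 101 ≤ ℓ) (hw : #B ≤ w) {A : List ℕ} (hA : ∀ ℓ ∈ A, ℓ ∈ oddPrimes q n)
    {c : ℕ} {C : Finset ℕ} (hC : C ⊆ oddPrimes q n) (hc : #C ≤ c)
    (hsub : oddPrimes q n \ C ⊆ A.toFinset ∪ B) (h : sieveSearch q n w c A = true) :
    SieveCriterion q n := by
  have hpos : ∀ ℓ ∈ A, 0 < ℓ := fun ℓ hℓ => (mem_oddPrimes.1 (hA ℓ hℓ)).2.1.pos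
  induction A generalizing c C with
  | nil => exact sieveCriterion_of_sieveTest hq hn hC hc hpos hB hw hsub h
  | cons a A ih =>
    rw [sieveSearch, Bool.or_eq_true] at h
    rcases h with h | h
    · exact sieveCriterion_of_sieveTest hq hn hC hc hpos hB hw hsub h
    · refine ih (fun ℓ hℓ => hA ℓ (List.mem_cons_of_mem _ hℓ))
        (insert_subset (hA a List.mem_cons_self) hC)
        ((card_insert_le _ _).trans (Nat.succ_le_succ hc)) ?_ h
        fun ℓ hℓ => hpos ℓ (List.mem_cons_of_mem _ hℓ)
      intro ℓ hℓ
      rw [mem_sdiff, mem_insert, not_or] at hℓ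
      have := hsub (mem_sdiff.2 ⟨hℓ.1, hℓ.2.2⟩)
      simp only [List.toFinset_cons, mem_union, mem_insert] at this ⊢
      tauto

theorem sieveCriterion_of_sieveCheck {q n : ℕ} (hq : 2 ≤ q) (hn : 1 ≤ n)
    (h : sieveCheck q n = true) : SieveCriterion q n := by
  have hm : (q ^ n - 1) / (q - 1) = ∑ i ∈ range n, q ^ i := by
    rw [← geom_sum_mul_sub_one q n (by omega), Nat.mul_div_cancel _ (by omega)]
  have hm0 : 0 < ∑ i ∈ range n, q ^ i := sum_pos (fun _ _ => by positivity) ⟨0, mem_range.2 hn⟩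
  simp only [sieveCheck, hm, Bool.and_eq_true, Nat.blt_eq] at h
  refine sieveCriterion_of_sieveSearch (B := {ℓ ∈ oddPrimes q n | 101 ≤ ℓ}) (C := ∅) (by omega) hn
    (fun ℓ hℓ => (mem_filter.1 hℓ).2) (card_filter_le_of_roughPart_lt hm0 (fun ℓ hℓ =>
      ⟨(mem_oddPrimes.1 hℓ).2.1, (mem_oddPrimes.1 hℓ).2.2.1⟩) h.1) ?_ (empty_subset _) le_rfl ?_ h.2
  · intro ℓ hℓ
    have key : ∀ ℓ ∈ smallPrimes, ℓ.Prime ∧ ℓ ≠ 2 := by decide +kernel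
    rw [List.mem_filter, beq_iff_eq] at hℓ
    exact mem_oddPrimes.2 ⟨(key ℓ hℓ.1).2, (key ℓ hℓ.1).1, Nat.dvd_of_mod_eq_zero hℓ.2, hm0.ne'⟩
  · intro ℓ hℓ
    rw [sdiff_empty] at hℓ
    rw [mem_union, List.mem_toFinset, List.mem_filter, mem_filter, beq_iff_eq]
    obtain ⟨h2, hp, hd, -⟩ := mem_oddPrimes.1 hℓ
    rcases lt_or_ge ℓ 101 with hlt | hle
    · exact .inl ⟨mem_smallPrimes hp h2 hlt, Nat.mod_eq_zero_of_dvd hd⟩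
    · exact .inr ⟨hℓ, hle⟩

end CriterionCheck

section Ranges

/-- A condition satisfied by all powers `q` of primes exceeding `3` with `q < 5 ^ 20`. -/
def looksLikePrimePower (q : ℕ) : Bool :=
  q % 2 != 0 && q % 3 != 0 && smallPrimes.all fun ℓ => q % ℓ != 0 || ℓ ^ 20 % q == 0

/-- Evaluate `sieveCheck q n` for all possible prime powers `q` with `5 ≤ q < k + 5` except those
in `exc`. -/
def sieveCheckBelow (n : ℕ) (exc : List ℕ) : ℕ → Bool
  | 0 => true
  | k + 1 => sieveCheckBelow n exc k && (!looksLikePrimePower (k + 5) || (k + 5).gcd n != 1 ||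
      exc.contains (k + 5) || sieveCheck (k + 5) n)

lemma looksLikePrimePower_pow {p t : ℕ} (hp : p.Prime) (hp5 : 5 ≤ p) (h : p ^ t < 5 ^ 20) :
    looksLikePrimePower (p ^ t) = true := by
  have ht : t ≤ 20 := by
    have h1 : 5 ^ t < 5 ^ 20 := (Nat.pow_le_pow_left hp5 t).trans_lt h
    exact ((Nat.pow_lt_pow_iff_right (by norm_num)).1 h1).le
  have key : ∀ ℓ, ℓ.Prime → ℓ ∣ p ^ t → ℓ = p := fun ℓ hℓ hd =>
    (Nat.prime_dvd_prime_iff_eq hℓ hp).1 (hℓ.dvd_of_dvd_pow hd)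
  simp only [looksLikePrimePower, Bool.and_eq_true, bne_iff_ne, ne_eq, List.all_eq_true,
    Bool.or_eq_true, beq_iff_eq]
  refine ⟨⟨fun h2 => ?_, fun h3 => ?_⟩, fun ℓ hℓ => ?_⟩
  · have := key 2 Nat.prime_two (Nat.dvd_of_mod_eq_zero h2)
    omega
  · have := key 3 Nat.prime_three (Nat.dvd_of_mod_eq_zero h3)
    omega
  · rw [or_iff_not_imp_left, not_not]
    intro h
    have hprime : ∀ ℓ ∈ smallPrimes, ℓ.Prime := by decide +kernel
    rw [key ℓ (hprime ℓ hℓ) (Nat.dvd_of_mod_eq_zero h)]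
    exact Nat.mod_eq_zero_of_dvd (pow_dvd_pow p ht)

lemma sieveCheck_of_sieveCheckBelow {n k : ℕ} {exc : List ℕ} (h : sieveCheckBelow n exc k = true)
    {q : ℕ} (h5 : 5 ≤ q) (hk : q < k + 5) (hq : looksLikePrimePower q = true)
    (hn : q.gcd n = 1) (he : q ∉ exc) : sieveCheck q n = true := by
  induction k with
  | zero => omega
  | succ k ih =>
    rw [sieveCheckBelow, Bool.and_eq_true] at h
    rcases Nat.lt_succ_iff_lt_or_eq.1 (show q < (k + 5).succ by omega) with hlt | rfl
    · exact ih h.1 hlt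
    · simpa [hq, hn, he] using h.2

lemma sieveCriterion_of_sieveCheckBelow {p t q n k : ℕ} {exc : List ℕ} (hp : p.Prime)
    (hp5 : 5 ≤ p) (ht : 1 ≤ t) (hq : q = p ^ t) (hn : 1 ≤ n) (hgcd : n.gcd p = 1)
    (h : sieveCheckBelow n exc k = true) (hk : q < k + 5) (hk' : k + 5 ≤ 5 ^ 20) (he : q ∉ exc) :
    SieveCriterion q n := by
  have h5 : 5 ≤ q := hq ▸ hp5.trans (Nat.le_self_pow (by omega) p)
  refine sieveCriterion_of_sieveCheck (by omega) hn
    (sieveCheck_of_sieveCheckBelow h h5 hk ?_ ?_ he)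
  · exact hq ▸ looksLikePrimePower_pow hp hp5 (hq ▸ hk.trans_le hk')
  · rw [Nat.gcd_comm, hq]
    exact Nat.Coprime.pow_right t hgcd

/-- The prime powers `q` for which the pair `(q, n)` is treated by exhibiting an element. -/
def exceptional : ℕ → List ℕ
  | 3 => [5, 7, 11, 13, 19, 25, 31, 37, 43, 49, 61, 67, 79, 109, 121, 163]
  | 4 => [5, 7, 11, 13, 17, 19, 23, 25, 29, 37, 41, 47, 53, 83]
  | 6 => [5, 7]
  | 8 => [5]
  | _ => []

/-- The range of `q` in which the sieve is evaluated, shifted by `5`. -/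
def checkRange : ℕ → ℕ
  | 3 => 4400
  | 4 => 1500
  | 5 | 6 => 1200
  | 7 | 8 => 170
  | 9 | 10 | 11 | 12 => 75
  | _ => 35

set_option maxRecDepth 100000 in
lemma sieveCheckBelow_checkRange :
    ∀ n < 60, 3 ≤ n → sieveCheckBelow n (exceptional n) (checkRange n) = true := by
  decide +kernel

end Ranges

section LargeParameters

open Finset

variable {q n : ℕ}

lemma parityFactor_le (n : ℕ) : parityFactor n ≤ 4 := by
  unfold parityFactor
  split <;> norm_num

lemma additive_loss_le (hq : 1 ≤ q) (hn : 1 ≤ n) :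
    ((n.gcd (q - 1) : ℝ) - 1) / q + ((n : ℝ) - n.gcd (q - 1)) / (2 * (q : ℝ) ^ 2) ≤
      ((n : ℝ) - 1) / q := by
  have hrn : (n.gcd (q - 1) : ℝ) ≤ n := by exact_mod_cast Nat.gcd_le_left _ hn
  have hq' : (1 : ℝ) ≤ q := by exact_mod_cast hq
  have h : ((n : ℝ) - n.gcd (q - 1)) / (2 * (q : ℝ) ^ 2) ≤ ((n : ℝ) - n.gcd (q - 1)) / q := by
    gcongr
    nlinarith
  refine (add_le_add_right h _).trans_eq ?_
  rw [← add_div]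
  ring

lemma prod_oddPrimes_le (q : ℕ) (hn : 1 ≤ n) :
    ∏ ℓ ∈ oddPrimes q n, ℓ ≤ ∑ i ∈ range n, q ^ i := by
  refine Nat.le_of_dvd ?_ (prod_oddPrimes_dvd q n)
  exact lt_of_lt_of_le (by simp) (single_le_sum (f := fun i => q ^ i) (by simp) (mem_range.2 hn))

/-- The criterion for large `q`, relative to the size of the core consisting of the small primes. -/
lemma sieveCriterion_of_card_le {F G : Finset ℕ} {c k E : ℕ} {σ : ℝ} (hn : 1 ≤ n) (hq : 1 ≤ q)
    (hc : 0 < c) (hF : ∀ ℓ ∈ F, 0 < ℓ ∧ ℓ ≤ c)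
    (hFG : ∀ ℓ ∈ oddPrimes q n, ℓ < c → ℓ ∈ F ∪ G) (hk : #(oddPrimes q n) ≤ k) (hkF : k ≤ #F)
    (hE : ∀ e ≤ #G, 2 ^ e * (k - e + n) ≤ E) (hσ : ∑ ℓ ∈ F, (ℓ : ℝ)⁻¹ + (n - 1) / q ≤ σ)
    (hσ1 : σ ≤ 1) (h : ((E : ℝ) * (parityFactor n * q)) ^ 2 * (q : ℝ) ^ n <
      ((1 - σ) * ((q : ℝ) ^ n - 1)) ^ 2) : SieveCriterion q n := by
  set S := oddPrimes q n with hS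
  have hcard : #(S \ G) + #(S ∩ G) = #S := by
    rw [add_comm, card_inter_add_card_sdiff]
  have hsd : S \ (S ∩ G) = S \ G := sdiff_inter_self_left S G
  refine sieveCriterion_of_additive_sieved (C := S ∩ G) (s := k - #(S ∩ G))
    (σ := ∑ ℓ ∈ F, (ℓ : ℝ)⁻¹) (τ := σ - ∑ ℓ ∈ F, (ℓ : ℝ)⁻¹) inter_subset_left hq ?_ ?_
    ((additive_loss_le hq hn).trans (by linarith)) (by linarith) ?_
  · rw [hsd]
    omega
  · rw [hsd]
    refine sum_inv_le hc hF (fun ℓ hℓ hlt => ?_) (by omega)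
    rw [mem_sdiff] at hℓ
    exact (mem_union.1 (hFG ℓ hℓ.1 hlt)).resolve_right hℓ.2
  · have hr : (n + n.gcd (q - 1)) / 2 ≤ n := by
      have := Nat.gcd_le_left (q - 1) hn
      omega
    have hE' := hE #(S ∩ G) (card_le_card inter_subset_right)
    have h2 : (2 : ℝ) ^ #(S ∩ G) * ((k - #(S ∩ G) : ℕ) + ((n + n.gcd (q - 1)) / 2 : ℕ)) ≤ E := by
      refine le_trans ?_ (by exact_mod_cast hE' : (2 : ℝ) ^ #(S ∩ G) *
        ((k - #(S ∩ G) : ℕ) + (n : ℕ)) ≤ E)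
      gcongr
    calc _ = ((2 : ℝ) ^ #(S ∩ G) * ((k - #(S ∩ G) : ℕ) + ((n + n.gcd (q - 1)) / 2 : ℕ)) *
          (parityFactor n * q)) ^ 2 * (q : ℝ) ^ n := by ring
      _ ≤ ((E : ℝ) * (parityFactor n * q)) ^ 2 * (q : ℝ) ^ n := by gcongr
      _ < _ := h
      _ = _ := by ring

lemma mem_of_mem_oddPrimes_three {ℓ : ℕ} (h : ℓ ∈ oddPrimes q 3) (hlt : ℓ < 103) :
    ℓ ∈ ({3, 7, 13, 19, 31, 37, 43, 61, 67, 73, 79, 97} : Finset ℕ) := by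
  have key : ∀ ℓ < 103, ℓ.Prime → (∃ x < ℓ, (1 + x + x ^ 2) % ℓ = 0) →
      ℓ ∈ ({3, 7, 13, 19, 31, 37, 43, 61, 67, 73, 79, 97} : Finset ℕ) := by decide +kernel
  obtain ⟨-, hp, hd, -⟩ := mem_oddPrimes.1 h
  refine key ℓ hlt hp ⟨q % ℓ, Nat.mod_lt _ hp.pos, ?_⟩
  rw [sum_range_succ, sum_range_succ, sum_range_one, pow_zero, pow_one] at hd
  refine Eq.trans ?_ (Nat.mod_eq_zero_of_dvd hd)
  exact Nat.ModEq.add (Nat.ModEq.add_left _ (Nat.mod_modEq q ℓ)) ((Nat.mod_modEq q ℓ).pow 2)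

lemma sieveCriterion_three (hq : 4400 ≤ q) : SieveCriterion q 3 := by
  have hqR : (4400 : ℝ) ≤ q := by exact_mod_cast hq
  rcases le_or_gt #(oddPrimes q 3) 10 with hk | hk
  · refine sieveCriterion_of_card_le (F := {13, 19, 31, 37, 43, 61, 67, 73, 79, 97}) (G := {3, 7})
      (c := 103) (E := 44) (σ := 282 / 1000) (by norm_num) (by omega) (by norm_num) (by decide)
      (fun ℓ hℓ hlt => ?_) hk (by decide) (by decide) ?_ (by norm_num) ?_
    · have := mem_of_mem_oddPrimes_three hℓ hlt
      simp only [mem_union, mem_insert, mem_singleton] at this ⊢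
      tauto
    · have : ((3 : ℕ) - 1 : ℝ) / q ≤ 2 / 4400 := by
        norm_num
        rw [div_le_iff₀ (by linarith)]
        linarith
      refine (add_le_add_right this _).trans ?_
      norm_num
    · have hp : parityFactor 3 = 1 := by decide
      rw [hp]
      push_cast
      have h3 : (1 : ℝ) ≤ (q : ℝ) ^ 3 := one_le_pow₀ (by linarith)
      have h5 : (q : ℝ) ^ 3 ≤ (q : ℝ) ^ 5 := pow_le_pow_right₀ (by linarith) (by norm_num)
      have h6 : (4400 : ℝ) * (q : ℝ) ^ 5 ≤ (q : ℝ) ^ 6 := by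
        rw [pow_succ' _ 5]
        gcongr
      nlinarith
  · obtain ⟨j, hj⟩ : ∃ j, #(oddPrimes q 3) = 11 + j := Nat.exists_eq_add_of_le hk
    have h1 := pow_card_mul_prod_le (c := 103)
      (F := {3, 7, 13, 19, 31, 37, 43, 61, 67, 73, 79, 97}) (by decide)
      fun ℓ hℓ hlt => mem_of_mem_oddPrimes_three (q := q) hℓ hlt
    have h2 := prod_oddPrimes_le (n := 3) q (by norm_num)
    rw [hj, pow_add] at h1
    rw [sum_range_succ, sum_range_succ, sum_range_one, pow_zero, pow_one] at h2
    have hP : ∏ ℓ ∈ ({3, 7, 13, 19, 31, 37, 43, 61, 67, 73, 79, 97} : Finset ℕ), ℓ ≥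
      103 * 16 ^ 11 * 320 := by decide +kernel
    have hcard : #({3, 7, 13, 19, 31, 37, 43, 61, 67, 73, 79, 97} : Finset ℕ) = 12 := by decide
    rw [hcard] at h1
    have h16 : 16 ^ j ≤ 103 ^ j := Nat.pow_le_pow_left (by norm_num) j
    have h3 : 320 * (16 ^ 11 * 16 ^ j) ≤ 1 + q + q ^ 2 := by
      have : 103 ^ 11 * 16 ^ j * (103 * 16 ^ 11 * 320) ≤ (1 + q + q ^ 2) * 103 ^ 12 :=
        (Nat.mul_le_mul (Nat.mul_le_mul_left _ h16) hP).trans (h1.trans (Nat.mul_le_mul_right _ h2))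
      norm_num at this ⊢
      omega
    have h4 : 17 * 4 ^ (11 + j) ≤ q := by
      have e : 16 ^ 11 * 16 ^ j = (4 ^ (11 + j)) ^ 2 := by
        rw [← pow_add, ← pow_mul, mul_comm _ 2, pow_mul]
        norm_num
      rw [e] at h3
      by_contra! h
      have h' := Nat.pow_le_pow_left (Nat.succ_le_of_lt h) 2
      rw [mul_pow] at h'
      nlinarith
    refine sieveCriterion_of_all_core (by omega) ?_
    have hp : parityFactor 3 = 1 := by decide
    rw [hp, hj, one_mul]
    have hA : (3 + Nat.gcd 3 (q - 1)) / 2 - 1 ≤ 2 := by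
      have := Nat.gcd_le_left (q - 1) (show 0 < 3 by norm_num)
      omega
    have h5 : (2 ^ (11 + j + ((3 + Nat.gcd 3 (q - 1)) / 2 - 1)) * q) ^ 2 * q ^ 3 ≤
        16 * 4 ^ (11 + j) * q ^ 5 := by
      calc _ ≤ (2 ^ (11 + j + 2) * q) ^ 2 * q ^ 3 := by gcongr; norm_num
        _ = 16 * 4 ^ (11 + j) * q ^ 5 := by
          rw [show 4 = 2 ^ 2 by norm_num, ← pow_mul]
          ring
    refine h5.trans_lt ?_
    have h6 : 1 ≤ q ^ 3 := Nat.one_le_pow _ _ (by omega)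
    have h7 : 17 * 4 ^ (11 + j) * q ^ 5 ≤ q ^ 6 := by
      rw [pow_succ' _ 5]
      gcongr
    have h8 : 2 * q ^ 3 ≤ q ^ 5 := by
      rw [show 5 = 2 + 3 by norm_num, pow_add]
      gcongr
      nlinarith
    zify [h6] at h5 h7 h8 ⊢
    have h9 : (1 : ℤ) ≤ 4 ^ (11 + j) := one_le_pow₀ (by norm_num)
    have h10 : (q : ℤ) ^ 5 * 1 ≤ (q : ℤ) ^ 5 * 4 ^ (11 + j) := by gcongr
    nlinarith

lemma mem_of_mem_oddPrimes {ℓ : ℕ} (h : ℓ ∈ oddPrimes q n) (hlt : ℓ < 64) :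
    ℓ ∈ ({3, 5, 7, 11, 13, 17, 19, 23, 29, 31, 37, 41, 43, 47, 53, 59, 61} : Finset ℕ) := by
  have key : ∀ ℓ < 64, ℓ.Prime → ℓ ≠ 2 →
      ℓ ∈ ({3, 5, 7, 11, 13, 17, 19, 23, 29, 31, 37, 41, 43, 47, 53, 59, 61} : Finset ℕ) := by
    decide +kernel
  obtain ⟨h2, hp, -⟩ := mem_oddPrimes.1 h
  exact key ℓ hlt hp h2

lemma sieveCriterion_four (hq : 1500 ≤ q) : SieveCriterion q 4 := by
  have hqR : (1500 : ℝ) ≤ q := by exact_mod_cast hq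
  have hp : parityFactor 4 = 4 := by decide
  rcases le_or_gt #(oddPrimes q 4) 13 with hk | hk
  · refine sieveCriterion_of_card_le (F := {11, 13, 17, 19, 23, 29, 31, 37, 41, 43, 47, 53, 59})
      (G := {3, 5, 7}) (c := 61) (E := 112) (σ := 53 / 100) (by norm_num) (by omega) (by norm_num)
      (by decide) (fun ℓ hℓ hlt => ?_) hk (by decide) (by decide) ?_ (by norm_num) ?_
    · have := mem_of_mem_oddPrimes hℓ (by omega)
      simp only [mem_union, mem_insert, mem_singleton] at this ⊢
      omega
    · have : ((4 : ℕ) - 1 : ℝ) / q ≤ 3 / 1500 := by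
        norm_num
        rw [div_le_iff₀ (by linarith)]
        linarith
      refine (add_le_add_right this _).trans ?_
      norm_num
    · rw [hp]
      push_cast
      have h4 : (1 : ℝ) ≤ (q : ℝ) ^ 4 := one_le_pow₀ (by linarith)
      have h6 : (q : ℝ) ^ 4 ≤ (q : ℝ) ^ 6 := pow_le_pow_right₀ (by linarith) (by norm_num)
      have h8 : (1500 : ℝ) ^ 2 * (q : ℝ) ^ 6 ≤ (q : ℝ) ^ 8 := by
        rw [show 8 = 2 + 6 by norm_num, pow_add]
        gcongr
      nlinarith
  · obtain ⟨j, hj⟩ : ∃ j, #(oddPrimes q 4) = 14 + j := Nat.exists_eq_add_of_le hk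
    have h1 := pow_card_mul_prod_le (c := 59)
      (F := {3, 5, 7, 11, 13, 17, 19, 23, 29, 31, 37, 41, 43, 47, 53}) (S := oddPrimes q 4)
      (by decide) fun ℓ hℓ hlt => by
        have := mem_of_mem_oddPrimes hℓ (by omega)
        simp only [mem_insert, mem_singleton] at this ⊢
        omega
    have h2 := prod_oddPrimes_le (n := 4) q (by norm_num)
    rw [hj, pow_add] at h1
    rw [sum_range_succ, sum_range_succ, sum_range_succ, sum_range_one, pow_zero, pow_one] at h2
    have hP : ∏ ℓ ∈ ({3, 5, 7, 11, 13, 17, 19, 23, 29, 31, 37, 41, 43, 47, 53} : Finset ℕ), ℓ ≥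
      59 * 8 ^ 14 * 60000 := by decide +kernel
    have hcard : #({3, 5, 7, 11, 13, 17, 19, 23, 29, 31, 37, 41, 43, 47, 53} : Finset ℕ) = 15 := by
      decide
    rw [hcard] at h1
    have h8 : 8 ^ j ≤ 59 ^ j := Nat.pow_le_pow_left (by norm_num) j
    have h3 : 60000 * (8 ^ 14 * 8 ^ j) ≤ 1 + q + q ^ 2 + q ^ 3 := by
      have : 59 ^ 14 * 8 ^ j * (59 * 8 ^ 14 * 60000) ≤ (1 + q + q ^ 2 + q ^ 3) * 59 ^ 15 :=
        (Nat.mul_le_mul (Nat.mul_le_mul_left _ h8) hP).trans (h1.trans (Nat.mul_le_mul_right _ h2))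
      norm_num at this ⊢
      omega
    have h4 : (33 * 2 ^ (14 + j)) ^ 3 ≤ q ^ 3 := by
      have e : (33 * 2 ^ (14 + j)) ^ 3 = 33 ^ 3 * (8 ^ 14 * 8 ^ j) := by
        rw [mul_pow, ← pow_add, ← pow_mul, mul_comm (14 + j), pow_mul]
        norm_num
      rw [e]
      have : 1 + q + q ^ 2 ≤ q ^ 3 / 2 := by
        rw [Nat.le_div_iff_mul_le two_pos]
        nlinarith
      omega
    have h4' : 33 * 2 ^ (14 + j) ≤ q := le_of_pow_le_pow_left₀ (by norm_num) (by omega) h4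
    refine sieveCriterion_of_all_core (by omega) ?_
    rw [hp, hj]
    have hA : (4 + Nat.gcd 4 (q - 1)) / 2 - 1 ≤ 3 := by
      have := Nat.gcd_le_left (q - 1) (show 0 < 4 by norm_num)
      omega
    have h5 : (2 ^ (14 + j + ((4 + Nat.gcd 4 (q - 1)) / 2 - 1)) * (4 * q)) ^ 2 * q ^ 4 ≤
        (32 * 2 ^ (14 + j)) ^ 2 * q ^ 6 := by
      calc _ ≤ (2 ^ (14 + j + 3) * (4 * q)) ^ 2 * q ^ 4 := by gcongr; norm_num
        _ = _ := by ring
    refine h5.trans_lt ?_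
    have h6 : 1 ≤ q ^ 4 := Nat.one_le_pow _ _ (by omega)
    have h7 : (33 * 2 ^ (14 + j)) ^ 2 * q ^ 6 ≤ q ^ 8 := by
      rw [show 8 = 2 + 6 by norm_num, pow_add _ 2 6]
      gcongr
    have h9 : q ^ 4 ≤ q ^ 6 := Nat.pow_le_pow_right (by omega) (by norm_num)
    have h10 : 1 ^ 2 * q ^ 6 ≤ (2 ^ (14 + j)) ^ 2 * q ^ 6 := by
      gcongr
      exact Nat.one_le_two_pow
    zify [h6] at h7 h9 h10 ⊢
    nlinarith

lemma sieveCriterion_of_le_pow (hq : 5 ≤ q) (hn : 5 ≤ n)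
    (h : 2 ^ 27 * 64 ^ ((n + n.gcd (q - 1)) / 2 - 1) * parityFactor n ^ 6 * q ^ 5 ≤
      q ^ (2 * n)) : SieveCriterion q n := by
  set a := (n + n.gcd (q - 1)) / 2 - 1
  set k := #(oddPrimes q n) with hk
  have hP : 3 * 64 ^ 17 ≤ 2 * 2 ^ 27 * ∏ ℓ ∈
      ({3, 5, 7, 11, 13, 17, 19, 23, 29, 31, 37, 41, 43, 47, 53, 59, 61} : Finset ℕ), ℓ := by
    decide +kernel
  have hm : 3 * 64 ^ k ≤ 2 * 2 ^ 27 * ∑ i ∈ range n, q ^ i := by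
    have h1 := pow_card_mul_prod_le (c := 64) (S := oddPrimes q n) (by decide)
      fun ℓ hℓ hlt => mem_of_mem_oddPrimes hℓ hlt
    have h2 := h1.trans (Nat.mul_le_mul_right _ (prod_oddPrimes_le q (by omega)))
    rw [← hk, show #({3, 5, 7, 11, 13, 17, 19, 23, 29, 31, 37, 41, 43, 47, 53, 59, 61} :
      Finset ℕ) = 17 by decide] at h2
    refine Nat.le_of_mul_le_mul_right (?_ : _ * 64 ^ 17 ≤ _) (by positivity)
    calc 3 * 64 ^ k * 64 ^ 17 = 64 ^ k * (3 * 64 ^ 17) := by ring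
      _ ≤ 64 ^ k * (2 * 2 ^ 27 * ∏ ℓ ∈
        ({3, 5, 7, 11, 13, 17, 19, 23, 29, 31, 37, 41, 43, 47, 53, 59, 61} : Finset ℕ), ℓ) :=
        Nat.mul_le_mul_left _ hP
      _ = 2 * 2 ^ 27 * (64 ^ k * ∏ ℓ ∈
        ({3, 5, 7, 11, 13, 17, 19, 23, 29, 31, 37, 41, 43, 47, 53, 59, 61} : Finset ℕ), ℓ) := by
        ring
      _ ≤ 2 * 2 ^ 27 * ((∑ i ∈ range n, q ^ i) * 64 ^ 17) := Nat.mul_le_mul_left _ h2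
      _ = _ := by ring
  refine sieveCriterion_of_all_core (by omega) ?_
  rw [← hk]
  have hQ : 3125 ≤ q ^ n :=
    calc 3125 = 5 ^ 5 := by norm_num
      _ ≤ q ^ 5 := Nat.pow_le_pow_left hq 5
      _ ≤ q ^ n := Nat.pow_le_pow_right (by omega) hn
  have hmul := geom_sum_mul_sub_one q n (by omega)
  obtain ⟨R, hR⟩ : ∃ R, q ^ n = R + 1 := ⟨q ^ n - 1, by omega⟩
  obtain ⟨x, hx⟩ : ∃ x, q = x + 1 := ⟨q - 1, by omega⟩
  have hxq : q - 1 = x := by omega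
  rw [hR, Nat.add_sub_cancel, hxq] at hmul
  rw [mul_comm 2 n, pow_mul, hR] at h
  simp only [hR, Nat.add_sub_cancel]
  refine lt_of_pow_lt_pow_left₀ 3 (by positivity) ?_
  refine Nat.lt_of_mul_lt_mul_left (a := 3 * x) ?_
  have hR1 : (R + 1) ^ 5 * 100 ≤ 101 * R ^ 5 := by
    have h1 : (R + 1) * 3124 ≤ R * 3125 := by linarith
    have h2 := Nat.pow_le_pow_left h1 5
    rw [mul_pow, mul_pow] at h2
    norm_num at h2
    omega
  calc 3 * x * (((2 ^ (k + a) * (parityFactor n * q)) ^ 2 * (R + 1)) ^ 3)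
      = (3 * 64 ^ k) * x * (64 ^ a * parityFactor n ^ 6 * q ^ 6 * (R + 1) ^ 3) := by
        rw [show 64 = 2 ^ 6 by norm_num, ← pow_mul, ← pow_mul]
        ring
    _ ≤ (2 * 2 ^ 27 * ∑ i ∈ range n, q ^ i) * x *
        (64 ^ a * parityFactor n ^ 6 * q ^ 6 * (R + 1) ^ 3) := by gcongr
    _ = 2 * R * q * (R + 1) ^ 3 * (2 ^ 27 * 64 ^ a * parityFactor n ^ 6 * q ^ 5) := by
        rw [← hmul]
        ring
    _ ≤ 2 * R * q * (R + 1) ^ 3 * (R + 1) ^ 2 := Nat.mul_le_mul_left _ h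
    _ = 2 * R * q * (R + 1) ^ 5 := by ring
    _ < 3 * x * (R ^ 2) ^ 3 := by
        have hR0 : 0 < R := by omega
        have h5 : 0 < R ^ 5 := by positivity
        have : 2 * q * (R + 1) ^ 5 < 3 * x * R ^ 5 := by
          refine Nat.lt_of_mul_lt_mul_left (a := 100) ?_
          calc 100 * (2 * q * (R + 1) ^ 5) = 2 * q * ((R + 1) ^ 5 * 100) := by ring
            _ ≤ 2 * q * (101 * R ^ 5) := Nat.mul_le_mul_left _ hR1
            _ = 202 * q * R ^ 5 := by ring
            _ < 300 * x * R ^ 5 := Nat.mul_lt_mul_of_pos_right (by omega) h5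
            _ = _ := by ring
        calc 2 * R * q * (R + 1) ^ 5 = R * (2 * q * (R + 1) ^ 5) := by ring
          _ < R * (3 * x * R ^ 5) := Nat.mul_lt_mul_of_pos_left this hR0
          _ = _ := by ring

lemma sieveCriterion_of_five_le (hn : 5 ≤ n) (hn60 : n < 60) (hq : checkRange n + 5 ≤ q) :
    SieveCriterion q n := by
  have key : ∀ n < 60, 5 ≤ n → 2 ^ 27 * 64 ^ (n - 1) * parityFactor n ^ 6 ≤
      (checkRange n + 5) ^ (2 * n - 5) := by decide +kernel
  refine sieveCriterion_of_le_pow (by omega) hn ?_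
  have hA : (n + n.gcd (q - 1)) / 2 - 1 ≤ n - 1 := by
    have := Nat.gcd_le_left (q - 1) (show 0 < n by omega)
    omega
  calc _ ≤ 2 ^ 27 * 64 ^ (n - 1) * parityFactor n ^ 6 * q ^ 5 := by gcongr; norm_num
    _ ≤ q ^ (2 * n - 5) * q ^ 5 := by
      gcongr
      exact (key n hn60 hn).trans (Nat.pow_le_pow_left hq _)
    _ = q ^ (2 * n) := by rw [← pow_add, Nat.sub_add_cancel (by omega)]

lemma sieveCriterion_of_sixty_le (hq : 5 ≤ q) (hn : 60 ≤ n) : SieveCriterion q n := by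
  obtain ⟨j, rfl⟩ := Nat.exists_eq_add_of_le hn
  refine sieveCriterion_of_le_pow hq (by omega) ?_
  set a := ((60 + j) + (60 + j).gcd (q - 1)) / 2 - 1 with ha
  have hpar : parityFactor (60 + j) ^ 6 ≤ 2 ^ 12 :=
    (Nat.pow_le_pow_left (parityFactor_le _) 6).trans (by norm_num)
  suffices h : 2 ^ 27 * 64 ^ a * 2 ^ 12 ≤ q ^ 115 * (q ^ 2) ^ j by
    calc _ ≤ 2 ^ 27 * 64 ^ a * 2 ^ 12 * q ^ 5 := by gcongr
      _ ≤ q ^ 115 * (q ^ 2) ^ j * q ^ 5 := by gcongr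
      _ = _ := by
        rw [← pow_mul]
        ring
  rcases le_or_gt 11 q with h11 | h11
  · have hA : a ≤ 59 + j := by
      have := Nat.gcd_le_left (q - 1) (show 0 < 60 + j by omega)
      omega
    calc 2 ^ 27 * 64 ^ a * 2 ^ 12 ≤ 2 ^ 27 * 64 ^ (59 + j) * 2 ^ 12 := by gcongr; norm_num
      _ = (2 ^ 39 * 64 ^ 59) * 64 ^ j := by ring
      _ ≤ 11 ^ 115 * (11 ^ 2) ^ j := by gcongr <;> norm_num
      _ ≤ _ := by gcongr
  · have hA : a * 2 ≤ 68 + j := by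
      have := Nat.gcd_le_right (60 + j) (show 0 < q - 1 by omega)
      omega
    calc 2 ^ 27 * 64 ^ a * 2 ^ 12 = 2 ^ 39 * 8 ^ (a * 2) := by
          rw [mul_comm a, pow_mul]
          norm_num
          ring
      _ ≤ 2 ^ 39 * 8 ^ (68 + j) := by gcongr; norm_num
      _ = (2 ^ 39 * 8 ^ 68) * 8 ^ j := by ring
      _ ≤ 5 ^ 115 * (5 ^ 2) ^ j := by gcongr <;> norm_num
      _ ≤ _ := by gcongr

/-- The sieve applies outside the exceptional list. -/
theorem sieveCriterion_of_not_mem_exceptional {p t : ℕ} (hp : p.Prime) (hp5 : 5 ≤ p) (ht : 1 ≤ t)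
    (hq : q = p ^ t) (hn : 3 ≤ n) (hgcd : n.gcd p = 1) (he : q ∉ exceptional n) :
    SieveCriterion q n := by
  have h5 : 5 ≤ q := hq ▸ hp5.trans (Nat.le_self_pow (by omega) p)
  rcases le_or_gt 60 n with h60 | h60
  · exact sieveCriterion_of_sixty_le h5 h60
  rcases lt_or_ge q (checkRange n + 5) with hlt | hge
  · have hbound : ∀ n < 60, checkRange n + 5 ≤ 5 ^ 20 := by decide
    exact sieveCriterion_of_sieveCheckBelow hp hp5 ht hq (by omega) hgcd
      (sieveCheckBelow_checkRange n h60 hn) hlt (hbound n h60) he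
  obtain rfl | rfl | hn5 : n = 3 ∨ n = 4 ∨ 5 ≤ n := by omega
  · exact sieveCriterion_three (by change 4405 ≤ q at hge; omega)
  · exact sieveCriterion_four (by change 1505 ≤ q at hge; omega)
  · exact sieveCriterion_of_five_le hn5 h60 hge

end LargeParameters

section ListArithmetic

/-- Evaluate the entries of `l` before passing it to `f`. -/
noncomputable def listForce {α : Type} (l : List ℕ) : (List ℕ → α) → α :=
  List.rec (motive := fun _ => (List ℕ → α) → α) (fun f => f [])
    (fun a _ ih f => Nat.rec (ih fun l => f (0 :: l)) (fun b _ => ih fun l => f (b.succ :: l)) a) l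

/-- The polynomial `c * u + v` modulo `p`, where polynomials are given by their lists of
coefficients. -/
noncomputable def axpy (p c : ℕ) (u : List ℕ) : List ℕ → List ℕ :=
  List.rec (motive := fun _ => List ℕ → List ℕ) (fun v => v)
    (fun a _ ih v => List.rec (motive := fun _ => List ℕ) ((c.mul a).mod p :: ih [])
      (fun b v _ => ((c.mul a).add b).mod p :: ih v) v) u

/-- Apply `f` to all but the last and the last entry of `b :: l`. -/
noncomputable def popLast {α : Type} (b : ℕ) (l : List ℕ) (f : List ℕ → ℕ → α) : α :=
  List.rec (motive := fun _ => ℕ → (List ℕ → ℕ → α) → α) (fun b f => f [] b)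
    (fun a _ ih b f => ih a fun i t => f (b :: i) t) l b f

/-- Multiplication of polynomials modulo `p` and `X ^ g.length - g`. -/
noncomputable def mulMod (p : ℕ) (g u v : List ℕ) : List ℕ :=
  List.rec (motive := fun _ => List ℕ) (g.map fun _ => 0)
    (fun c _ ih => listForce ih fun w => axpy p c u (popLast 0 w fun i t => axpy p t g i)) v

/-- Powers modulo `p` and `X ^ g.length - g`, for exponents less than `2 ^ fuel`. -/
noncomputable def powMod (p : ℕ) (g : List ℕ) : ℕ → ℕ → List ℕ → List ℕ
  | 0, _, _ => [1]
  | fuel + 1, e, u =>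
    bif e == 0 then [1] else
      listForce (powMod p g fuel (e / 2) u) fun h =>
        bif e % 2 == 0 then mulMod p g h h else mulMod p g u (mulMod p g h h)

/-- The iterated `q`-th powers of `u`. -/
noncomputable def conjList (p : ℕ) (g : List ℕ) (q : ℕ) : ℕ → List ℕ → List (List ℕ)
  | 0, _ => []
  | k + 1, u => u :: conjList p g q k (powMod p g 32 q u)

/-- A product whose non-vanishing implies linear independence over the field with `q` elements. -/
noncomputable def indepProd (p : ℕ) (g : List ℕ) (q : ℕ) : ℕ → List (List ℕ) → List ℕ
  | 0, _ => [1]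
  | _ + 1, [] => [1]
  | k + 1, v :: vs => mulMod p g v <| indepProd p g q k <| vs.map fun w =>
      axpy p (p - 1) (mulMod p g w (powMod p g 32 q v)) (mulMod p g (powMod p g 32 q w) v)

/-- A product whose non-vanishing implies that the order of the class of `X` is no smaller than
`m`, if `ls` contains the prime factors of `m`. -/
noncomputable def orderProd (p : ℕ) (g : List ℕ) (m : ℕ) : List ℕ → List ℕ
  | [] => [1]
  | ℓ :: ls => mulMod p g (axpy p (p - 1) [1] (powMod p g 32 (m / ℓ) [0, 1])) (orderProd p g m ls)

/-- Whether a polynomial is equal to `1`. -/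
def listIsOne : List ℕ → Bool
  | [] => false
  | c :: l => c == 1 && l.all (· == 0)

/-- Whether the class of `X` modulo `p` and `X ^ g.length - g` has order `(q ^ n - 1) / 2` and is
`1`-normal, where `ls` contains the prime factors of `(q ^ n - 1) / 2`. -/
noncomputable def witnessCheck (p q n : ℕ) (ls g : List ℕ) : Bool :=
  let m := (q ^ n - 1) / 2
  Nat.blt (q ^ n) (2 ^ 32) && ls.all (fun ℓ => decide ℓ.Prime) && ls.prod ^ 32 % m == 0 &&
    listIsOne (powMod p g 32 m [0, 1]) &&
    ((conjList p g q n [0, 1]).foldr (axpy p 1) []).all (· == 0) &&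
    listIsOne (powMod p g 32 (q ^ n - 1)
      (mulMod p g (orderProd p g m ls) (indepProd p g q n (conjList p g q (n - 1) [0, 1]))))

/-- The data `(p, t, n, ls, g)` of an element for each exceptional pair. -/
def witnessData : List (ℕ × ℕ × ℕ × List ℕ × List ℕ) := [
  (5, 1, 3, [2, 31], [4, 3, 0]),
  (7, 1, 3, [3, 19], [2, 1, 0]),
  (11, 1, 3, [5, 7, 19], [3, 1, 0]),
  (13, 1, 3, [2, 3, 61], [4, 1, 0]),
  (19, 1, 3, [3, 127], [4, 1, 0]),
  (5, 2, 3, [2, 3, 7, 31], [1, 2, 3, 2, 4, 0]),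
  (31, 1, 3, [3, 5, 331], [7, 3, 0]),
  (37, 1, 3, [2, 3, 7, 67], [3, 2, 0]),
  (43, 1, 3, [3, 7, 631], [9, 4, 0]),
  (7, 2, 3, [2, 3, 19, 43], [3, 3, 5, 1, 1, 0]),
  (61, 1, 3, [2, 3, 5, 13, 97], [4, 1, 0]),
  (67, 1, 3, [3, 7, 11, 31], [4, 4, 0]),
  (79, 1, 3, [3, 7, 13, 43], [2, 6, 0]),
  (109, 1, 3, [2, 3, 7, 571], [12, 3, 0]),
  (11, 2, 3, [2, 3, 5, 7, 19, 37], [7, 9, 5, 1, 8, 0]),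
  (163, 1, 3, [3, 7, 19, 67], [4, 13, 0]),
  (5, 1, 4, [2, 3, 13], [1, 1, 0, 0]),
  (7, 1, 4, [2, 3, 5], [3, 1, 0, 0]),
  (11, 1, 4, [2, 3, 5, 61], [2, 5, 0, 0]),
  (13, 1, 4, [2, 3, 5, 7, 17], [3, 4, 0, 0]),
  (17, 1, 4, [2, 3, 5, 29], [2, 8, 1, 0]),
  (19, 1, 4, [2, 3, 5, 181], [2, 4, 0, 0]),
  (23, 1, 4, [2, 3, 5, 11, 53], [7, 2, 21, 0]),
  (5, 2, 4, [2, 3, 13, 313], [1, 0, 4, 3, 2, 3, 4, 0]),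
  (29, 1, 4, [2, 3, 5, 7, 421], [7, 8, 0, 0]),
  (37, 1, 4, [2, 3, 5, 19, 137], [7, 2, 0, 0]),
  (41, 1, 4, [2, 3, 5, 7, 29], [2, 6, 0, 0]),
  (47, 1, 4, [2, 3, 5, 13, 17, 23], [5, 5, 0, 0]),
  (53, 1, 4, [2, 3, 5, 13, 281], [10, 4, 0, 0]),
  (83, 1, 4, [2, 3, 5, 7, 13, 41, 53], [2, 14, 0, 0]),
  (5, 1, 6, [2, 3, 7, 31], [1, 2, 1, 2, 1, 0]),
  (7, 1, 6, [2, 3, 19, 43], [3, 0, 0, 5, 4, 0]),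
  (5, 1, 8, [2, 3, 13, 313], [1, 2, 3, 4, 2, 3, 3, 0])]

set_option maxRecDepth 100000 in
lemma witnessCheck_witnessData : ∀ w ∈ witnessData,
    witnessCheck w.1 (w.1 ^ w.2.1) w.2.2.1 w.2.2.2.1 w.2.2.2.2 = true := by
  decide +kernel

lemma exists_mem_witnessData {q n : ℕ} (h : q ∈ exceptional n) :
    ∃ w ∈ witnessData, w.1 ^ w.2.1 = q ∧ w.2.2.1 = n ∧ 1 ≤ w.2.1 ∧ w.1.Prime ∧
      2 ≤ w.2.2.2.2.length := by
  have key : ∀ n < 9, ∀ q ∈ exceptional n, ∃ w ∈ witnessData, w.1 ^ w.2.1 = q ∧ w.2.2.1 = n ∧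
      1 ≤ w.2.1 ∧ w.1.Prime ∧ 2 ≤ w.2.2.2.2.length := by decide +kernel
  refine key n ?_ q h
  by_contra! hn
  unfold exceptional at h
  split at h <;> first | omega | simp at h

end ListArithmetic

section WitnessSoundness

open Polynomial Module

/-- The value at `a` of the polynomial with the given list of coefficients. -/
def evalList {R : Type*} [CommRing R] (a : R) : List ℕ → R
  | [] => 0
  | c :: l => c + a * evalList a l

/-- A sequence of elements, given by a list, whose product of leading terms controls linear
independence over the field with `q` elements. -/
def frobeniusElimination {R : Type*} [CommRing R] (q : ℕ) : ℕ → List R → R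
  | 0, _ => 1
  | _ + 1, [] => 1
  | k + 1, v :: vs => v * frobeniusElimination q k (vs.map fun w => w ^ q * v - w * v ^ q)

/-- The list `u` is a polynomial of degree less than `g.length` with value `x` at `a`. -/
structure Represents {R : Type*} [CommRing R] (a : R) (g u : List ℕ) (x : R) : Prop where
  length_le : u.length ≤ g.length
  eval_eq : evalList a u = x

section Ring

variable {R : Type*} [CommRing R] {p : ℕ} {a : R} {g : List ℕ}

lemma map_evalList {S : Type*} [CommRing S] (φ : R →+* S) (a : R) (l : List ℕ) :
    φ (evalList a l) = evalList (φ a) l := by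
  induction l with
  | nil => simp [evalList]
  | cons c l ih => simp [evalList, ih]

lemma listForce_eq {α : Type} (l : List ℕ) (f : List ℕ → α) : listForce l f = f l := by
  induction l generalizing f with
  | nil => rfl
  | cons a l ih =>
    cases a with
    | zero => exact ih fun l => f (0 :: l)
    | succ b => exact ih fun l => f (b.succ :: l)

lemma cast_mod_of_cast_eq_zero (hp : (p : R) = 0) (c : ℕ) : ((c.mod p : ℕ) : R) = c := by
  conv_rhs => rw [← Nat.div_add_mod c p]
  push_cast
  rw [hp, zero_mul, zero_add]
  rfl

lemma evalList_axpy (hp : (p : R) = 0) (a : R) (c : ℕ) (u v : List ℕ) :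
    evalList a (axpy p c u v) = c * evalList a u + evalList a v := by
  induction u generalizing v with
  | nil => simp [axpy, evalList]
  | cons b u ih =>
    cases v with
    | nil =>
      change (((c.mul b).mod p : ℕ) : R) + a * evalList a (axpy p c u []) = _
      rw [ih, cast_mod_of_cast_eq_zero hp, Nat.mul_eq, evalList, evalList]
      push_cast
      ring
    | cons d v =>
      change ((((c.mul b).add d).mod p : ℕ) : R) + a * evalList a (axpy p c u v) = _
      rw [ih, cast_mod_of_cast_eq_zero hp, Nat.mul_eq, Nat.add_eq, evalList, evalList]
      push_cast
      ring

lemma length_axpy (p c : ℕ) (u v : List ℕ) :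
    (axpy p c u v).length = max u.length v.length := by
  induction u generalizing v with
  | nil => simp [axpy]
  | cons b u ih =>
    cases v with
    | nil =>
      change (axpy p c u []).length + 1 = _
      simp [ih]
    | cons d v =>
      change (axpy p c u v).length + 1 = _
      simp [ih]

lemma popLast_spec {α : Type} (a : R) (b : ℕ) (l : List ℕ) (f : List ℕ → ℕ → α) :
    ∃ i t, popLast b l f = f i t ∧ i.length = l.length ∧
      evalList a (b :: l) = evalList a i + a ^ l.length * t := by
  induction l generalizing b f with
  | nil => exact ⟨[], b, rfl, rfl, by simp [evalList]⟩
  | cons c l ih =>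
    obtain ⟨i, t, h, hl, he⟩ := ih c fun i t => f (b :: i) t
    refine ⟨b :: i, t, h, by simp [hl], ?_⟩
    rw [evalList, he, evalList, List.length_cons]
    ring

lemma represents_one (hg : 1 ≤ g.length) : Represents a g [1] 1 :=
  ⟨hg, by simp [evalList]⟩

lemma represents_X (hg : 2 ≤ g.length) : Represents a g [0, 1] a :=
  ⟨hg, by simp [evalList]⟩

lemma Represents.axpy (hp : (p : R) = 0) {u v : List ℕ} {x y : R} (c : ℕ)
    (hu : Represents a g u x) (hv : Represents a g v y) :
    Represents a g (axpy p c u v) (c * x + y) :=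
  ⟨by rw [length_axpy]; exact max_le hu.1 hv.1, by rw [evalList_axpy hp, hu.2, hv.2]⟩

lemma Represents.sub (hp : (p : R) = 0) (hp1 : 1 ≤ p) {u v : List ℕ} {x y : R}
    (hu : Represents a g u x) (hv : Represents a g v y) :
    Represents a g (_root_.axpy p (p - 1) v u) (x - y) := by
  have := hv.axpy hp (p - 1) hu
  rw [Nat.cast_sub hp1, hp] at this
  convert this using 1
  push_cast
  ring

lemma mulMod_spec (hp : (p : R) = 0) (hg : a ^ g.length = evalList a g) {u : List ℕ} {x : R}
    (hu : Represents a g u x) (v : List ℕ) :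
    (mulMod p g u v).length = g.length ∧ evalList a (mulMod p g u v) = x * evalList a v := by
  induction v with
  | nil =>
    refine ⟨List.length_map _, ?_⟩
    change evalList a (g.map fun _ => 0) = _
    rw [evalList, mul_zero]
    clear hg hu
    induction g with
    | nil => rfl
    | cons b g ih => rw [List.map_cons, evalList, ih, Nat.cast_zero, mul_zero, add_zero]
  | cons c v ih =>
    have h : mulMod p g u (c :: v) = listForce (mulMod p g u v) fun w =>
      axpy p c u (popLast 0 w fun i t => axpy p t g i) := rfl
    rw [h, listForce_eq]
    obtain ⟨i, t, hf, hl, he⟩ := popLast_spec a 0 (mulMod p g u v) fun i t => axpy p t g i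
    rw [hf, length_axpy, length_axpy, hl, ih.1, evalList_axpy hp, evalList_axpy hp, hu.2]
    refine ⟨by simpa using hu.1, ?_⟩
    rw [evalList, ih.1, ih.2, hg] at he
    push_cast at he
    rw [evalList]
    linear_combination -he

lemma Represents.mulMod (hp : (p : R) = 0) (hg : a ^ g.length = evalList a g) {u v : List ℕ}
    {x y : R} (hu : Represents a g u x) (hv : Represents a g v y) :
    Represents a g (mulMod p g u v) (x * y) :=
  ⟨(mulMod_spec hp hg hu v).1.le, by rw [(mulMod_spec hp hg hu v).2, hv.2]⟩

lemma Represents.powMod (hp : (p : R) = 0) (hg : a ^ g.length = evalList a g)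
    (hg1 : 1 ≤ g.length) {u : List ℕ} {x : R} (hu : Represents a g u x) {fuel e : ℕ}
    (he : e < 2 ^ fuel) : Represents a g (powMod p g fuel e u) (x ^ e) := by
  induction fuel generalizing e with
  | zero =>
    obtain rfl : e = 0 := by simpa using he
    rw [pow_zero]
    exact represents_one hg1
  | succ fuel ih =>
    have h := ih (e := e / 2) (by rw [pow_succ] at he; omega)
    rw [_root_.powMod, listForce_eq]
    rcases eq_or_ne e 0 with rfl | h0
    · simpa using represents_one hg1
    rw [show (e == 0) = false by simpa using h0, cond_false]
    rcases Nat.mod_two_eq_zero_or_one e with h2 | h2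
    · have hm := h.mulMod hp hg h
      rw [← pow_add, ← two_mul, Nat.mul_div_cancel' (Nat.dvd_of_mod_eq_zero h2)] at hm
      simpa [h2] using hm
    · have hm := hu.mulMod hp hg (h.mulMod hp hg h)
      rw [← pow_add, ← two_mul, ← pow_succ', show 2 * (e / 2) + 1 = e by omega] at hm
      simpa [h2] using hm

lemma evalList_eq_zero_of_all (a : R) {l : List ℕ} (h : l.all (· == 0) = true) :
    evalList a l = 0 := by
  induction l with
  | nil => rfl
  | cons c l ih =>
    rw [List.all_cons, Bool.and_eq_true, beq_iff_eq] at h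
    simp [evalList, h.1, ih h.2]

lemma evalList_eq_one_of_listIsOne (a : R) {l : List ℕ} (h : listIsOne l = true) :
    evalList a l = 1 := by
  cases l with
  | nil => simp [listIsOne] at h
  | cons c l =>
    rw [listIsOne, Bool.and_eq_true, beq_iff_eq] at h
    simp [evalList, h.1, evalList_eq_zero_of_all a h.2]

variable {q : ℕ}

lemma forall₂_represents_conjList (hp : (p : R) = 0) (hg : a ^ g.length = evalList a g)
    (hg1 : 1 ≤ g.length) (hq : q < 2 ^ 32) {k : ℕ} {u : List ℕ} {x : R}
    (hu : Represents a g u x) : List.Forall₂ (Represents a g) (conjList p g q k u)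
      (List.ofFn fun i : Fin k => x ^ q ^ (i : ℕ)) := by
  induction k generalizing u x with
  | zero => simp [conjList]
  | succ k ih =>
    rw [conjList, List.ofFn_succ]
    refine .cons (by simpa using hu) ?_
    simpa [← pow_mul, ← pow_succ'] using ih (hu.powMod hp hg hg1 hq)

lemma represents_sum (hp : (p : R) = 0) {us : List (List ℕ)} {xs : List R}
    (h : List.Forall₂ (Represents a g) us xs) :
    Represents a g (us.foldr (axpy p 1) []) xs.sum := by
  induction h with
  | nil => exact ⟨by simp, rfl⟩
  | cons h _ ih => simpa using h.axpy hp 1 ih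

lemma represents_indepProd (hp : (p : R) = 0) (hp1 : 1 ≤ p) (hg : a ^ g.length = evalList a g)
    (hg1 : 1 ≤ g.length) (hq : q < 2 ^ 32) {k : ℕ} {us : List (List ℕ)} {xs : List R}
    (h : List.Forall₂ (Represents a g) us xs) :
    Represents a g (indepProd p g q k us) (frobeniusElimination q k xs) := by
  induction k generalizing us xs with
  | zero => exact represents_one hg1
  | succ k ih =>
    cases h with
    | nil => exact represents_one hg1
    | cons h hs =>
      refine h.mulMod hp hg (ih ?_)
      rw [List.forall₂_map_left_iff, List.forall₂_map_right_iff]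
      refine hs.imp fun u x hu => ?_
      exact ((hu.powMod hp hg hg1 hq).mulMod hp hg h).sub hp hp1
        (hu.mulMod hp hg (h.powMod hp hg hg1 hq))

lemma represents_orderProd (hp : (p : R) = 0) (hp1 : 1 ≤ p) (hg : a ^ g.length = evalList a g)
    (hg2 : 2 ≤ g.length) {m : ℕ} (hm : m < 2 ^ 32) (ls : List ℕ) :
    Represents a g (orderProd p g m ls) (ls.map fun ℓ => a ^ (m / ℓ) - 1).prod := by
  induction ls with
  | nil => exact represents_one (by omega)
  | cons ℓ ls ih =>
    rw [List.map_cons, List.prod_cons]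
    refine Represents.mulMod hp hg (Represents.sub hp hp1 ?_ (represents_one (by omega))) ih
    exact (represents_X hg2).powMod hp hg (by omega) ((Nat.div_le_self _ _).trans_lt hm)

/-- The consequences of `witnessCheck` for a root of `X ^ g.length - g`. -/
lemma witnessCheck_spec {n : ℕ} {ls : List ℕ} (hn : 1 ≤ n)
    (h : witnessCheck p q n ls g = true)
    (hp : (p : R) = 0) (hp1 : 1 ≤ p) (hg : a ^ g.length = evalList a g) (hg2 : 2 ≤ g.length) :
    a ^ ((q ^ n - 1) / 2) = 1 ∧ ∑ i : Fin n, a ^ q ^ (i : ℕ) = 0 ∧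
      ((ls.map fun ℓ => a ^ ((q ^ n - 1) / 2 / ℓ) - 1).prod *
        frobeniusElimination q n (List.ofFn fun i : Fin (n - 1) => a ^ q ^ (i : ℕ))) ^
          (q ^ n - 1) = 1 := by
  simp only [witnessCheck, Bool.and_eq_true, Nat.blt_eq] at h
  obtain ⟨⟨⟨⟨⟨hlt, -⟩, -⟩, h1⟩, h2⟩, h3⟩ := h
  have hq32 : q < 2 ^ 32 := (Nat.le_self_pow (by omega) q).trans_lt hlt
  have hX : Represents a g [0, 1] a := represents_X hg2
  refine ⟨?_, ?_, ?_⟩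
  · rw [← evalList_eq_one_of_listIsOne a h1]
    exact (hX.powMod hp hg (by omega) (by omega)).eval_eq.symm
  · rw [← evalList_eq_zero_of_all a h2, ← List.sum_ofFn]
    exact (represents_sum hp (forall₂_represents_conjList hp hg (by omega) hq32 hX)).eval_eq.symm
  · refine Eq.trans ?_ (evalList_eq_one_of_listIsOne a h3)
    refine (Represents.powMod hp hg (by omega) ?_ (by omega)).eval_eq.symm
    exact (represents_orderProd hp hp1 hg hg2 (by omega) ls).mulMod hp hg
      (represents_indepProd hp hp1 hg (by omega) hq32
        (forall₂_represents_conjList hp hg (by omega) hq32 hX))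

end Ring

section Field

universe u

variable {K L : Type*} [Field K] [Field L] [Algebra K L] [Fintype K]

lemma linearIndependent_of_frobenius {k : ℕ} {v : Fin (k + 1) → L} (h0 : v 0 ≠ 0)
    (h : LinearIndependent K fun i : Fin k =>
      v i.succ ^ Fintype.card K * v 0 - v i.succ * v 0 ^ Fintype.card K) :
    LinearIndependent K v := by
  rw [Fintype.linearIndependent_iff] at h ⊢
  intro c hc
  have hF : ∑ i, c i • v i ^ Fintype.card K = 0 := by
    have := congrArg (FiniteField.frobeniusAlgHom K L) hc
    simpa [map_sum, FiniteField.coe_frobeniusAlgHom] using this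
  have key : ∀ i : Fin k, c i.succ = 0 := by
    refine h (fun i => c i.succ) ?_
    have h1 : (∑ i, c i • v i ^ Fintype.card K) * v 0 - (∑ i, c i • v i) * v 0 ^ Fintype.card K
        = 0 := by rw [hF, hc, zero_mul, zero_mul, sub_zero]
    rw [Finset.sum_mul, Finset.sum_mul, ← Finset.sum_sub_distrib, Fin.sum_univ_succ] at h1
    rw [← h1]
    simp only [smul_mul_assoc, smul_sub]
    rw [mul_comm (v 0), sub_self, zero_add]
  intro i
  refine Fin.cases ?_ key i
  rw [Fin.sum_univ_succ] at hc
  simpa [key, h0] using hc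

lemma linearIndependent_of_frobeniusElimination {k : ℕ} {vs : List L} (hk : vs.length ≤ k)
    (h : frobeniusElimination (Fintype.card K) k vs ≠ 0) : LinearIndependent K vs.get := by
  induction k generalizing vs with
  | zero =>
    obtain rfl : vs = [] := List.length_eq_zero_iff.1 (by omega)
    exact linearIndependent_empty_type (ι := Fin 0)
  | succ k ih =>
    cases vs with
    | nil => exact linearIndependent_empty_type (ι := Fin 0)
    | cons v vs =>
      rw [frobeniusElimination] at h
      have h1 := ih (by simpa using hk) (right_ne_zero_of_mul h)
      refine linearIndependent_of_frobenius (k := vs.length) (left_ne_zero_of_mul h) ?_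
      have h2 := h1.comp (Fin.cast (List.length_map _).symm) (Fin.cast_injective _)
      convert h2 using 1
      ext i
      simp

lemma finrank_conjSpan_of_sum_eq_zero {n : ℕ} {α : L} (hn : 1 ≤ n)
    (htr : ∑ i : Fin n, α ^ Fintype.card K ^ (i : ℕ) = 0)
    (hind : LinearIndependent K fun i : Fin (n - 1) => α ^ Fintype.card K ^ (i : ℕ)) :
    finrank K (conjSpan K (Fintype.card K) n α) = n - 1 := by
  obtain ⟨k, rfl⟩ : ∃ k, n = k + 1 := ⟨n - 1, by omega⟩
  have hspan : conjSpan K (Fintype.card K) (k + 1) α =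
      Submodule.span K (Set.range fun i : Fin k => α ^ Fintype.card K ^ (i : ℕ)) := by
    refine le_antisymm (Submodule.span_le.2 ?_) (Submodule.span_mono ?_)
    · rintro _ ⟨i, rfl⟩
      refine Fin.lastCases ?_ (fun j => ?_) i
      · rw [Fin.sum_univ_castSucc, add_comm] at htr
        simp only [eq_neg_of_add_eq_zero_left htr]
        exact Submodule.neg_mem _ (Submodule.sum_mem _ fun j _ =>
          Submodule.subset_span ⟨j, by simp⟩)
      · exact Submodule.subset_span ⟨j, by simp⟩
    · rintro _ ⟨j, rfl⟩
      exact ⟨j.castSucc, by simp⟩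
  have hind' : LinearIndependent K fun i : Fin k => α ^ Fintype.card K ^ (i : ℕ) := hind
  rw [hspan, finrank_span_eq_card hind', Fintype.card_fin, Nat.add_sub_cancel]

lemma degree_evalList_X_lt {R : Type*} [CommRing R] (l : List ℕ) :
    (evalList (X : R[X]) l).degree < l.length := by
  induction l with
  | nil => simp [evalList]
  | cons c l ih =>
    rw [evalList, List.length_cons]
    refine (degree_add_le _ _).trans_lt (max_lt ?_ ?_)
    · exact (degree_natCast_le c).trans_lt (by exact_mod_cast Nat.succ_pos _)
    · nontriviality R
      rw [mul_comm, degree_mul_X]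
      push_cast
      exact WithBot.add_lt_add_right (by simp) ih

lemma exists_pow_eq_evalList {L : Type u} [Field L] [Fintype L] {m : ℕ} {g : List ℕ}
    (hg : 1 ≤ g.length) (hm : m ∣ Fintype.card L - 1)
    (h : ∀ {R : Type u} [CommRing R] [Algebra L R] (a : R), a ^ g.length = evalList a g →
      a ^ m = 1) : ∃ α : L, α ^ g.length = evalList α g := by
  obtain ⟨f, hf⟩ : ∃ f : L[X], f = X ^ g.length - evalList X g := ⟨_, rfl⟩
  have hdeg : f.degree = g.length := by
    rw [hf, degree_sub_eq_left_of_degree_lt] <;> rw [degree_X_pow]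
    exact degree_evalList_X_lt g
  have hdvd : f ∣ X ^ m - 1 := by
    rw [← AdjoinRoot.mk_eq_zero, map_sub, map_pow, map_one, AdjoinRoot.mk_X, sub_eq_zero]
    refine h _ ?_
    rw [← AdjoinRoot.mk_X, ← map_pow, ← map_evalList, ← sub_eq_zero, ← map_sub, ← hf,
      AdjoinRoot.mk_self]
  have hdvd' : f ∣ X ^ Fintype.card L - X := by
    obtain ⟨k, hk⟩ := hm
    rw [show Fintype.card L = m * k + 1 by have := Fintype.card_pos (α := L); omega]
    refine hdvd.trans ((sub_dvd_pow_sub_pow (X ^ m) 1 k).trans ⟨X, ?_⟩)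
    rw [one_pow, ← pow_mul]
    ring
  have hsplit : f.Splits := by
    have := (FiniteField.isSplittingField_sub L L).splits
    rw [Algebra.algebraMap_self, Polynomial.map_id] at this
    exact this.of_dvd (FiniteField.X_pow_card_sub_X_ne_zero L Fintype.one_lt_card) hdvd'
  obtain ⟨α, hα⟩ := hsplit.exists_eval_eq_zero (by
    rw [hdeg]
    exact_mod_cast (by omega : g.length ≠ 0))
  refine ⟨α, ?_⟩
  have := map_evalList (evalRingHom α) X g
  rw [coe_evalRingHom, eval_X] at this
  rwa [hf, eval_sub, eval_pow, eval_X, this, sub_eq_zero] at hα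

lemma orderOf_eq_of_map_prod_ne_zero {m : ℕ} {ls : List ℕ} {α : L} (hm : 0 < m)
    (hls : ∀ ℓ ∈ ls, ℓ.Prime) (hdvd : m ∣ ls.prod ^ 32) (hα : α ^ m = 1)
    (h : (ls.map fun ℓ => α ^ (m / ℓ) - 1).prod ≠ 0) : orderOf α = m := by
  refine orderOf_eq_of_pow_and_pow_div_prime hm hα fun ℓ hℓ hℓm h1 => h ?_
  obtain ⟨r, hr, hr'⟩ :=
    (hℓ.prime.dvd_prod_iff).1 (hℓ.dvd_of_dvd_pow (hℓm.trans hdvd))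
  obtain rfl := (Nat.prime_dvd_prime_iff_eq hℓ (hls r hr)).1 hr'
  exact List.prod_eq_zero (List.mem_map.2 ⟨ℓ, hr, by rw [h1, sub_self]⟩)

lemma prime_and_dvd_of_witnessCheck {p q n : ℕ} {ls g : List ℕ}
    (h : witnessCheck p q n ls g = true) :
    (∀ ℓ ∈ ls, ℓ.Prime) ∧ (q ^ n - 1) / 2 ∣ ls.prod ^ 32 := by
  simp only [witnessCheck, Bool.and_eq_true, List.all_eq_true, decide_eq_true_eq, beq_iff_eq] at h
  exact ⟨h.1.1.1.1.2, Nat.dvd_of_mod_eq_zero h.1.1.1.2⟩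

lemma exists_of_witnessCheck {K : Type*} {L : Type u} [Field K] [Field L] [Algebra K L]
    [Fintype K] [Fintype L] {p n : ℕ} {ls g : List ℕ} (hp : (p : L) = 0) (hp1 : 1 ≤ p)
    (hn : 1 ≤ n) (hq : 3 ≤ Fintype.card K) (hodd : Odd (Fintype.card K))
    (hL : Fintype.card L = Fintype.card K ^ n) (hg : 2 ≤ g.length)
    (h : witnessCheck p (Fintype.card K) n ls g = true) :
    ∃ α : L, orderOf α = (Fintype.card L - 1) / 2 ∧
      finrank K (conjSpan K (Fintype.card K) n α) = n - 1 := by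
  have h3 : 3 ≤ Fintype.card L := hL ▸ hq.trans (Nat.le_self_pow (by omega) _)
  have hdvd : (Fintype.card L - 1) / 2 ∣ Fintype.card L - 1 := by
    refine Nat.div_dvd_of_dvd ?_
    obtain ⟨k, hk⟩ := hL ▸ hodd.pow (n := n)
    exact ⟨k, by omega⟩
  obtain ⟨α, hα⟩ := exists_pow_eq_evalList (L := L) (by omega : 1 ≤ g.length) hdvd
    fun {R} _ _ a ha => by
      have hpR : (p : R) = 0 := by rw [← map_natCast (algebraMap L R), hp, map_zero]
      rw [hL]
      exact (witnessCheck_spec hn h hpR hp1 ha hg).1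
  obtain ⟨h1, htr, hz⟩ := witnessCheck_spec hn h hp hp1 hα hg
  have hne := ne_zero_pow (n := Fintype.card K ^ n - 1) (by omega) (hz.trans_ne one_ne_zero)
  obtain ⟨hls, hls'⟩ := prime_and_dvd_of_witnessCheck h
  rw [← hL] at h1 hls' hne
  refine ⟨α, orderOf_eq_of_map_prod_ne_zero (by omega) hls hls' h1 (left_ne_zero_of_mul hne), ?_⟩
  refine finrank_conjSpan_of_sum_eq_zero hn htr ?_
  have hind := linearIndependent_of_frobeniusElimination (K := K) (by simp)
    (right_ne_zero_of_mul hne)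
  have hind' := hind.comp (Fin.cast (List.length_ofFn).symm) (Fin.cast_injective _)
  convert hind' using 1
  ext i
  simp

end Field

end WitnessSoundness

/-- Let `q` be a power of a prime `p ≥ 5` and `n ≥ 3` with `gcd(n, p) = 1`. Then there exists
an element of `F_{q^n}` that is simultaneously `2`-primitive and `1`-normal over `F_q`. -/
theorem stmt_6 (p t q n : ℕ) (hp : p.Prime) (hp5 : 5 ≤ p) (ht : 1 ≤ t) (hq : q = p ^ t)
    (hn : 3 ≤ n) (hgcd : Nat.gcd n p = 1)
    (K L : Type*) [Field K] [Field L] [Algebra K L] [Fintype K] [Fintype L]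
    (hK : Fintype.card K = q) (hL : Fintype.card L = q ^ n) :
    ∃ α : L, orderOf α = (q ^ n - 1) / 2 ∧
      Module.finrank K (conjSpan K q n α) = n - 1 := by
  obtain rfl := hK
  have hodd : Odd (Fintype.card K) := hq ▸ (hp.odd_of_ne_two (by omega)).pow
  have hq5 : 5 ≤ Fintype.card K := hq ▸ hp5.trans (Nat.le_self_pow (by omega) _)
  by_cases he : Fintype.card K ∈ exceptional n
  · obtain ⟨⟨r, s, n, ls, g⟩, hw, hrs, rfl, hs, hr, hg⟩ := exists_mem_witnessData he
    have hcheck := witnessCheck_witnessData _ hw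
    simp only at hrs hs hr hg hcheck hL
    rw [hrs] at hcheck
    have : Fact r.Prime := ⟨hr⟩
    have hchar : CharP L r := charP_of_card_eq_prime_pow (f := s * n) (by rw [hL, ← hrs, pow_mul])
    rw [← hL]
    exact exists_of_witnessCheck (CharP.cast_eq_zero L r) hr.one_le (by omega) (by omega) hodd hL hg
      hcheck
  · have hrank : Module.finrank K L = n :=
      Nat.pow_right_injective (by omega : 2 ≤ Fintype.card K)
        ((Module.card_eq_pow_finrank (K := K) (V := L)).symm.trans hL)
    have : Fact p.Prime := ⟨hp⟩
    have hchar : CharP K p := charP_of_card_eq_prime_pow (f := t) hq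
    have hnK : (Module.finrank K L : K) ≠ 0 := by
      rw [hrank, Ne, CharP.cast_eq_zero_iff K p]
      exact (hp.coprime_iff_not_dvd).1 (Nat.coprime_comm.1 hgcd)
    have hsieve : SieveCriterion (Fintype.card K) (Module.finrank K L) := by
      rw [hrank]
      exact sieveCriterion_of_not_mem_exceptional hp hp5 ht hq hn hgcd he
    have h := exists_of_sieveCriterion (K := K) (L := L) hodd (by omega) hnK hsieve
    rwa [hrank, hL] at h
end
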